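/- For every Schottky group Γ there exists a transverse quasi-circle. -/

import Mathlib

open Filter Set Topology
open scoped ENNReal NNReal
noncomputable section

abbrev SL2C := Matrix.SpecialLinearGroup (Fin 2) ℂ
noncomputable instance : TopologicalSpace SL2C := instTopologicalSpaceSubtype
abbrev PSL2C := SL2C ⧸ Subgroup.center SL2C

/-- The Riemann sphere, as a type synonym for the one-point extension of `ℂ`,
equipped with (a bi-Lipschitz copy of) the chordal metric via stereographic embedding. -/
def RSphere : Type := OnePoint ℂ

namespace RSphere

def infty : RSphere := OnePoint.infty
def ofC (z : ℂ) : RSphere := (z : OnePoint ℂ)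
instance : Coe ℂ RSphere := ⟨ofC⟩

/-- Stereographic/chordal embedding of the Riemann sphere into `ℂ × ℝ`. -/
def chordalEmbed : RSphere → ℂ × ℝ := fun z =>
  OnePoint.rec ((0 : ℂ), (1 : ℝ))
    (fun w => (2 * w / (1 + ‖w‖ ^ 2), (‖w‖ ^ 2 - 1) / (‖w‖ ^ 2 + 1))) (z : OnePoint ℂ)

lemma chordalEmbed_injective : Function.Injective chordalEmbed := by
  have key : ∀ z w : ℂ, chordalEmbed (ofC z) = chordalEmbed (ofC w) → z = w := by
    intro z w h
    have hz : (0:ℝ) < 1 + ‖z‖ ^ 2 := by positivity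
    have hw : (0:ℝ) < 1 + ‖w‖ ^ 2 := by positivity
    have h1 : 2 * z / (1 + ‖z‖ ^ 2) = 2 * w / (1 + ‖w‖ ^ 2) := congrArg Prod.fst h
    have h2 : (‖z‖ ^ 2 - 1) / (‖z‖ ^ 2 + 1) = (‖w‖ ^ 2 - 1) / (‖w‖ ^ 2 + 1) := congrArg Prod.snd h
    have hnorm : ‖z‖ ^ 2 = ‖w‖ ^ 2 := by
      rw [div_eq_div_iff (by positivity) (by positivity)] at h2
      nlinarith [h2]
    have hn : ‖z‖ = ‖w‖ := by nlinarith [norm_nonneg z, norm_nonneg w]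
    rw [hn] at h1
    have hden : ((1:ℂ) + (‖w‖:ℂ) ^ 2) ≠ 0 := by
      intro hc
      have hre : (1:ℝ) + ‖w‖ ^ 2 = 0 := by exact_mod_cast hc
      nlinarith [norm_nonneg w]
    rw [div_eq_div_iff hden hden] at h1
    have h1' : (2:ℂ) * z = 2 * w := mul_right_cancel₀ hden h1
    exact mul_left_cancel₀ two_ne_zero h1'
  intro a b h
  induction a using OnePoint.rec with
  | infty =>
    induction b using OnePoint.rec with
    | infty => rfl
    | coe w =>
      exfalso
      have h2 : (1:ℝ) = (‖w‖ ^ 2 - 1) / (‖w‖ ^ 2 + 1) := congrArg Prod.snd h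
      have hw : (0:ℝ) < ‖w‖ ^ 2 + 1 := by positivity
      rw [eq_div_iff (ne_of_gt hw)] at h2
      nlinarith
  | coe z =>
    induction b using OnePoint.rec with
    | infty =>
      exfalso
      have h2 : (‖z‖ ^ 2 - 1) / (‖z‖ ^ 2 + 1) = (1:ℝ) := congrArg Prod.snd h
      have hz : (0:ℝ) < ‖z‖ ^ 2 + 1 := by positivity
      rw [div_eq_iff (ne_of_gt hz)] at h2
      nlinarith
    | coe w => exact congrArg ofC (key z w h)

instance : MetricSpace RSphere := MetricSpace.induced chordalEmbed chordalEmbed_injective inferInstance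
instance : MeasurableSpace RSphere := borel RSphere
instance : BorelSpace RSphere := ⟨rfl⟩

end RSphere

open RSphere MeasureTheory

/-- The Möbius transformation of the Riemann sphere associated to a matrix in `SL(2,ℂ)`. -/
def mobius (g : SL2C) : RSphere → RSphere := fun z =>
  OnePoint.rec
    (if g.1 1 0 = 0 then RSphere.infty else RSphere.ofC (g.1 0 0 / g.1 1 0))
    (fun w => if g.1 1 0 * w + g.1 1 1 = 0 then RSphere.infty
      else RSphere.ofC ((g.1 0 0 * w + g.1 0 1) / (g.1 1 0 * w + g.1 1 1)))
    (z : OnePoint ℂ)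

/-- The orbit of a point of the Riemann sphere under a subgroup of `PSL(2,ℂ)`
(described via arbitrary lifts to `SL(2,ℂ)`). -/
def mobiusOrbit (Γ : Subgroup PSL2C) (z : RSphere) : Set RSphere :=
  {w | ∃ g : SL2C, (g : PSL2C) ∈ Γ ∧ mobius g z = w}

/-- The limit set of a subgroup of `PSL(2,ℂ)`: the set of accumulation points of orbits. -/
def limitSet (Γ : Subgroup PSL2C) : Set RSphere :=
  {w | ∃ z : RSphere, AccPt w (Filter.principal (mobiusOrbit Γ z))}

/-- The Hausdorff dimension of the limit set. -/
noncomputable def limitDim (Γ : Subgroup PSL2C) : ℝ≥0∞ := dimH (limitSet Γ)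

/-- A Kleinian group: a finitely generated discrete subgroup of `PSL(2,ℂ)`. -/
def IsKleinian (Γ : Subgroup PSL2C) : Prop :=
  DiscreteTopology Γ ∧ Subgroup.FG Γ

/-- A conical limit point (in the dynamical, Beardon–Maskit/Bowditch sense):
there are group elements `γ n` and distinct points `a ≠ b` with `γ n • x → a` while
`γ n • y → b` for every `y ≠ x`. -/
def IsConicalLimitPoint (Γ : Subgroup PSL2C) (x : RSphere) : Prop :=
  ∃ (γ : ℕ → SL2C) (a b : RSphere), (∀ n, (γ n : PSL2C) ∈ Γ) ∧ a ≠ b ∧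
    Filter.Tendsto (fun n => mobius (γ n) x) Filter.atTop (nhds a) ∧
    ∀ y : RSphere, y ≠ x → Filter.Tendsto (fun n => mobius (γ n) y) Filter.atTop (nhds b)

/-- Convex cocompactness of a Kleinian group, via the Beardon–Maskit/Bowditch
characterization: a Kleinian group is convex cocompact (equivalently, it acts
cocompactly on the convex hull of its limit set in `ℍ³`) iff every limit point
is a conical limit point. -/
def IsConvexCocompact (Γ : Subgroup PSL2C) : Prop :=
  IsKleinian Γ ∧ ∀ x ∈ limitSet Γ, IsConicalLimitPoint Γ x

/-- The unit circle in `ℂ`. -/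
def unitCircle : Set ℂ := Metric.sphere 0 1

/-- A Jordan curve on the Riemann sphere: a homeomorphic image of the unit circle. -/
def IsJordanCurve (C : Set RSphere) : Prop :=
  ∃ f : ℂ → RSphere, ContinuousOn f unitCircle ∧ Set.InjOn f unitCircle ∧ C = f '' unitCircle

/-- A round circle on the Riemann sphere: a Euclidean circle in `ℂ`, or a
Euclidean line together with `∞`. -/
def IsRoundCircle (C : Set RSphere) : Prop :=
  (∃ (c : ℂ) (r : ℝ), 0 < r ∧ C = RSphere.ofC '' Metric.sphere c r) ∨
  (∃ a v : ℂ, v ≠ 0 ∧ C = insert RSphere.infty (RSphere.ofC '' {z | ∃ t : ℝ, z = a + t • v}))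

/-- A loxodromic element of `SL(2,ℂ)`: the trace is not a real number of absolute value `≤ 2`. -/
def IsLoxodromic (g : SL2C) : Prop :=
  ∀ t : ℝ, Matrix.trace (g.1) = (t : ℂ) → 2 < |t|

/-- Schottky data of rank `g`: free generators `gen i` together with `2g` open topological
disks with disjoint closures and Jordan curve boundaries, such that `gen i` maps the
boundary of the `i`-th disk onto the boundary of the `(i+g)`-th disk and maps the `i`-th
disk off the `(i+g)`-th disk. -/
structure SchottkyData (g : ℕ) where
  gen : Fin g → SL2C
  D : Fin g ⊕ Fin g → Set RSphere
  isOpen : ∀ i, IsOpen (D i)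
  nonempty : ∀ i, (D i).Nonempty
  jordan : ∀ i, IsJordanCurve (frontier (D i))
  disjointClosures : ∀ i j, i ≠ j → closure (D i) ∩ closure (D j) = ∅
  lox : ∀ i, IsLoxodromic (gen i)
  maps_boundary : ∀ i : Fin g, mobius (gen i) '' frontier (D (Sum.inl i)) = frontier (D (Sum.inr i))
  maps_off : ∀ i : Fin g, (mobius (gen i) '' D (Sum.inl i)) ∩ D (Sum.inr i) = ∅

namespace SchottkyData

/-- The subgroup of `PSL(2,ℂ)` generated by the Schottky data. -/
def group {g : ℕ} (S : SchottkyData g) : Subgroup PSL2C :=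
  Subgroup.closure (Set.range fun i => ((S.gen i : PSL2C)))

/-- The generators generate freely. -/
def Free {g : ℕ} (S : SchottkyData g) : Prop :=
  Function.Injective ⇑(FreeGroup.lift (fun i : Fin g => ((S.gen i : PSL2C))))

/-- Classical Schottky data: all the boundary curves are round circles. -/
def IsClassical {g : ℕ} (S : SchottkyData g) : Prop :=
  ∀ i, IsRoundCircle (frontier (S.D i))

/-- The (Schottky) fundamental domain determined by the data: the complement of the
closed disks. -/
def domain {g : ℕ} (S : SchottkyData g) : Set RSphere :=
  (⋃ i, closure (S.D i))ᶜ

/-- The boundary of the orbit of the fundamental domain. -/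
def orbitBoundary {g : ℕ} (S : SchottkyData g) : Set RSphere :=
  ⋃ γ : {γ : SL2C // (γ : PSL2C) ∈ S.group}, mobius γ.1 '' (⋃ i, frontier (S.D i))

end SchottkyData

/-- `Γ` is a Schottky group of rank `g`. -/
def IsSchottkyOfRank (Γ : Subgroup PSL2C) (g : ℕ) : Prop :=
  ∃ S : SchottkyData g, S.group = Γ ∧ S.Free ∧ IsKleinian Γ ∧ IsConvexCocompact Γ

/-- `Γ` is a Schottky group. -/
def IsSchottky (Γ : Subgroup PSL2C) : Prop := ∃ g, IsSchottkyOfRank Γ g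

/-- `Γ` is a classical Schottky group of rank `g`: some Schottky data for `Γ` has all its
defining curves round circles. -/
def IsClassicalSchottkyOfRank (Γ : Subgroup PSL2C) (g : ℕ) : Prop :=
  ∃ S : SchottkyData g, S.group = Γ ∧ S.Free ∧ S.IsClassical ∧ IsKleinian Γ ∧ IsConvexCocompact Γ

/-- `Γ` is a classical Schottky group. -/
def IsClassicalSchottky (Γ : Subgroup PSL2C) : Prop := ∃ g, IsClassicalSchottkyOfRank Γ g

/-- A quasi-circle of `Γ`: a `Γ`-invariant Jordan curve containing the limit set. -/
def IsQuasiCircle (Γ : Subgroup PSL2C) (η : Set RSphere) : Prop :=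
  IsJordanCurve η ∧ limitSet Γ ⊆ η ∧
  ∀ g : SL2C, (g : PSL2C) ∈ Γ → mobius g '' η = η

/-- A rectifiable subset of the sphere: finite 1-dimensional Hausdorff measure. -/
def Rectifiable (η : Set RSphere) : Prop := μH[1] η < ⊤

/-! ### The space `ℛ(S¹, W)` of bounded-length closed curves meeting a compact set `W ⊆ ℂ` -/

/-- The unit circle as a topological space. -/
abbrev S1 := ↥(Metric.sphere (0 : ℂ) 1)

/-- The standard parametrization of the unit circle. -/
noncomputable def circleParam (t : ℝ) : S1 :=
  ⟨circleMap 0 1 t, circleMap_mem_sphere 0 zero_le_one t⟩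

/-- The length (total variation) of a closed curve `h : S¹ → ℂ`. -/
noncomputable def curveLength (h : C(S1, ℂ)) : ℝ≥0∞ :=
  eVariationOn (fun t => h (circleParam t)) (Set.Icc 0 (2 * Real.pi))

/-- An element of `ℛ(S¹, W)`: a continuous rectifiable (bounded-length) closed curve
in `ℂ` whose image meets `W`. -/
structure RCurve (W : Set ℂ) where
  toFun : C(S1, ℂ)
  meets : (Set.range toFun ∩ W).Nonempty
  bddLength : curveLength toFun < ⊤

/-- The Fréchet distance on `ℛ(S¹, W)`:
`d_F(h₁,h₂) = inf {sup |h₁(σ₁ t) - h₂(σ₂ t)| : σ₁, σ₂ ∈ Homeo(S¹)} + |ℓ(h₁) - ℓ(h₂)|`. -/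
noncomputable def frechetDist {W : Set ℂ} (h₁ h₂ : RCurve W) : ℝ :=
  (⨅ σ : (S1 ≃ₜ S1) × (S1 ≃ₜ S1), ⨆ t : S1, dist (h₁.toFun (σ.1 t)) (h₂.toFun (σ.2 t))) +
    |(curveLength h₁.toFun).toReal - (curveLength h₂.toFun).toReal|

/-- The subset of the Riemann sphere traced out by a curve in `ℂ`. -/
def RCurve.carrier {W : Set ℂ} (h : RCurve W) : Set RSphere :=
  RSphere.ofC '' Set.range h.toFun

/-- The collection `E_Γ` of curves in `ℛ(S¹,W)` tracing bounded-length quasi-circles of `Γ`. -/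
def ECurves (W : Set ℂ) (Γ : Subgroup PSL2C) : Set (RCurve W) :=
  {h | IsQuasiCircle Γ h.carrier}

/-- Closure of a set of curves with respect to the Fréchet distance. -/
def dClosure {W : Set ℂ} (A : Set (RCurve W)) : Set (RCurve W) :=
  {h | ∀ ε : ℝ, 0 < ε → ∃ a ∈ A, frechetDist h a < ε}

/-- Boundary (frontier) of a set of curves with respect to the Fréchet distance. -/
def dFrontier {W : Set ℂ} (A : Set (RCurve W)) : Set (RCurve W) :=
  dClosure A ∩ dClosure Aᶜ

/-! ### Generating curves for quasi-circles -/

/-- `A` is a (possibly non-simple) continuous curve from `p` to `q`. -/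
def IsCurveFromTo (A : Set RSphere) (p q : RSphere) : Prop :=
  ∃ f : ℝ → RSphere, ContinuousOn f (Set.Icc 0 1) ∧ f 0 = p ∧ f 1 = q ∧
    A = f '' Set.Icc 0 1

/-- `A` is an arc (a simple continuous curve) from `p` to `q`. -/
def IsArc (A : Set RSphere) (p q : RSphere) : Prop :=
  ∃ f : ℝ → RSphere, ContinuousOn f (Set.Icc 0 1) ∧ Set.InjOn f (Set.Icc 0 1) ∧
    f 0 = p ∧ f 1 = q ∧ A = f '' Set.Icc 0 1

/-- A (possibly singular) generating curve for Schottky data `S`: for each `i` a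
curve `conn i` joining a point `p i` of the `i`-th boundary curve to a point `q i` of the
`(i+g)`-th boundary curve, together with a curve `bnd i` on the `(i+g)`-th boundary curve
joining `q i` to the image `gen i ∙ p i`. -/
structure PreGenCurve {g : ℕ} (S : SchottkyData g) where
  conn : Fin g → Set RSphere
  bnd : Fin g → Set RSphere
  p : Fin g → RSphere
  q : Fin g → RSphere
  p_mem : ∀ i, p i ∈ frontier (S.D (Sum.inl i))
  q_mem : ∀ i, q i ∈ frontier (S.D (Sum.inr i))
  conn_curve : ∀ i, IsCurveFromTo (conn i) (p i) (q i)
  bnd_curve : ∀ i, IsCurveFromTo (bnd i) (q i) (mobius (S.gen i) (p i))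
  bnd_sub : ∀ i, bnd i ⊆ frontier (S.D (Sum.inr i))

namespace PreGenCurve

variable {g : ℕ} {S : SchottkyData g}

/-- The underlying set of a generating curve. -/
def carrier (ζ : PreGenCurve S) : Set RSphere := ⋃ i, (ζ.conn i ∪ ζ.bnd i)

/-- A generating curve is simple if its constituent curves are disjoint arcs (meeting
only at the prescribed endpoints). -/
def IsSimple (ζ : PreGenCurve S) : Prop :=
  (∀ i, IsArc (ζ.conn i) (ζ.p i) (ζ.q i)) ∧
  (∀ i, IsArc (ζ.bnd i) (ζ.q i) (mobius (S.gen i) (ζ.p i))) ∧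
  (∀ i, ζ.conn i ∩ ζ.bnd i = {ζ.q i}) ∧
  ∀ i j, i ≠ j → (ζ.conn i ∪ ζ.bnd i) ∩ (ζ.conn j ∪ ζ.bnd j) = ∅

end PreGenCurve

/-- The `Γ`-invariant closed set generated by a set `ζ`:
`Λ_Γ ∪ ⋃_{γ ∈ Γ} γ(ζ)`. -/
def generatedBy (Γ : Subgroup PSL2C) (ζ : Set RSphere) : Set RSphere :=
  limitSet Γ ∪ ⋃ γ : {γ : SL2C // (γ : PSL2C) ∈ Γ}, mobius γ.1 '' ζ

/-- `η` is generated by a (simple) generating curve of `Γ`. -/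
def IsGeneratedByGenCurve (Γ : Subgroup PSL2C) (η : Set RSphere) : Prop :=
  ∃ (g : ℕ) (S : SchottkyData g), S.group = Γ ∧
    ∃ ζ : PreGenCurve S, ζ.IsSimple ∧ generatedBy Γ ζ.carrier = η

/-- A trivial singular curve: a closed curve generated by some non-simple generating curve. -/
def IsTrivialSingular (Γ : Subgroup PSL2C) (η : Set RSphere) : Prop :=
  ∃ (g : ℕ) (S : SchottkyData g), S.group = Γ ∧
    ∃ ζ : PreGenCurve S, ¬ζ.IsSimple ∧ generatedBy Γ ζ.carrier = η

/-- The set `Ψ_Γ` associated to a sequence `Γ_n → Γ`: the boundary of the closure of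
`⋃ n, E_{Γ_n}` in `(ℛ(S¹,W), d_F)`, with the trivial singular curves removed. -/
def PsiSet (W : Set ℂ) (Γseq : ℕ → Subgroup PSL2C) (Γ : Subgroup PSL2C) : Set (RCurve W) :=
  dFrontier (dClosure (⋃ n, ECurves W (Γseq n))) \ {h | IsTrivialSingular Γ h.carrier}

/-! ### Linear and transverse quasi-circles -/

/-- A linear quasi-circle: off the limit set, the curve consists of points and
circular/linear arcs (each connected component of `η \ Λ_Γ` lies on a round circle). -/
def IsLinearQC (Γ : Subgroup PSL2C) (η : Set RSphere) : Prop :=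
  IsQuasiCircle Γ η ∧
  ∀ x ∈ η \ limitSet Γ, ∃ C : Set RSphere, IsRoundCircle C ∧
    connectedComponentIn (η \ limitSet Γ) x ⊆ C

/-- Two subsets of the sphere meet orthogonally at a (finite) point `x`: there are
differentiable local parametrizations of the two sets through `x` whose (nonzero) tangent
vectors are orthogonal. -/
def MeetsOrthogonallyAt (A B : Set RSphere) (x : RSphere) : Prop :=
  ∃ (z u v : ℂ) (f h : ℝ → ℂ), x = RSphere.ofC z ∧ u ≠ 0 ∧ v ≠ 0 ∧
    HasDerivAt f u 0 ∧ HasDerivAt h v 0 ∧ f 0 = z ∧ h 0 = z ∧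
    (∀ᶠ t in nhds (0 : ℝ), RSphere.ofC (f t) ∈ A) ∧
    (∀ᶠ t in nhds (0 : ℝ), RSphere.ofC (h t) ∈ B) ∧
    (u * (starRingEnd ℂ) v).re = 0

/-- A transverse quasi-circle: it meets the boundary of the orbit of some fundamental
domain orthogonally, and contains no parallel arc (no nondegenerate arc inside that
boundary). -/
def IsTransverseQC (Γ : Subgroup PSL2C) (η : Set RSphere) : Prop :=
  IsQuasiCircle Γ η ∧
  ∃ (g : ℕ) (S : SchottkyData g), S.group = Γ ∧
    (∀ x ∈ η ∩ S.orbitBoundary, MeetsOrthogonallyAt η S.orbitBoundary x) ∧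
    ¬∃ (A : Set RSphere) (p q : RSphere), p ≠ q ∧ IsArc A p q ∧ A ⊆ η ∩ S.orbitBoundary

/-! ### Good sequences -/

/-- A good sequence of quasi-circles for `Γ_n → Γ`: quasi-circles `η_n` of `Γ_n`
converging in the Fréchet metric to a quasi-circle `η_∞` of `Γ`. -/
def IsGoodSequence {W : Set ℂ} (Γseq : ℕ → Subgroup PSL2C) (Γ : Subgroup PSL2C)
    (hn : ℕ → RCurve W) (h : RCurve W) : Prop :=
  (∀ n, IsQuasiCircle (Γseq n) (hn n).carrier) ∧
  Filter.Tendsto (fun n => frechetDist (hn n) h) Filter.atTop (nhds 0) ∧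
  IsQuasiCircle Γ h.carrier

/-! ### Quasiconformal maps -/

/-- A quasiconformal homeomorphism of the Riemann sphere (metric definition:
uniformly bounded circular distortion). -/
def IsQuasiconformal (f : RSphere ≃ₜ RSphere) : Prop :=
  ∃ K : ℝ, ∀ x : RSphere,
    Filter.limsup (fun r : ℝ =>
        (⨆ y ∈ Metric.sphere x r, dist (f x) (f y)) /
          (⨅ y ∈ Metric.sphere x r, dist (f x) (f y)))
      (nhdsWithin 0 (Set.Ioi 0)) ≤ K

/-- `f` conjugates the subgroup `Γ` of `PSL(2,ℂ)` onto the subgroup `Γ'`, i.e.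
`Γ' = f Γ f⁻¹` as groups of transformations of the sphere. -/
def ConjugatesBy (f : RSphere ≃ₜ RSphere) (Γ Γ' : Subgroup PSL2C) : Prop :=
  (∀ g : SL2C, (g : PSL2C) ∈ Γ → ∃ g' : SL2C, (g' : PSL2C) ∈ Γ' ∧
    ∀ z : RSphere, mobius g' (f z) = f (mobius g z)) ∧
  (∀ g' : SL2C, (g' : PSL2C) ∈ Γ' → ∃ g : SL2C, (g : PSL2C) ∈ Γ ∧
    ∀ z : RSphere, mobius g' (f z) = f (mobius g z))

/-! ### Schottky space -/

/-- The subgroup generated by a tuple in `PSL(2,ℂ)`. -/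
def tupleGroup {g : ℕ} (γ : Fin g → PSL2C) : Subgroup PSL2C :=
  Subgroup.closure (Set.range γ)

/-- The subgroup generated by a tuple of matrices in `SL(2,ℂ)`. -/
def groupOfGens {g : ℕ} (γ : Fin g → SL2C) : Subgroup PSL2C :=
  Subgroup.closure (Set.range fun i => ((γ i : PSL2C)))

/-- A marked rank-`g` Schottky group: a tuple of free Schottky generators in `PSL(2,ℂ)`. -/
abbrev MarkedSchottky (g : ℕ) :=
  {γ : Fin g → PSL2C // ∃ S : SchottkyData g, (∀ i, ((S.gen i : PSL2C)) = γ i) ∧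
    S.Free ∧ IsKleinian S.group ∧ IsConvexCocompact S.group}

/-- Conjugacy of marked Schottky groups. -/
def schottkyRel (g : ℕ) : Setoid (MarkedSchottky g) where
  r a b := ∃ h : PSL2C, ∀ i, b.1 i = h * a.1 i * h⁻¹
  iseqv := by
    refine ⟨fun a => ⟨1, fun i => by simp⟩, ?_, ?_⟩
    · rintro a b ⟨h, e⟩
      exact ⟨h⁻¹, fun i => by rw [e i]; group⟩
    · rintro a b c ⟨h, e⟩ ⟨h', e'⟩
      exact ⟨h' * h, fun i => by rw [e' i, e i]; group⟩

/-- The rank-`g` Schottky space `𝔍_g`: marked rank-`g` Schottky groups up to conjugacy in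
`PSL(2,ℂ)`, with the quotient topology. -/
def SchottkySpace (g : ℕ) : Type := Quotient (schottkyRel g)

instance (g : ℕ) : TopologicalSpace (SchottkySpace g) := by
  unfold SchottkySpace; infer_instance

namespace SchottkySpace

/-- The Hausdorff dimension of (the limit set of) a point of Schottky space. -/
noncomputable def dim {g : ℕ} (x : SchottkySpace g) : ℝ≥0∞ :=
  ⨅ γ : {γ : MarkedSchottky g // Quotient.mk (schottkyRel g) γ = x},
    limitDim (tupleGroup γ.1.1)

/-- The open subset `𝔍_g¹` of Schottky space: points of Hausdorff dimension `< 1`. -/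
def J1 (g : ℕ) : Set (SchottkySpace g) := {x | dim x < 1}

/-- The subset `𝔍_{g,o}` of classical Schottky groups in Schottky space. -/
def classicalLocus (g : ℕ) : Set (SchottkySpace g) :=
  {x | ∃ γ : MarkedSchottky g, Quotient.mk (schottkyRel g) γ = x ∧
    IsClassicalSchottky (tupleGroup γ.1)}

end SchottkySpace

/-- An `SL(2,ℂ)`-level tuple of free Schottky generators. -/
def IsSchottkyTuple {g : ℕ} (γ : Fin g → SL2C) : Prop :=
  ∃ S : SchottkyData g, S.gen = γ ∧ S.Free ∧ IsKleinian S.group ∧ IsConvexCocompact S.group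


set_option linter.unusedSectionVars false
set_option linter.unusedVariables false

namespace TQ

/-- `f` has a continuous logarithm on `K`. -/
def HasLog {α : Type*} [TopologicalSpace α] (K : Set α) (f : α → ℂ) : Prop :=
  ∃ φ : α → ℂ, ContinuousOn φ K ∧ ∀ z ∈ K, Complex.exp (φ z) = f z

section HasLog
variable {α : Type*} [TopologicalSpace α] {K L : Set α} {f g : α → ℂ}

lemma HasLog.mono (h : HasLog K f) (hL : L ⊆ K) : HasLog L f := by
  obtain ⟨φ, h1, h2⟩ := h
  exact ⟨φ, h1.mono hL, fun z hz => h2 z (hL hz)⟩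

lemma HasLog.congr (h : HasLog K f) (hfg : ∀ z ∈ K, f z = g z) : HasLog K g := by
  obtain ⟨φ, h1, h2⟩ := h
  exact ⟨φ, h1, fun z hz => (h2 z hz).trans (hfg z hz)⟩

lemma HasLog.mul (hf : HasLog K f) (hg : HasLog K g) : HasLog K (fun z => f z * g z) := by
  obtain ⟨φ, h1, h2⟩ := hf
  obtain ⟨ψ, h3, h4⟩ := hg
  exact ⟨fun z => φ z + ψ z, h1.add h3, fun z hz => by rw [Complex.exp_add, h2 z hz, h4 z hz]⟩

lemma HasLog.zpow (hf : HasLog K f) (n : ℤ) : HasLog K (fun z => f z ^ n) := by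
  obtain ⟨φ, h1, h2⟩ := hf
  exact ⟨fun z => n * φ z, continuousOn_const.mul h1,
    fun z hz => by rw [Complex.exp_int_mul, h2 z hz]⟩

lemma hasLog_of_slitPlane (hf : ContinuousOn f K) (h : ∀ z ∈ K, f z ∈ Complex.slitPlane) :
    HasLog K f :=
  ⟨fun z => Complex.log (f z), hf.clog h,
    fun z hz => Complex.exp_log (Complex.slitPlane_ne_zero (h z hz))⟩

lemma hasLog_union_disjoint (hK : IsClosed K) (hL : IsClosed L) (hd : Disjoint K L)
    (h1 : HasLog K f) (h2 : HasLog L f) : HasLog (K ∪ L) f := by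
  classical
  obtain ⟨φ, a1, a2⟩ := h1
  obtain ⟨ψ, b1, b2⟩ := h2
  have hL' : ∀ z ∈ L, z ∉ K := fun z hz hz' => Set.disjoint_left.1 hd hz' hz
  refine ⟨fun z => if z ∈ K then φ z else ψ z, ContinuousOn.union_of_isClosed ?_ ?_ hK hL, ?_⟩
  · exact a1.congr fun z hz => by simp [hz]
  · exact b1.congr fun z hz => by simp [hL' z hz]
  · rintro z (hz | hz)
    · simp [hz, a2 z hz]
    · simp [hL' z hz, b2 z hz]

lemma const_of_exp_const {s : Set α} (hs : IsPreconnected s) (φ : α → ℂ) (h : ContinuousOn φ s)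
    (he : ∀ a ∈ s, ∀ b ∈ s, Complex.exp (φ a) = Complex.exp (φ b)) {a b : α}
    (ha : a ∈ s) (hb : b ∈ s) : φ a = φ b :=
  Complex.isCoveringMap_exp.constOn_of_comp hs h
    (fun a ha b hb => Subtype.ext (he a ha b hb)) ha hb

lemma hasLog_union (hK : IsClosed K) (hL : IsClosed L) (hc : IsPreconnected (K ∩ L))
    (h1 : HasLog K f) (h2 : HasLog L f) : HasLog (K ∪ L) f := by
  classical
  rcases (K ∩ L).eq_empty_or_nonempty with he | ⟨x, hx⟩
  · exact hasLog_union_disjoint hK hL (Set.disjoint_iff_inter_eq_empty.2 he) h1 h2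
  obtain ⟨φ, a1, a2⟩ := h1
  obtain ⟨ψ, b1, b2⟩ := h2
  have key : ∀ z ∈ K ∩ L, φ z - ψ z = φ x - ψ x := by
    intro z hz
    refine const_of_exp_const hc (fun z => φ z - ψ z)
      ((a1.mono inter_subset_left).sub (b1.mono inter_subset_right)) ?_ hz hx
    have : ∀ y ∈ K ∩ L, Complex.exp (φ y - ψ y) = 1 := fun y hy => by
      rw [Complex.exp_sub, a2 y hy.1, b2 y hy.2, div_self]
      rw [← a2 y hy.1]; exact Complex.exp_ne_zero _
    intro a ha b hb
    rw [this a ha, this b hb]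
  have hx1 : Complex.exp (φ x - ψ x) = 1 := by
    rw [Complex.exp_sub, a2 x hx.1, b2 x hx.2, div_self]
    rw [← a2 x hx.1]; exact Complex.exp_ne_zero _
  refine ⟨fun z => if z ∈ K then φ z else ψ z + (φ x - ψ x),
    ContinuousOn.union_of_isClosed ?_ ?_ hK hL, ?_⟩
  · exact a1.congr fun z hz => by simp [hz]
  · refine (b1.add continuousOn_const).congr (f := fun z => ψ z + (φ x - ψ x)) fun z hz => ?_
    by_cases h : z ∈ K
    · simp only [h, if_true]; rw [← key z ⟨h, hz⟩]; ring
    · simp [h]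
  · rintro z (hz | hz)
    · simp [hz, a2 z hz]
    · by_cases h : z ∈ K
      · simp [h, a2 z h]
      · simp only [h, if_false]; rw [Complex.exp_add, hx1, b2 z hz, mul_one]

end HasLog

/-- Nonvanishing functions on `ℝ` have logs. -/
lemma hasLog_real (f : ℝ → ℂ) (hf : Continuous f) (h0 : ∀ t, f t ≠ 0) : HasLog univ f := by
  have : IsSimplyConnected (univ : Set ℝ) :=
    (Homeomorph.Set.univ ℝ).toHomotopyEquiv.simplyConnectedSpace
  obtain ⟨φ, h1, h2⟩ := Complex.exists_continuousOn_eqOn_exp_comp this isOpen_univ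
    hf.continuousOn (by rintro ⟨t, -, ht⟩; exact h0 t ht)
  exact ⟨φ, h1, fun z hz => h2 hz⟩

lemma hasLog_complex (f : ℂ → ℂ) (hf : Continuous f) (h0 : ∀ t, f t ≠ 0) : HasLog univ f := by
  have : IsSimplyConnected (univ : Set ℂ) :=
    (Homeomorph.Set.univ ℂ).toHomotopyEquiv.simplyConnectedSpace
  obtain ⟨φ, h1, h2⟩ := Complex.exists_continuousOn_eqOn_exp_comp this isOpen_univ
    hf.continuousOn (by rintro ⟨t, -, ht⟩; exact h0 t ht)
  exact ⟨φ, h1, fun z hz => h2 hz⟩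

lemma hasLog_Icc {a b : ℝ} (hab : a ≤ b) (f : ℝ → ℂ) (hf : ContinuousOn f (Icc a b))
    (h0 : ∀ t ∈ Icc a b, f t ≠ 0) : HasLog (Icc a b) f := by
  have h := hasLog_real (fun t => f (projIcc a b hab t)) ?_ ?_
  · refine (h.mono (subset_univ (Icc a b))).congr fun z hz => ?_
    simp [projIcc_of_mem hab hz]
  · exact hf.comp_continuous (by fun_prop) (fun t => (projIcc a b hab t).2)
  · exact fun t => h0 _ (projIcc a b hab t).2

/-- No nonvanishing continuous function on the plane has nonzero degree at infinity. -/
lemma no_degree (g : ℂ → ℂ) (hg : Continuous g) (h0 : ∀ z, g z ≠ 0) (p : ℂ) (n : ℤ) (R : ℝ)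
    (h : ∀ z, R ≤ ‖z‖ → g z = (z - p) ^ n) : n = 0 := by
  obtain ⟨L, hL, hLe⟩ := hasLog_complex g hg h0
  rw [continuousOn_univ] at hL
  set ρ : ℝ := |R| + ‖p‖ + 1 with hρ
  have hρ0 : 0 < ρ := by positivity
  let w : ℝ → ℂ := fun θ => p + ρ * Complex.exp (θ * Complex.I)
  have hw : ∀ θ, R ≤ ‖w θ‖ := fun θ => by
    have h1 : ‖(ρ : ℂ) * Complex.exp (θ * Complex.I)‖ = ρ := by
      rw [norm_mul, Complex.norm_exp_ofReal_mul_I, mul_one, Complex.norm_real, Real.norm_of_nonneg hρ0.le]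
    have h2 : ‖(ρ : ℂ) * Complex.exp (θ * Complex.I)‖ ≤ ‖w θ‖ + ‖p‖ := by
      have : (ρ : ℂ) * Complex.exp (θ * Complex.I) = w θ - p := by simp [w]
      rw [this]; exact norm_sub_le _ _
    rw [h1] at h2
    have := le_abs_self R
    linarith
  have hex : ∀ θ : ℝ, Complex.exp (L (w θ) - n * (θ * Complex.I)) = (ρ : ℂ) ^ n := fun θ => by
    rw [Complex.exp_sub, hLe _ (mem_univ _), h _ (hw θ), Complex.exp_int_mul]
    have : w θ - p = ρ * Complex.exp (θ * Complex.I) := by simp [w]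
    rw [this, mul_zpow, mul_div_assoc, div_self, mul_one]
    exact zpow_ne_zero _ (Complex.exp_ne_zero _)
  have hcont : Continuous (fun θ : ℝ => L (w θ) - n * (θ * Complex.I)) := by
    have : Continuous w := by fun_prop
    fun_prop
  have := const_of_exp_const (isPreconnected_univ) _ hcont.continuousOn
    (fun a _ b _ => by rw [hex, hex]) (mem_univ (0 : ℝ)) (mem_univ (2 * Real.pi))
  have hw2 : w (2 * Real.pi) = w 0 := by
    simp [w, Complex.exp_two_pi_mul_I]
  rw [hw2] at this
  have h3 : (n : ℂ) * ((2 * Real.pi : ℝ) * Complex.I) = 0 := by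
    have e0 : (n : ℂ) * (((0 : ℝ) : ℂ) * Complex.I) = 0 := by simp
    linear_combination e0 + this
  simpa [Real.pi_ne_zero] using h3

/-- Core gluing contradiction. -/
lemma glue_false {U K : Set ℂ} (hU : IsOpen U) (hb : Bornology.IsBounded U) (hK : IsClosed K)
    (hfr : frontier U ⊆ K) {p : ℂ} (hp : p ∈ U) {n : ℤ} (hn : n ≠ 0) (h : ℂ → ℂ)
    (hh : ContinuousOn h (closure U)) (hh0 : ∀ z ∈ closure U, h z ≠ 0) (Φ : ℂ → ℂ)
    (hΦ : ContinuousOn Φ K) (he : ∀ z ∈ K, Complex.exp (Φ z) * h z = (z - p) ^ n) : False := by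
  classical
  obtain ⟨Ψ, hΨ⟩ := ContinuousMap.exists_restrict_eq hK ⟨K.domRestrict Φ, hΦ.domRestrict⟩
  have hΨ' : ∀ z ∈ K, Ψ z = Φ z := fun z hz => by
    exact DFunLike.congr_fun hΨ ⟨z, hz⟩
  let g : ℂ → ℂ := fun z => if z ∈ U then Complex.exp (Ψ z) * h z else (z - p) ^ n
  have hg1 : ContinuousOn g (closure U) := by
    refine ((Complex.continuous_exp.comp Ψ.continuous).continuousOn.mul hh).congr fun z hz => ?_
    by_cases hzU : z ∈ U
    · simp [g, hzU]
    · have hz' : z ∈ K := hfr ⟨hz, by rwa [hU.interior_eq]⟩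
      simp [g, hzU, hΨ' z hz', he z hz']
  have hg2 : ContinuousOn g Uᶜ := by
    have : ContinuousOn (fun z : ℂ => (z - p) ^ n) Uᶜ := by
      refine ContinuousOn.zpow₀ (by fun_prop) _ fun z hz => Or.inl ?_
      exact sub_ne_zero.2 fun hzp => hz (hzp ▸ hp)
    refine this.congr fun z hz => ?_
    have : z ∉ U := hz
    simp [g, this]
  have hg : Continuous g := by
    rw [← continuousOn_univ]
    refine (ContinuousOn.union_of_isClosed hg1 hg2 isClosed_closure hU.isClosed_compl).mono ?_
    intro z _
    by_cases hz : z ∈ U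
    · exact Or.inl (subset_closure hz)
    · exact Or.inr hz
  have hg0 : ∀ z, g z ≠ 0 := fun z => by
    by_cases hz : z ∈ U
    · simp only [g, hz, if_true]
      exact mul_ne_zero (Complex.exp_ne_zero _) (hh0 z (subset_closure hz))
    · simp only [g, hz, if_false]
      exact zpow_ne_zero _ (sub_ne_zero.2 fun hzp => hz (hzp ▸ hp))
  obtain ⟨R, hR⟩ := hb.subset_closedBall 0
  refine hn (no_degree g hg hg0 p n (R + 1) fun z hz => ?_)
  have : z ∉ U := fun hzU => by
    have := hR hzU
    rw [mem_closedBall_zero_iff] at this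
    linarith
  simp [g, this]

/-- points of the complement around which `K` has no log (inside). -/
def In (K : Set ℂ) : Set ℂ := {p | p ∉ K ∧ ¬ HasLog K (fun z => z - p)}
/-- points of the complement for which `K` has a log (outside). -/
def Out (K : Set ℂ) : Set ℂ := {p | p ∉ K ∧ HasLog K (fun z => z - p)}

lemma mem_trichotomy (K : Set ℂ) (p : ℂ) : p ∈ K ∨ p ∈ In K ∨ p ∈ Out K := by
  unfold In Out; by_cases h : p ∈ K <;> by_cases h' : HasLog K (fun z => z - p) <;> simp [h, h']

lemma disj_In_Out (K : Set ℂ) {p : ℂ} (h : p ∈ In K) (h' : p ∈ Out K) : False := h.2 h'.2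

lemma log_local {K : Set ℂ} (hK : IsClosed K) {p : ℂ} (hp : p ∉ K) :
    ∃ r > 0, Metric.ball p r ⊆ Kᶜ ∧ ∀ q ∈ Metric.ball p r,
      (HasLog K (fun z => z - q) ↔ HasLog K (fun z => z - p)) := by
  obtain ⟨r, hr, hb⟩ := Metric.isOpen_iff.1 hK.isOpen_compl p hp
  have key : ∀ q ∈ Metric.ball p (r / 4), ∀ q' ∈ Metric.ball p (r / 4),
      HasLog K (fun z => z - q) → HasLog K (fun z => z - q') := by
    intro q hq q' hq' h
    have h1 : ∀ z ∈ K, ‖q - q'‖ < ‖z - q‖ := fun z hz => by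
      have hz : r ≤ dist z p := by
        by_contra hlt
        exact hb (Metric.mem_ball.2 (not_le.1 hlt)) hz
      have hzq : ‖z - q‖ = dist z q := (dist_eq_norm _ _).symm
      have hqq : ‖q - q'‖ = dist q q' := (dist_eq_norm _ _).symm
      rw [hzq, hqq]
      rw [Metric.mem_ball] at hq hq'
      have t1 := dist_triangle z q p
      have t2 := dist_triangle_right q q' p
      linarith
    have h2 : HasLog K (fun z => 1 + (q - q') / (z - q)) := by
      refine hasLog_of_slitPlane ?_ fun z hz => ?_
      · refine continuousOn_const.add (continuousOn_const.div (by fun_prop) fun z hz => ?_)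
        exact norm_pos_iff.1 ((norm_nonneg _).trans_lt (h1 z hz))
      · refine Complex.mem_slitPlane_of_norm_lt_one ?_
        rw [norm_div, div_lt_one ((norm_nonneg _).trans_lt (h1 z hz))]
        exact h1 z hz
    refine (h.mul h2).congr fun z hz => ?_
    have : z - q ≠ 0 := norm_pos_iff.1 ((norm_nonneg _).trans_lt (h1 z hz))
    field_simp
    ring
  refine ⟨r / 4, by positivity, (Metric.ball_subset_ball (by linarith)).trans hb, fun q hq =>
    ⟨key q hq p (Metric.mem_ball_self (by positivity)), key p (Metric.mem_ball_self (by positivity)) q hq⟩⟩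

lemma isOpen_In {K : Set ℂ} (hK : IsClosed K) : IsOpen (In K) := by
  rw [Metric.isOpen_iff]
  intro p hp
  obtain ⟨r, hr, h1, h2⟩ := log_local hK hp.1
  exact ⟨r, hr, fun q hq => ⟨h1 hq, fun h => hp.2 ((h2 q hq).1 h)⟩⟩

lemma isOpen_Out {K : Set ℂ} (hK : IsClosed K) : IsOpen (Out K) := by
  rw [Metric.isOpen_iff]
  intro p hp
  obtain ⟨r, hr, h1, h2⟩ := log_local hK hp.1
  exact ⟨r, hr, fun q hq => ⟨h1 hq, ((h2 q hq).2 hp.2)⟩⟩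

/-- `F1` -/
lemma preconnected_In_or_Out {K A : Set ℂ} (hK : IsClosed K) (hA : IsPreconnected A)
    (hd : A ⊆ Kᶜ) : A ⊆ In K ∨ A ⊆ Out K := by
  refine hA.subset_or_subset (isOpen_In hK) (isOpen_Out hK) ?_ ?_
  · exact Set.disjoint_left.2 fun z h h' => disj_In_Out K h h'
  · intro z hz
    rcases mem_trichotomy K z with h | h | h
    · exact absurd h (hd hz)
    · exact Or.inl h
    · exact Or.inr h

/-- If `K` lies in a ball not containing `p`, then `p` is outside. -/
lemma hasLog_of_subset_ball {K : Set ℂ} {c p : ℂ} {r : ℝ} (hK : K ⊆ Metric.ball c r)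
    (hp : p ∉ Metric.ball c r) : HasLog K (fun z => z - p) := by
  have hcp : r ≤ ‖c - p‖ := by
    rw [Metric.mem_ball, dist_comm, dist_eq_norm] at hp; linarith
  rcases K.eq_empty_or_nonempty with rfl | ⟨k, hk⟩
  · exact ⟨0, by simp, by simp⟩
  have hr : 0 < r := Metric.pos_of_mem_ball (hK hk)
  have hne : c - p ≠ 0 := norm_pos_iff.1 (hr.trans_le hcp)
  have h1 : HasLog K (fun _ => c - p) :=
    ⟨fun _ => Complex.log (c - p), continuousOn_const, fun _ _ => Complex.exp_log hne⟩
  have h2 : HasLog K (fun z => 1 + (z - c) / (c - p)) := by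
    refine hasLog_of_slitPlane (by fun_prop) fun z hz => ?_
    refine Complex.mem_slitPlane_of_norm_lt_one ?_
    rw [norm_div, div_lt_one (hr.trans_le hcp)]
    have := hK hz
    rw [Metric.mem_ball, dist_eq_norm] at this
    linarith
  refine (h1.mul h2).congr fun z hz => ?_
  field_simp
  ring

lemma In_bounded {K : Set ℂ} (hK : IsCompact K) : Bornology.IsBounded (In K) := by
  obtain ⟨R, hR⟩ := hK.isBounded.subset_ball 0
  refine (Metric.isBounded_ball (x := (0:ℂ)) (r := R)).subset fun p hp => ?_
  by_contra h
  exact hp.2 (hasLog_of_subset_ball hR h)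

/-- `F2` -/
lemma subset_In {U K : Set ℂ} (hU : IsOpen U) (hb : Bornology.IsBounded U) (hK : IsClosed K)
    (hfr : frontier U ⊆ K) (hd : Disjoint U K) : U ⊆ In K := by
  intro p hp
  refine ⟨Set.disjoint_left.1 hd hp, ?_⟩
  rintro ⟨Φ, h1, h2⟩
  refine glue_false hU hb hK hfr hp one_ne_zero (fun _ => 1) continuousOn_const (by simp) Φ h1 ?_
  intro z hz
  simp [h2 z hz]

lemma preconnected_compl_ball (R : ℝ) (hR : 0 < R) : IsPreconnected {z : ℂ | R ≤ ‖z‖} := by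
  have h1 : IsPreconnected ((Ici R) ×ˢ (univ : Set ℝ)) :=
    isPreconnected_Ici.prod isPreconnected_univ
  have h2 := h1.image (fun p : ℝ × ℝ => (p.1 : ℂ) * Complex.exp (p.2 * Complex.I))
    (by fun_prop)
  convert! h2 using 1
  ext z
  constructor
  · intro hz
    exact ⟨(‖z‖, Complex.arg z), ⟨hz, mem_univ _⟩, Complex.norm_mul_exp_arg_mul_I z⟩
  · rintro ⟨⟨a, b⟩, ⟨ha, -⟩, rfl⟩
    have ha' : R ≤ a := ha
    have : 0 ≤ a := hR.le.trans ha'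
    simp [Complex.norm_exp_ofReal_mul_I, abs_of_nonneg this, ha']

/-- `F4` -/
lemma isPreconnected_Out {K : Set ℂ} (hK : IsCompact K) : IsPreconnected (Out K) := by
  obtain ⟨R0, hR0⟩ := hK.isBounded.subset_ball 0
  set R := |R0| + 1 with hR
  have hRp : 0 < R := by positivity
  have hKR : K ⊆ Metric.ball 0 R := hR0.trans (Metric.ball_subset_ball (by
    have := le_abs_self R0; linarith))
  have hE : {z : ℂ | R ≤ ‖z‖} ⊆ Out K := fun z hz => by
    have hz' : z ∉ Metric.ball (0 : ℂ) R := by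
      simpa using (show R ≤ ‖z‖ from hz)
    exact ⟨fun h => hz' (hKR h), hasLog_of_subset_ball hKR hz'⟩
  have key : ∀ u v : Set ℂ, IsOpen u → IsOpen v → Out K ⊆ u ∪ v → Out K ∩ (u ∩ v) = ∅ →
      {z : ℂ | R ≤ ‖z‖} ⊆ u → (Out K ∩ v).Nonempty → False := by
    rintro u v hu hv huv hd hEu ⟨p, hp⟩
    have hV : IsOpen (Out K ∩ v) := (isOpen_Out hK.isClosed).inter hv
    have hb : Bornology.IsBounded (Out K ∩ v) := by
      refine (Metric.isBounded_ball (x := (0:ℂ)) (r := R)).subset fun z hz => ?_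
      rw [mem_ball_zero_iff]
      by_contra h
      have hzu : z ∈ u := hEu (not_lt.1 h)
      have : z ∈ Out K ∩ (u ∩ v) := ⟨hz.1, hzu, hz.2⟩
      rw [hd] at this; exact this
    have hfr : frontier (Out K ∩ v) ⊆ K := by
      intro z hz
      rw [hV.frontier_eq] at hz
      by_contra hzK
      have hmeet : ∀ W : Set ℂ, IsOpen W → z ∈ W → (W ∩ (Out K ∩ v)).Nonempty := fun W hW hzW =>
        mem_closure_iff.1 hz.1 W hW hzW
      rcases mem_trichotomy K z with h | h | h
      · exact hzK h
      · obtain ⟨w, hw1, hw2, -⟩ := hmeet _ (isOpen_In hK.isClosed) h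
        exact disj_In_Out K hw1 hw2
      · rcases huv h with h' | h'
        · obtain ⟨w, hw1, hw2, hw3⟩ := hmeet _ hu h'
          have : w ∈ Out K ∩ (u ∩ v) := ⟨hw2, hw1, hw3⟩
          rw [hd] at this; exact this
        · exact hz.2 ⟨h, h'⟩
    exact disj_In_Out K (subset_In hV hb hK.isClosed hfr
      (Set.disjoint_left.2 fun z hz hz' => hz.1.1 hz') hp) hp.1
  intro u v hu hv huv hun hvn
  by_contra hne
  rw [Set.not_nonempty_iff_eq_empty] at hne
  have hor := (preconnected_compl_ball R hRp).subset_or_subset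
    ((isOpen_Out hK.isClosed).inter hu) ((isOpen_Out hK.isClosed).inter hv)
    (Set.disjoint_left.2 fun z hz hz' => by
      have : z ∈ Out K ∩ (u ∩ v) := ⟨hz.1, hz.2, hz'.2⟩
      rw [hne] at this; exact this)
    (fun z hz => by
      rcases huv (hE hz) with h | h
      · exact Or.inl ⟨hE hz, h⟩
      · exact Or.inr ⟨hE hz, h⟩)
  rcases hor with h | h
  · exact key u v hu hv huv hne (h.trans inter_subset_right) hvn
  · exact key v u hv hu (by rwa [union_comm]) (by rwa [inter_comm v u]) (h.trans inter_subset_right) hun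

end TQ


namespace TQ

section General
variable {X Y Z : Type*} [TopologicalSpace X] [TopologicalSpace Y] [TopologicalSpace Z] [T2Space Y]

lemma continuousOn_image_of_comp {f : X → Y} {φ : Y → Z} {K : Set X} (hK : IsCompact K)
    (hf : ContinuousOn f K) (h : ContinuousOn (fun x => φ (f x)) K) : ContinuousOn φ (f '' K) := by
  rw [continuousOn_iff_isClosed]
  intro t ht
  obtain ⟨u, hu, hu'⟩ := continuousOn_iff_isClosed.1 h t ht
  refine ⟨f '' (u ∩ K), ?_, ?_⟩
  · exact ((hK.inter_left hu).image_of_continuousOn (hf.mono inter_subset_right)).isClosed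
  · rw [← hu']
    ext y
    constructor
    · rintro ⟨hy, x, hx, rfl⟩
      exact ⟨⟨x, ⟨hy, hx⟩, rfl⟩, x, hx, rfl⟩
    · rintro ⟨⟨x, ⟨hx, hxK⟩, rfl⟩, -⟩
      exact ⟨hx, x, hxK, rfl⟩

/-- Injective images of intervals. -/
lemma hasLog_arc {f : ℝ → Y} {a b : ℝ} (hab : a ≤ b) (hf : ContinuousOn f (Icc a b))
    (hi : InjOn f (Icc a b)) {g : Y → ℂ} (hg : ContinuousOn g (f '' Icc a b))
    (h0 : ∀ z ∈ f '' Icc a b, g z ≠ 0) : HasLog (f '' Icc a b) g := by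
  obtain ⟨ψ, h1, h2⟩ := hasLog_Icc hab (fun t => g (f t))
    (hg.comp hf (mapsTo_image _ _)) (fun t ht => h0 _ ⟨t, ht, rfl⟩)
  have hinv : ∀ t ∈ Icc a b, Function.invFunOn f (Icc a b) (f t) = t := fun t ht =>
    hi.leftInvOn_invFunOn ht
  refine ⟨fun z => ψ (Function.invFunOn f (Icc a b) z),
    continuousOn_image_of_comp isCompact_Icc hf (h1.congr fun t ht => ?_), ?_⟩
  · simp only [hinv t ht]
  · rintro _ ⟨t, ht, rfl⟩
    simp only [hinv t ht]
    exact h2 t ht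

/-- A simple closed curve, as a periodic map. -/
structure Loop (F : ℝ → Y) : Prop where
  cont : Continuous F
  per : ∀ t, F (t + 1) = F t
  inj : ∀ s t, F s = F t → ∃ n : ℤ, s = t + n

variable {F : ℝ → Y}

lemma Loop.per_int (hF : Loop F) (t : ℝ) (n : ℤ) : F (t + n) = F t := by
  have : Function.Periodic F 1 := hF.per
  simpa using this.int_mul n t

lemma Loop.shift (hF : Loop F) (c : ℝ) : Loop (fun t => F (t + c)) := by
  refine ⟨hF.cont.comp (by fun_prop), fun t => ?_, fun s t h => ?_⟩
  · have : t + 1 + c = (t + c) + 1 := by ring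
    simp only [this, hF.per]
  · obtain ⟨n, hn⟩ := hF.inj _ _ h
    exact ⟨n, by linarith⟩

lemma Loop.range_shift (c : ℝ) : range (fun t => F (t + c)) = range F := by
  ext y; constructor
  · rintro ⟨t, rfl⟩; exact ⟨t + c, rfl⟩
  · rintro ⟨t, rfl⟩; exact ⟨t - c, by simp⟩

lemma Loop.range_eq (hF : Loop F) (c : ℝ) : range F = F '' Icc c (c + 1) := by
  ext y; constructor
  · rintro ⟨t, rfl⟩
    refine ⟨c + Int.fract (t - c), ⟨by linarith [Int.fract_nonneg (t - c)], by
      linarith [Int.fract_lt_one (t - c)]⟩, ?_⟩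
    rw [← hF.per_int _ ⌊t - c⌋]
    congr 1
    have := Int.fract_add_floor (t - c)
    linarith
  · rintro ⟨t, -, rfl⟩; exact ⟨t, rfl⟩

lemma Loop.isCompact (hF : Loop F) : IsCompact (range F) := by
  rw [hF.range_eq 0]; exact isCompact_Icc.image hF.cont

lemma Loop.injOn (hF : Loop F) {a b : ℝ} (h : b < a + 1) : InjOn F (Icc a b) := by
  intro s hs t ht hst
  obtain ⟨n, hn⟩ := hF.inj s t hst
  have h1 : (-1 : ℝ) < n := by linarith [hs.1, ht.2]
  have h2 : (n : ℝ) < 1 := by linarith [hs.2, ht.1]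
  have : n = 0 := by
    have h1' : (-1 : ℤ) < n := by exact_mod_cast h1
    have h2' : n < 1 := by exact_mod_cast h2
    omega
  simpa [this] using hn

lemma Loop.degree (hF : Loop F) {g : Y → ℂ} (hg : ContinuousOn g (range F))
    (h0 : ∀ z ∈ range F, g z ≠ 0) :
    ∃ (n : ℤ) (ψ : ℝ → ℂ), ContinuousOn ψ (Icc 0 1) ∧
      (∀ t ∈ Icc (0 : ℝ) 1, Complex.exp (ψ t) = g (F t)) ∧
      ψ 1 - ψ 0 = n * (2 * Real.pi * Complex.I) := by
  obtain ⟨ψ, h1, h2⟩ := hasLog_Icc zero_le_one (fun t => g (F t))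
    ((hg.comp_continuous hF.cont (fun t => mem_range_self t)).continuousOn)
    (fun t _ => h0 _ ⟨t, rfl⟩)
  have h01 : F 1 = F 0 := by simpa using hF.per 0
  have : Complex.exp (ψ 1) = Complex.exp (ψ 0) := by
    rw [h2 1 (by simp), h2 0 (by simp)]; simp only [h01]
  obtain ⟨n, hn⟩ := Complex.exp_eq_exp_iff_exists_int.1 this
  exact ⟨n, ψ, h1, h2, by rw [hn]; ring⟩

lemma Loop.hasLog (hF : Loop F) {g : Y → ℂ} {ψ : ℝ → ℂ} (h1 : ContinuousOn ψ (Icc 0 1))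
    (h2 : ∀ t ∈ Icc (0 : ℝ) 1, Complex.exp (ψ t) = g (F t)) (h3 : ψ 1 = ψ 0) :
    HasLog (range F) g := by
  have hr := hF.range_eq 0
  rw [zero_add] at hr
  have hinv : ∀ t ∈ Icc (0:ℝ) 1, ψ (Function.invFunOn F (Icc 0 1) (F t)) = ψ t := fun t ht => by
    have hm : F t ∈ F '' Icc 0 1 := ⟨t, ht, rfl⟩
    obtain ⟨ha, hb⟩ := Function.invFunOn_pos hm
    set s := Function.invFunOn F (Icc 0 1) (F t)
    obtain ⟨n, hn⟩ := hF.inj _ _ hb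
    have e1 : (-1 : ℝ) ≤ n := by linarith [ha.1, ht.2]
    have e2 : (n : ℝ) ≤ 1 := by linarith [ha.2, ht.1]
    have e1' : (-1 : ℤ) ≤ n := by exact_mod_cast e1
    have e2' : n ≤ 1 := by exact_mod_cast e2
    have : n = -1 ∨ n = 0 ∨ n = 1 := by omega
    rcases this with rfl | rfl | rfl
    · have hs : s = 0 := by push_cast at hn; linarith [ha.1, ht.2]
      have ht : t = 1 := by push_cast at hn; linarith
      rw [hs, ht, h3]
    · simp at hn; rw [hn]
    · have hs : s = 1 := by push_cast at hn; linarith [ha.2, ht.1]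
      have ht : t = 0 := by push_cast at hn; linarith
      rw [hs, ht, h3]
  rw [hr]
  refine ⟨fun z => ψ (Function.invFunOn F (Icc 0 1) z),
    continuousOn_image_of_comp isCompact_Icc hF.cont.continuousOn (h1.congr fun t ht => ?_), ?_⟩
  · simp only [hinv t ht]
  · rintro _ ⟨t, ht, rfl⟩
    simp only [hinv t ht]
    exact h2 t ht

lemma Loop.pair (hF : Loop F) {g1 g2 : Y → ℂ} (c1 : ContinuousOn g1 (range F))
    (c2 : ContinuousOn g2 (range F)) (h1 : ∀ z ∈ range F, g1 z ≠ 0)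
    (h2 : ∀ z ∈ range F, g2 z ≠ 0) (n1 : ¬ HasLog (range F) g1) (n2 : ¬ HasLog (range F) g2) :
    ∃ (m n : ℤ) (Φ : Y → ℂ), m ≠ 0 ∧ n ≠ 0 ∧ ContinuousOn Φ (range F) ∧
      ∀ z ∈ range F, Complex.exp (Φ z) * g2 z ^ m = g1 z ^ n := by
  obtain ⟨d1, ψ1, a1, b1, e1⟩ := hF.degree c1 h1
  obtain ⟨d2, ψ2, a2, b2, e2⟩ := hF.degree c2 h2
  have hd1 : d1 ≠ 0 := by
    rintro rfl
    exact n1 (hF.hasLog a1 b1 (by simpa [sub_eq_zero] using e1))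
  have hd2 : d2 ≠ 0 := by
    rintro rfl
    exact n2 (hF.hasLog a2 b2 (by simpa [sub_eq_zero] using e2))
  have : HasLog (range F) (fun z => g1 z ^ d2 * (g2 z ^ d1)⁻¹) := by
    refine hF.hasLog (ψ := fun t => d2 * ψ1 t - d1 * ψ2 t) ?_ ?_ ?_
    · exact (continuousOn_const.mul a1).sub (continuousOn_const.mul a2)
    · intro t ht
      rw [Complex.exp_sub, Complex.exp_int_mul, Complex.exp_int_mul, b1 t ht, b2 t ht, div_eq_mul_inv]
    · linear_combination (d2 : ℂ) * e1 - d1 * e2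
  obtain ⟨Φ, hΦ, hΦ'⟩ := this
  refine ⟨d1, d2, Φ, hd1, hd2, hΦ, fun z hz => ?_⟩
  rw [hΦ' z hz, mul_assoc, inv_mul_cancel₀ (zpow_ne_zero _ (h2 z hz)), mul_one]

end General

section Plane
variable {F : ℝ → ℂ}

lemma In_arc_empty {f : ℝ → ℂ} {a b : ℝ} (hab : a ≤ b) (hf : ContinuousOn f (Icc a b))
    (hi : InjOn f (Icc a b)) : In (f '' Icc a b) = ∅ := by
  refine Set.eq_empty_of_forall_notMem fun p hp => hp.2 ?_
  exact hasLog_arc hab hf hi (by fun_prop) fun z hz => sub_ne_zero.2 fun h => hp.1 (h ▸ hz)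

lemma frontier_In {K : Set ℂ} (hK : IsClosed K) : frontier (In K) ⊆ K := by
  intro z hz
  rw [(isOpen_In hK).frontier_eq] at hz
  rcases mem_trichotomy K z with h | h | h
  · exact h
  · exact absurd h hz.2
  · obtain ⟨w, h1, h2⟩ := mem_closure_iff.1 hz.1 _ (isOpen_Out hK) h
    exact (disj_In_Out K h2 h1).elim

/-- `F3` -/
lemma Loop.eq_In (hF : Loop F) {U : Set ℂ} (hU : IsOpen U) (hb : Bornology.IsBounded U)
    (hne : U.Nonempty) (hfr : frontier U ⊆ range F) (hd : Disjoint U (range F)) :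
    U = In (range F) := by
  have hK := hF.isCompact.isClosed
  have hsub := subset_In hU hb hK hfr hd
  refine Subset.antisymm hsub fun p2 hp2 => ?_
  by_contra hp2U
  obtain ⟨p1, hp1⟩ := hne
  have hp1' := hsub hp1
  have ne : ∀ p ∉ range F, ∀ z ∈ range F, z - p ≠ 0 := fun p hp z hz =>
    sub_ne_zero.2 fun h => hp (h ▸ hz)
  obtain ⟨m, n, Φ, hm, hn, hΦ, he⟩ := hF.pair (g1 := fun z => z - p1) (g2 := fun z => z - p2)
    (by fun_prop) (by fun_prop) (ne p1 hp1'.1) (ne p2 hp2.1) hp1'.2 hp2.2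
  have hp2c : p2 ∉ closure U := fun h => hp2.1 (hfr ⟨h, by rwa [hU.interior_eq]⟩)
  have ne2 : ∀ z ∈ closure U, z - p2 ≠ 0 := fun z hz => sub_ne_zero.2 fun h => hp2c (h ▸ hz)
  refine glue_false hU hb hK hfr hp1 hn (fun z => (z - p2) ^ m) ?_ ?_ Φ hΦ he
  · exact ContinuousOn.zpow₀ (by fun_prop) _ fun z hz => Or.inl (ne2 z hz)
  · exact fun z hz => zpow_ne_zero _ (ne2 z hz)

/-- `F5` -/
lemma Loop.isPreconnected_In (hF : Loop F) : IsPreconnected (In (range F)) := by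
  have hK := hF.isCompact.isClosed
  intro u v hu hv huv hun hvn
  by_contra hne
  rw [Set.not_nonempty_iff_eq_empty] at hne
  have key : ∀ u v : Set ℂ, IsOpen u → IsOpen v → In (range F) ⊆ u ∪ v →
      In (range F) ∩ (u ∩ v) = ∅ → (In (range F) ∩ u).Nonempty → In (range F) ∩ u = In (range F) := by
    intro u v hu hv huv hd hne
    refine hF.eq_In ((isOpen_In hK).inter hu) ((In_bounded hF.isCompact).subset inter_subset_left)
      hne ?_ (Set.disjoint_left.2 fun z hz hz' => hz.1.1 hz')
    intro z hz
    rw [((isOpen_In hK).inter hu).frontier_eq] at hz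
    rcases mem_trichotomy (range F) z with h | h | h
    · exact h
    · exfalso
      rcases huv h with h' | h'
      · exact hz.2 ⟨h, h'⟩
      · obtain ⟨w, h1, h2⟩ := mem_closure_iff.1 hz.1 v hv h'
        have : w ∈ In (range F) ∩ (u ∩ v) := ⟨h2.1, h2.2, h1⟩
        rw [hd] at this; exact this
    · obtain ⟨w, h1, h2⟩ := mem_closure_iff.1 hz.1 _ (isOpen_Out hK) h
      exact (disj_In_Out _ h2.1 h1).elim
  have h1 := key u v hu hv huv hne hun
  obtain ⟨z, hz⟩ := hvn
  have hzu : z ∈ In (range F) ∩ u := by rw [h1]; exact hz.1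
  have : z ∈ In (range F) ∩ (u ∩ v) := ⟨hz.1, hzu.2, hz.2⟩
  rw [hne] at this; exact this

lemma Loop.frontier_subset_false (hF : Loop F) {U : Set ℂ} (hU : IsOpen U)
    (hb : Bornology.IsBounded U) (hne : (U \ range F).Nonempty)
    (hfr : frontier U ⊆ range F) (y : ℂ) (hy : y ∈ range F) : y ∈ frontier U := by
  by_contra hyf
  obtain ⟨c, rfl⟩ := hy
  have hcl : IsClosed (F ⁻¹' frontier U) := isClosed_frontier.preimage hF.cont
  obtain ⟨δ, hδ, hball⟩ := Metric.isOpen_iff.1 hcl.isOpen_compl c hyf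
  set ε := min (δ / 2) (1 / 4) with hε
  have hε0 : 0 < ε := by positivity
  have hεδ : ε < δ := (min_le_left _ _).trans_lt (by linarith)
  have hε4 : ε ≤ 1 / 4 := min_le_right _ _
  have hsub : frontier U ⊆ F '' Icc (c + ε) (c + 1 - ε) := by
    intro z hz
    have hzr := hfr hz
    rw [hF.range_eq c] at hzr
    obtain ⟨t, ht, rfl⟩ := hzr
    refine ⟨t, ⟨?_, ?_⟩, rfl⟩
    · by_contra h
      refine hball (a := t) ?_ hz
      rw [Metric.mem_ball, Real.dist_eq, abs_lt]
      constructor <;> linarith [ht.1]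
    · by_contra h
      refine hball (a := t - 1) ?_ ?_
      · rw [Metric.mem_ball, Real.dist_eq, abs_lt]
        constructor <;> linarith [ht.2]
      · have := hF.per (t - 1)
        rw [sub_add_cancel] at this
        change F (t - 1) ∈ frontier U
        rw [← this]; exact hz
  have hA : IsCompact (F '' Icc (c + ε) (c + 1 - ε)) := isCompact_Icc.image hF.cont
  set A := F '' Icc (c + ε) (c + 1 - ε)
  have hfr2 : frontier (U \ A) ⊆ A := by
    intro z hz
    have h1 : frontier (U ∩ Aᶜ) ⊆ _ := frontier_inter_subset U Aᶜ
    rcases h1 hz with h | h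
    · exact hsub h.1
    · rw [frontier_compl] at h
      exact hA.isClosed.frontier_subset h.2
  have := subset_In (hU.sdiff hA.isClosed) (hb.subset sdiff_subset) hA.isClosed hfr2 disjoint_sdiff_left
  rw [In_arc_empty (by linarith) hF.cont.continuousOn (hF.injOn (by linarith))] at this
  obtain ⟨z, hz⟩ := hne
  exact this ⟨hz.1, fun h => hz.2 (image_subset_range _ _ h)⟩

/-- `F6` -/
lemma Loop.frontier_In_eq (hF : Loop F) (hne : (In (range F)).Nonempty) :
    frontier (In (range F)) = range F :=
  Subset.antisymm (frontier_In hF.isCompact.isClosed) fun y hy =>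
    hF.frontier_subset_false (isOpen_In hF.isCompact.isClosed) (In_bounded hF.isCompact)
      (hne.mono fun z hz => ⟨hz, hz.1⟩) (frontier_In hF.isCompact.isClosed) y hy

lemma frontier_Out {K : Set ℂ} (hK : IsClosed K) : frontier (Out K) ⊆ K := by
  intro z hz
  rw [(isOpen_Out hK).frontier_eq] at hz
  rcases mem_trichotomy K z with h | h | h
  · exact h
  · obtain ⟨w, h1, h2⟩ := mem_closure_iff.1 hz.1 _ (isOpen_In hK) h
    exact (disj_In_Out K h1 h2).elim
  · exact absurd h hz.2

lemma Out_cobounded {K : Set ℂ} (hK : IsCompact K) : Bornology.IsBounded (Out K)ᶜ := by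
  refine ((In_bounded hK).union hK.isBounded).subset fun z hz => ?_
  rcases mem_trichotomy K z with h | h | h
  · exact Or.inr h
  · exact Or.inl h
  · exact absurd h hz

/-- `F6'` -/
lemma Loop.subset_closure_Out (hF : Loop F) (hne : (In (range F)).Nonempty) :
    range F ⊆ closure (Out (range F)) := by
  intro y hy
  have hK := hF.isCompact.isClosed
  have hfr : frontier (closure (Out (range F)))ᶜ ⊆ frontier (Out (range F)) := by
    rw [frontier_compl]; exact frontier_closure_subset
  have h := hF.frontier_subset_false (U := (closure (Out (range F)))ᶜ) isClosed_closure.isOpen_compl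
    ((Out_cobounded hF.isCompact).subset (compl_subset_compl.2 subset_closure)) ?_
    (hfr.trans (frontier_Out hK)) y hy
  · exact frontier_subset_closure (hfr h)
  · obtain ⟨p, hp⟩ := hne
    refine ⟨p, fun hpc => ?_, hp.1⟩
    obtain ⟨w, h1, h2⟩ := mem_closure_iff.1 hpc _ (isOpen_In hK) hp
    exact disj_In_Out _ h1 h2

lemma Loop.closure_In (hF : Loop F) (hne : (In (range F)).Nonempty) :
    closure (In (range F)) = In (range F) ∪ range F := by
  rw [closure_eq_self_union_frontier, hF.frontier_In_eq hne]

end Plane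

end TQ


namespace TQ

section Arcs
variable {X : Type*} [TopologicalSpace X] [T2Space X]

/-- `A` is an arc from `p` to `q`. -/
def Arc (A : Set X) (p q : X) : Prop :=
  ∃ f : ℝ → X, ContinuousOn f (Icc 0 1) ∧ InjOn f (Icc 0 1) ∧ f 0 = p ∧ f 1 = q ∧ A = f '' Icc 0 1

variable {A B : Set X} {p q r s : X}

lemma arc_of_Icc {f : ℝ → X} {a b : ℝ} (hab : a < b) (hf : ContinuousOn f (Icc a b))
    (hi : InjOn f (Icc a b)) : Arc (f '' Icc a b) (f a) (f b) := by
  have hba : 0 < b - a := sub_pos.2 hab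
  have him : (fun t : ℝ => a + t * (b - a)) '' Icc 0 1 = Icc a b := by
    ext x; constructor
    · rintro ⟨t, ⟨h0, h1⟩, rfl⟩
      constructor <;> simp only <;> nlinarith
    · rintro ⟨h0, h1⟩
      refine ⟨(x - a) / (b - a), ⟨by apply div_nonneg <;> linarith, by
        rw [div_le_one hba]; linarith⟩, ?_⟩
      field_simp; ring
  have hm : MapsTo (fun t : ℝ => a + t * (b - a)) (Icc 0 1) (Icc a b) := by
    rw [← him]; exact mapsTo_image _ _
  refine ⟨fun t => f (a + t * (b - a)), hf.comp (by fun_prop) hm, ?_, by simp, by simp, ?_⟩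
  · intro x hx y hy h
    have := hi (hm hx) (hm hy) h
    simp only [add_right_inj] at this
    exact mul_right_cancel₀ hba.ne' this
  · rw [← him, image_image]

lemma Arc.symm (h : Arc A p q) : Arc A q p := by
  obtain ⟨f, hf, hi, h0, h1, rfl⟩ := h
  have hm : MapsTo (fun t : ℝ => 1 - t) (Icc 0 1) (Icc 0 1) := fun t ht =>
    ⟨by linarith [ht.2], by linarith [ht.1]⟩
  refine ⟨fun t => f (1 - t), hf.comp (by fun_prop) hm, ?_, by simp [h1], by simp [h0], ?_⟩
  · intro x hx y hy h
    have := hi (hm hx) (hm hy) h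
    linarith
  · ext y; constructor
    · rintro ⟨t, ht, rfl⟩; exact ⟨1 - t, hm ht, by simp⟩
    · rintro ⟨t, ht, rfl⟩; exact ⟨1 - t, hm ht, rfl⟩

lemma Arc.isCompact (h : Arc A p q) : IsCompact A := by
  obtain ⟨f, hf, hi, h0, h1, rfl⟩ := h
  exact isCompact_Icc.image_of_continuousOn hf

lemma Arc.isClosed (h : Arc A p q) : IsClosed A := h.isCompact.isClosed

lemma Arc.isPreconnected (h : Arc A p q) : IsPreconnected A := by
  obtain ⟨f, hf, hi, h0, h1, rfl⟩ := h
  exact isPreconnected_Icc.image _ hf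

lemma Arc.left_mem (h : Arc A p q) : p ∈ A := by
  obtain ⟨f, hf, hi, h0, h1, rfl⟩ := h
  exact ⟨0, by simp, h0⟩

lemma Arc.right_mem (h : Arc A p q) : q ∈ A := h.symm.left_mem

lemma Arc.ne (h : Arc A p q) : p ≠ q := by
  obtain ⟨f, hf, hi, h0, h1, rfl⟩ := h
  rintro rfl
  have := hi (by simp) (by simp) (h0.trans h1.symm)
  norm_num at this

lemma Arc.trans (h : Arc A p q) (h' : Arc B q r) (hAB : A ∩ B = {q}) : Arc (A ∪ B) p r := by
  obtain ⟨f, hf, hi, h0, h1, rfl⟩ := h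
  obtain ⟨g, hg, hj, k0, k1, rfl⟩ := h'
  have e1 : ∀ t ∈ Icc (0:ℝ) 1, (if t ≤ 1 then f t else g (t - 1)) = f t := fun t ht => if_pos ht.2
  have e2 : ∀ t ∈ Icc (1:ℝ) 2, (if t ≤ 1 then f t else g (t - 1)) = g (t - 1) := fun t ht => by
    rcases eq_or_lt_of_le ht.1 with h | h
    · subst h; simp [h1, k0]
    · exact if_neg (not_le.2 h)
  have hm : MapsTo (fun t : ℝ => t - 1) (Icc 1 2) (Icc 0 1) := fun t ht =>
    ⟨by linarith [ht.1], by linarith [ht.2]⟩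
  have hu : Icc (0:ℝ) 1 ∪ Icc 1 2 = Icc 0 2 := Icc_union_Icc_eq_Icc (by norm_num) (by norm_num)
  have him : (fun t => if t ≤ 1 then f t else g (t - 1)) '' Icc (0:ℝ) 2 =
      f '' Icc 0 1 ∪ g '' Icc 0 1 := by
    rw [← hu, image_union, image_congr e1, image_congr e2]
    congr 1
    ext y; constructor
    · rintro ⟨t, ht, rfl⟩; exact ⟨t - 1, hm ht, rfl⟩
    · rintro ⟨t, ht, rfl⟩
      exact ⟨t + 1, ⟨by linarith [ht.1], by linarith [ht.2]⟩, by simp⟩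
  have key : ∀ x ∈ Icc (0:ℝ) 1, ∀ y ∈ Icc (1:ℝ) 2, f x = g (y - 1) → x = y := by
    intro x hx y hy hxy
    have hq : f x ∈ f '' Icc 0 1 ∩ g '' Icc 0 1 := ⟨⟨x, hx, rfl⟩, hxy ▸ ⟨y - 1, hm hy, rfl⟩⟩
    rw [hAB] at hq
    have hq : f x = q := hq
    have hx1 : x = 1 := hi hx (by simp) (hq.trans h1.symm)
    have hy1 : y - 1 = 0 := hj (hm hy) (by simp) (by rw [k0, ← hq, hxy])
    linarith
  have := arc_of_Icc (f := fun t => if t ≤ 1 then f t else g (t - 1)) (a := 0) (b := 2) (by norm_num)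
    ?_ ?_
  · rw [him] at this
    convert this using 1
    · simp [h0]
    · norm_num [k1]
  · rw [← hu]
    refine ContinuousOn.union_of_isClosed (hf.congr e1) ((hg.comp (by fun_prop) hm).congr e2)
      isClosed_Icc isClosed_Icc
  · rw [← hu]
    rintro x (hx | hx) y (hy | hy) hxy
    · simp only [e1 x hx, e1 y hy] at hxy; exact hi hx hy hxy
    · simp only [e1 x hx, e2 y hy] at hxy; exact key x hx y hy hxy
    · simp only [e2 x hx, e1 y hy] at hxy; exact (key y hy x hx hxy.symm).symm
    · simp only [e2 x hx, e2 y hy] at hxy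
      have := hj (hm hx) (hm hy) hxy
      linarith

lemma Arc.split (h : Arc A p q) {z : X} (hz : z ∈ A) (hp : z ≠ p) (hq : z ≠ q) :
    ∃ B1 B2, Arc B1 p z ∧ Arc B2 z q ∧ A = B1 ∪ B2 ∧ B1 ∩ B2 = {z} := by
  obtain ⟨f, hf, hi, h0, h1, rfl⟩ := h
  obtain ⟨t, ht, rfl⟩ := hz
  have t0 : 0 < t := lt_of_le_of_ne ht.1 fun h => hp (by rw [← h, h0])
  have t1 : t < 1 := lt_of_le_of_ne ht.2 fun h => hq (by rw [h, h1])
  have s1 : Icc 0 t ⊆ Icc 0 1 := Icc_subset_Icc_right ht.2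
  have s2 : Icc t 1 ⊆ Icc 0 1 := Icc_subset_Icc_left ht.1
  refine ⟨f '' Icc 0 t, f '' Icc t 1, ?_, ?_, ?_, ?_⟩
  · have := arc_of_Icc t0 (hf.mono s1) (hi.mono s1); rwa [h0] at this
  · have := arc_of_Icc t1 (hf.mono s2) (hi.mono s2); rwa [h1] at this
  · rw [← image_union, Icc_union_Icc_eq_Icc ht.1 ht.2]
  · rw [← hi.image_inter s1 s2]
    rw [Icc_inter_Icc_eq_singleton ht.1 ht.2, image_singleton]

lemma Arc.firstHit (h : Arc A p q) {K : Set X} (hK : IsClosed K) (hp : p ∉ K)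
    (hne : (A ∩ K).Nonempty) : ∃ z ∈ K, ∃ B ⊆ A, Arc B p z ∧ B ∩ K = {z} ∧
      ∀ᶠ x in 𝓝 p, x ∈ A → x ∈ B := by
  obtain ⟨f, hf, hi, h0, h1, rfl⟩ := h
  obtain ⟨_, ⟨t₁, ht₁, rfl⟩, hk₁⟩ := hne
  set S := Icc (0:ℝ) 1 ∩ f ⁻¹' K with hS
  have hSc : IsClosed S := hf.preimage_isClosed_of_isClosed isClosed_Icc hK
  have hSne : S.Nonempty := ⟨t₁, ht₁, hk₁⟩
  have hSb : BddBelow S := ⟨0, fun x hx => hx.1.1⟩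
  set t := sInf S with ht
  have htS : t ∈ S := hSc.csInf_mem hSne hSb
  have t0 : 0 < t := lt_of_le_of_ne htS.1.1 fun h => hp (by rw [← h0, h]; exact htS.2)
  have s1 : Icc 0 t ⊆ Icc 0 1 := Icc_subset_Icc_right htS.1.2
  have s2 : Icc t 1 ⊆ Icc 0 1 := Icc_subset_Icc_left htS.1.1
  refine ⟨f t, htS.2, f '' Icc 0 t, image_mono s1, ?_, ?_, ?_⟩
  · have := arc_of_Icc t0 (hf.mono s1) (hi.mono s1); rwa [h0] at this
  · ext x; constructor
    · rintro ⟨⟨u, hu, rfl⟩, hxK⟩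
      have : t ≤ u := csInf_le hSb ⟨s1 hu, hxK⟩
      rw [le_antisymm hu.2 this]; rfl
    · rintro rfl
      exact ⟨⟨t, ⟨t0.le, le_rfl⟩, rfl⟩, htS.2⟩
  · have hc : IsClosed (f '' Icc t 1) := (isCompact_Icc.image_of_continuousOn (hf.mono s2)).isClosed
    have hpc : p ∉ f '' Icc t 1 := by
      rintro ⟨u, hu, hu'⟩
      have := hi (s2 hu) (by simp) (hu'.trans h0.symm)
      linarith [hu.1]
    filter_upwards [hc.isOpen_compl.mem_nhds hpc] with x hx
    rintro ⟨u, hu, rfl⟩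
    rcases le_total u t with h | h
    · exact ⟨u, ⟨hu.1, h⟩, rfl⟩
    · exact absurd ⟨u, ⟨h, hu.2⟩, rfl⟩ hx

lemma Arc.join (hA : Arc A p q) (hB : Arc B s r) (hp : p ∉ B) (hr : r ∉ A)
    (hne : (A ∩ B).Nonempty) : ∃ E ⊆ A ∪ B, Arc E p r ∧ (∀ᶠ x in 𝓝 p, x ∈ A → x ∈ E) ∧
      (∀ᶠ x in 𝓝 r, x ∈ B → x ∈ E) := by
  obtain ⟨z, hz, A', hA'A, hA', hA'B, hg⟩ := hA.firstHit hB.isClosed hp hne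
  have hzA : z ∈ A := hA'A hA'.right_mem
  by_cases hzs : z = s
  · subst hzs
    refine ⟨A' ∪ B, union_subset_union_left _ hA'A, hA'.trans hB hA'B, ?_, ?_⟩
    · filter_upwards [hg] with x hx hxA using Or.inl (hx hxA)
    · filter_upwards with x hx using Or.inr hx
  · have hzr : z ≠ r := fun h => hr (h ▸ hzA)
    obtain ⟨B1, B2, h1, h2, h3, h4⟩ := hB.split hz hzs hzr
    have hB2 : B2 ⊆ B := h3 ▸ subset_union_right
    refine ⟨A' ∪ B2, union_subset_union hA'A hB2, hA'.trans h2 ?_, ?_, ?_⟩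
    · refine Subset.antisymm ?_ ?_
      · rw [← hA'B]; exact inter_subset_inter_right _ hB2
      · rintro x rfl; exact ⟨hA'.right_mem, h2.left_mem⟩
    · filter_upwards [hg] with x hx hxA using Or.inl (hx hxA)
    · have : r ∉ B1 := fun h => hzr (by
        have : r ∈ B1 ∩ B2 := ⟨h, h2.right_mem⟩
        rw [h4] at this; exact this.symm)
      filter_upwards [h1.isClosed.isOpen_compl.mem_nhds this] with x hx hxB
      rw [h3] at hxB
      exact Or.inr (hxB.resolve_left hx)

end Arcs

section PlaneArcs

lemma arc_segment {p q : ℂ} (h : p ≠ q) : Arc (segment ℝ p q) p q := by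
  refine ⟨fun t => AffineMap.lineMap p q t, ?_, ?_, by simp, by simp, ?_⟩
  · exact AffineMap.lineMap_continuous.continuousOn
  · exact (AffineMap.lineMap_injective ℝ h).injOn
  · rw [segment_eq_image_lineMap]

lemma arc_connected {U : Set ℂ} (hU : IsOpen U) (hc : IsPreconnected U) {p q : ℂ} (hp : p ∈ U)
    (hq : q ∈ U) (hpq : p ≠ q) : ∃ A ⊆ U, Arc A p q := by
  set S : Set ℂ := {z | z ∈ U ∧ (z = p ∨ ∃ A ⊆ U, Arc A p z)} with hS
  have step : ∀ z ∈ S, ∀ w, segment ℝ z w ⊆ U → w ∈ S := by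
    rintro z ⟨hzU, hz⟩ w hw
    have hwU : w ∈ U := hw (right_mem_segment ℝ z w)
    refine ⟨hwU, ?_⟩
    by_cases hwp : w = p
    · exact Or.inl hwp
    right
    by_cases hps : p ∈ segment ℝ z w
    · refine ⟨segment ℝ p w, ?_, arc_segment (Ne.symm hwp)⟩
      exact (convex_segment z w).segment_subset hps (right_mem_segment ℝ z w) |>.trans hw
    rcases hz with rfl | ⟨A, hAU, hA⟩
    · exact absurd (left_mem_segment ℝ z w) hps
    by_cases hwA : w ∈ A
    · by_cases hwz : w = z
      · subst hwz; exact ⟨A, hAU, hA⟩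
      obtain ⟨B1, B2, h1, h2, h3, h4⟩ := hA.split hwA hwp hwz
      exact ⟨B1, (h3 ▸ subset_union_left).trans hAU, h1⟩
    have hzw : z ≠ w := fun h => hwA (h ▸ hA.right_mem)
    obtain ⟨E, hE, hE', -, -⟩ := hA.join (arc_segment hzw) hps hwA
      ⟨z, hA.right_mem, left_mem_segment ℝ z w⟩
    exact ⟨E, hE.trans (union_subset hAU hw), hE'⟩
  have hSo : IsOpen S := by
    rw [Metric.isOpen_iff]
    intro z hz
    obtain ⟨r, hr, hb⟩ := Metric.isOpen_iff.1 hU z hz.1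
    exact ⟨r, hr, fun w hw => step z hz w
      (((convex_ball z r).segment_subset (Metric.mem_ball_self hr) hw).trans hb)⟩
  have hTo : IsOpen (U \ S) := by
    rw [Metric.isOpen_iff]
    intro z hz
    obtain ⟨r, hr, hb⟩ := Metric.isOpen_iff.1 hU z hz.1
    refine ⟨r, hr, fun w hw => ⟨hb hw, fun hwS => hz.2 (step w hwS z
      (((convex_ball z r).segment_subset hw (Metric.mem_ball_self hr)).trans hb))⟩⟩
  have hsub : U ⊆ S := hc.subset_left_of_subset_union hSo hTo disjoint_sdiff_right
    (fun z hz => by by_cases h : z ∈ S; exacts [Or.inl h, Or.inr ⟨hz, h⟩])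
    ⟨p, hp, hp, Or.inl rfl⟩
  rcases (hsub hq).2 with h | h
  · exact absurd h.symm hpq
  · exact h

end PlaneArcs

end TQ


namespace TQ

section
variable {X : Type*} [TopologicalSpace X] [T2Space X]

lemma Arc.shrink {A : Set X} {p q : X} (h : Arc A p q) {V : Set X} (hV : V ∈ 𝓝 p) :
    ∃ z, ∃ B ⊆ A ∩ V, Arc B p z ∧ ∀ᶠ x in 𝓝 p, x ∈ A → x ∈ B := by
  obtain ⟨f, hf, hi, h0, h1, rfl⟩ := h
  have hc : ContinuousWithinAt f (Icc 0 1) 0 := hf 0 (by simp)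
  rw [← h0] at hV
  have hmem := hc hV
  rw [mem_map, Metric.mem_nhdsWithin_iff] at hmem
  obtain ⟨δ, hδ, hb⟩ := hmem
  set ε := min (δ / 2) (1 / 2) with hε
  have hε0 : 0 < ε := by positivity
  have hεδ : ε < δ := (min_le_left _ _).trans_lt (by linarith)
  have hε1 : ε ≤ 1 / 2 := min_le_right _ _
  have s1 : Icc 0 ε ⊆ Icc (0:ℝ) 1 := Icc_subset_Icc_right (by linarith)
  have s2 : Icc ε 1 ⊆ Icc (0:ℝ) 1 := Icc_subset_Icc_left hε0.le
  refine ⟨f ε, f '' Icc 0 ε, ?_, ?_, ?_⟩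
  · rintro _ ⟨t, ht, rfl⟩
    refine ⟨⟨t, s1 ht, rfl⟩, hb ⟨?_, s1 ht⟩⟩
    rw [Metric.mem_ball, Real.dist_eq, abs_lt]
    constructor <;> linarith [ht.1, ht.2]
  · have := arc_of_Icc hε0 (hf.mono s1) (hi.mono s1); rwa [h0] at this
  · have hc : IsClosed (f '' Icc ε 1) := (isCompact_Icc.image_of_continuousOn (hf.mono s2)).isClosed
    have hpc : p ∉ f '' Icc ε 1 := by
      rintro ⟨u, hu, hu'⟩
      have := hi (s2 hu) (by simp) (hu'.trans h0.symm)
      linarith [hu.1]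
    filter_upwards [hc.isOpen_compl.mem_nhds hpc] with x hx
    rintro ⟨u, hu, rfl⟩
    rcases le_total u ε with h | h
    · exact ⟨u, ⟨hu.1, h⟩, rfl⟩
    · exact absurd ⟨u, ⟨h, hu.2⟩, rfl⟩ hx

end

lemma hasLog_Arc {A : Set ℂ} {p q : ℂ} (h : Arc A p q) {g : ℂ → ℂ} (hg : ContinuousOn g A)
    (h0 : ∀ z ∈ A, g z ≠ 0) : HasLog A g := by
  obtain ⟨f, hf, hi, -, -, rfl⟩ := h
  exact hasLog_arc zero_le_one hf hi hg h0

lemma hasLog_of_In_empty {K L : Set ℂ} (h : In K = ∅) (hL : L ⊆ K) {z : ℂ} (hz : z ∉ K) :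
    HasLog L (fun w => w - z) := by
  refine HasLog.mono ?_ hL
  by_contra hn
  have : z ∈ In K := ⟨hz, hn⟩
  rw [h] at this; exact this

lemma In_step {Y R e : Set ℂ} {y r : ℂ} (hY : IsClosed Y) (hR : IsClosed R) (he : Arc e y r)
    (hd : Disjoint Y R) (h1 : Y ∩ e = {y}) (h2 : R ∩ e = {r}) (h : In (Y ∪ R) = ∅) :
    In (Y ∪ R ∪ e) = ∅ := by
  refine Set.eq_empty_of_forall_notMem fun p hp => hp.2 ?_
  have hpYR : p ∉ Y ∪ R := fun h => hp.1 (Or.inl h)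
  have l1 := hasLog_of_In_empty h (subset_union_left (s := Y) (t := R)) hpYR
  have l2 := hasLog_of_In_empty h (subset_union_right (s := Y) (t := R)) hpYR
  have l3 : HasLog e (fun w => w - p) := hasLog_Arc he (by fun_prop)
    fun z hz => sub_ne_zero.2 fun h => hp.1 (Or.inr (h ▸ hz))
  have l4 := hasLog_union hY he.isClosed (by rw [h1]; exact isPreconnected_singleton) l1 l3
  have l5 := hasLog_union (hY.union he.isClosed) hR (by
    rw [union_inter_distrib_right, hd.inter_eq, empty_union, inter_comm, h2]
    exact isPreconnected_singleton) l4 l2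
  refine l5.mono ?_
  rintro z ((h | h) | h)
  · exact Or.inl (Or.inl h)
  · exact Or.inr h
  · exact Or.inl (Or.inr h)

lemma In_union_disjoint {Y R : Set ℂ} (hY : IsClosed Y) (hR : IsClosed R) (hd : Disjoint Y R)
    (h1 : In Y = ∅) (h2 : In R = ∅) : In (Y ∪ R) = ∅ := by
  refine Set.eq_empty_of_forall_notMem fun p hp => hp.2 ?_
  exact hasLog_union_disjoint hY hR hd
    (hasLog_of_In_empty h1 Subset.rfl fun h => hp.1 (Or.inl h))
    (hasLog_of_In_empty h2 Subset.rfl fun h => hp.1 (Or.inr h))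

lemma In_empty_compl {X : Set ℂ} (hX : In X = ∅) : Xᶜ = Out X := by
  ext z
  constructor
  · intro hz
    rcases mem_trichotomy X z with h | h | h
    · exact absurd h hz
    · rw [hX] at h; exact h.elim
    · exact h
  · exact fun h => h.1

/-- Connect two points of `X` by an arc in the complement of `X`, along prescribed collars. -/
lemma connect_step {X : Set ℂ} (hXc : IsCompact X) (hX : In X = ∅) {q p q' p' : ℂ} (hqX : q ∈ X)
    (hpX : p ∈ X) (hqp : q ≠ p) {Cq Cp : Set ℂ} (hCq : Arc Cq q q') (hCp : Arc Cp p p')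
    (hq : Cq ∩ X ⊆ {q}) (hp : Cp ∩ X ⊆ {p}) :
    ∃ E, Arc E q p ∧ E ∩ X = {q, p} ∧ (∀ᶠ x in 𝓝 q, x ∈ Cq → x ∈ E) ∧
      (∀ᶠ x in 𝓝 p, x ∈ Cp → x ∈ E) := by
  obtain ⟨V, W, hV, hW, hqV, hpW, hVW⟩ := t2_separation hqp
  obtain ⟨c, C, hC, hCa, hCg⟩ := hCq.shrink (hV.mem_nhds hqV)
  obtain ⟨d, D, hD, hDa, hDg⟩ := hCp.shrink (hW.mem_nhds hpW)
  have hCX : C ∩ X ⊆ {q} := fun z hz => hq ⟨(hC hz.1).1, hz.2⟩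
  have hDX : D ∩ X ⊆ {p} := fun z hz => hp ⟨(hD hz.1).1, hz.2⟩
  have hCD : ∀ z ∈ C, z ∉ D := fun z h1 h2 => Set.disjoint_left.1 hVW (hC h1).2 (hD h2).2
  have hcX : c ∈ Xᶜ := fun h => hCa.ne (hCX ⟨hCa.right_mem, h⟩ : c = q).symm
  have hdX : d ∈ Xᶜ := fun h => hDa.ne (hDX ⟨hDa.right_mem, h⟩ : d = p).symm
  have hcd : c ≠ d := fun h => hCD c hCa.right_mem (h ▸ hDa.right_mem)
  obtain ⟨A, hAX, hA⟩ := arc_connected hXc.isClosed.isOpen_compl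
    (by rw [In_empty_compl hX]; exact isPreconnected_Out hXc) hcX hdX hcd
  obtain ⟨E1, hE1, hE1a, hg1, -⟩ := hCa.join hA (fun h => hAX h hqX)
    (fun h => hCD d h hDa.right_mem) ⟨c, hCa.right_mem, hA.left_mem⟩
  have hpE1 : p ∉ E1 := fun h => by
    rcases hE1 h with h | h
    · exact hCD p h hDa.left_mem
    · exact hAX h hpX
  obtain ⟨E, hE, hEa, hg2, hg3⟩ := hE1a.join hDa.symm (fun h => hCD q hCa.left_mem h) hpE1
    ⟨d, hE1a.right_mem, hDa.right_mem⟩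
  refine ⟨E, hEa, ?_, ?_, ?_⟩
  · refine Subset.antisymm ?_ ?_
    · rintro z ⟨hz, hzX⟩
      rcases hE hz with h | h
      · rcases hE1 h with h | h
        · exact Or.inl (hCX ⟨h, hzX⟩)
        · exact absurd hzX (hAX h)
      · exact Or.inr (hDX ⟨h, hzX⟩)
    · rintro z (rfl | rfl)
      · exact ⟨hEa.left_mem, hqX⟩
      · exact ⟨hEa.right_mem, hpX⟩
  · filter_upwards [hCg, hg1, hg2] with x h1 h2 h3 h using h3 (h2 (h1 h))
  · filter_upwards [hDg, hg3] with x h1 h3 h using h3 (h1 h)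

lemma In_biUnion {K : ℕ → Set ℂ} (n : ℕ) (hK : ∀ i < n, IsCompact (K i))
    (hd : ∀ i < n, ∀ j < n, i ≠ j → Disjoint (K i) (K j)) (h : ∀ i < n, In (K i) = ∅) :
    In (⋃ i ∈ Iio n, K i) = ∅ := by
  induction n with
  | zero =>
    refine Set.eq_empty_of_forall_notMem fun p hp => hp.2 ?_
    exact ⟨fun _ => 0, continuousOn_const, by simp⟩
  | succ n ih =>
    have e : (⋃ i ∈ Iio (n + 1), K i) = (⋃ i ∈ Iio n, K i) ∪ K n := by
      ext z; simp only [mem_iUnion, mem_Iio, mem_union, exists_prop]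
      constructor
      · rintro ⟨i, hi, hz⟩
        rcases Nat.lt_succ_iff_lt_or_eq.1 hi with h | rfl
        · exact Or.inl ⟨i, h, hz⟩
        · exact Or.inr hz
      · rintro (⟨i, hi, hz⟩ | hz)
        · exact ⟨i, by omega, hz⟩
        · exact ⟨n, by omega, hz⟩
    rw [e]
    refine In_union_disjoint ?_ (hK n (by omega)).isClosed ?_
      (ih (fun i hi => hK i (by omega)) (fun i hi j hj => hd i (by omega) j (by omega))
        (fun i hi => h i (by omega))) (h n (by omega))
    · exact ((finite_Iio n).isCompact_biUnion fun i hi => hK i (by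
        have : i < n := hi
        omega)).isClosed
    · refine Set.disjoint_left.2 fun z hz hz' => ?_
      simp only [mem_iUnion, mem_Iio, exists_prop] at hz
      obtain ⟨i, hi, hz⟩ := hz
      exact Set.disjoint_left.1 (hd i (by omega) n (by omega) (by omega)) hz hz'

/-- M4 -/
theorem connecting_arcs (n : ℕ) (hn : 2 ≤ n) (K : ℕ → Set ℂ) (q p q' p' : ℕ → ℂ)
    (Cq Cp : ℕ → Set ℂ) (hK : ∀ i < n, IsCompact (K i))
    (hd : ∀ i < n, ∀ j < n, i ≠ j → Disjoint (K i) (K j)) (hIn : ∀ i < n, In (K i) = ∅)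
    (hq : ∀ i < n, q i ∈ K i) (hp : ∀ i < n, p i ∈ K i) (hqp : ∀ i < n, q i ≠ p i)
    (hCq : ∀ i < n, Arc (Cq i) (q i) (q' i)) (hCp : ∀ i < n, Arc (Cp i) (p i) (p' i))
    (hCqK : ∀ i < n, Cq i ∩ (⋃ j ∈ Iio n, K j) ⊆ {q i})
    (hCpK : ∀ i < n, Cp i ∩ (⋃ j ∈ Iio n, K j) ⊆ {p i}) :
    ∃ e : ℕ → Set ℂ, ∀ i < n, Arc (e i) (q i) (p ((i + 1) % n)) ∧
      e i ∩ (⋃ j ∈ Iio n, K j) = {q i, p ((i + 1) % n)} ∧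
      (∀ᶠ x in 𝓝 (q i), x ∈ Cq i → x ∈ e i) ∧
      (∀ᶠ x in 𝓝 (p ((i + 1) % n)), x ∈ Cp ((i + 1) % n) → x ∈ e i) ∧
      ∀ j < n, j ≠ i → Disjoint (e i) (e j) := by
  set L := ⋃ j ∈ Iio n, K j with hL
  have hLc : IsCompact L := (finite_Iio n).isCompact_biUnion fun i hi => hK i hi
  have memL : ∀ i < n, ∀ z ∈ K i, z ∈ L := fun i hi z hz => by
    simp only [hL, mem_iUnion, mem_Iio, exists_prop]; exact ⟨i, hi, hz⟩
  have sep : ∀ i < n, ∀ j < n, ∀ z, z ∈ K i → z ∈ K j → i = j := fun i hi j hj z h1 h2 => by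
    by_contra hne
    exact Set.disjoint_left.1 (hd i hi j hj hne) h1 h2
  have nx : ∀ i, (i + 1) % n < n := fun i => Nat.mod_lt _ (by omega)
  -- induction
  have main : ∀ m ≤ n, ∃ e : ℕ → Set ℂ, (∀ i < m, Arc (e i) (q i) (p ((i + 1) % n)) ∧
      e i ∩ L = {q i, p ((i + 1) % n)} ∧
      (∀ᶠ x in 𝓝 (q i), x ∈ Cq i → x ∈ e i) ∧
      (∀ᶠ x in 𝓝 (p ((i + 1) % n)), x ∈ Cp ((i + 1) % n) → x ∈ e i) ∧
      ∀ j < m, j ≠ i → Disjoint (e i) (e j)) ∧ (m < n → In (L ∪ ⋃ i ∈ Iio m, e i) = ∅) := by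
    intro m
    induction m with
    | zero =>
      intro _
      refine ⟨fun _ => ∅, fun i hi => absurd hi (by omega), fun _ => ?_⟩
      have h0 : L ∪ ⋃ i ∈ Iio 0, (fun _ => ∅ : ℕ → Set ℂ) i = L := by
        have : (Iio 0 : Set ℕ) = ∅ := by ext; simp
        rw [this]; simp only [mem_empty_iff_false, iUnion_false, iUnion_empty, union_empty]
      rw [h0]; exact In_biUnion n hK hd hIn
    | succ m ih =>
      intro hm
      obtain ⟨e, he, heIn⟩ := ih (by omega)
      have heIn := heIn (by omega)
      set Z := ⋃ i ∈ Iio m, e i with hZ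
      have hZc : IsCompact Z := (finite_Iio m).isCompact_biUnion fun i hi => (he i hi).1.isCompact
      have memZ : ∀ z, z ∈ Z ↔ ∃ i < m, z ∈ e i := fun z => by
        simp only [hZ, mem_iUnion, mem_Iio, exists_prop]
      have hmn : m < n := by omega
      -- base points avoid `Z`
      have hqZ : q m ∉ Z := by
        rw [memZ]; rintro ⟨i, hi, hz⟩
        have : q m ∈ e i ∩ L := ⟨hz, memL m hmn _ (hq m hmn)⟩
        rw [(he i hi).2.1] at this
        rcases this with h | h
        · have := sep m hmn i (by omega) (q m) (hq m hmn) (h ▸ hq i (by omega))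
          omega
        · have h : q m = p ((i + 1) % n) := h
          have h2 := sep m hmn _ (nx i) (q m) (hq m hmn) (h ▸ hp _ (nx i))
          rw [← h2] at h
          exact hqp m hmn h
      have hpZ : p ((m + 1) % n) ∉ Z := by
        rw [memZ]; rintro ⟨i, hi, hz⟩
        have : p ((m + 1) % n) ∈ e i ∩ L := ⟨hz, memL _ (nx m) _ (hp _ (nx m))⟩
        rw [(he i hi).2.1] at this
        rcases this with h | h
        · have h : p ((m + 1) % n) = q i := h
          have h2 := sep _ (nx m) i (by omega) _ (hp _ (nx m)) (h ▸ hq i (by omega))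
          rw [h2] at h
          exact hqp i (by omega) h.symm
        · have h : p ((m + 1) % n) = p ((i + 1) % n) := h
          have h2 := sep _ (nx m) _ (nx i) _ (hp _ (nx m)) (h ▸ hp _ (nx i))
          have h3 : (i + 1) % n = i + 1 := Nat.mod_eq_of_lt (by omega)
          rw [h3] at h2
          rcases Nat.lt_or_ge (m + 1) n with h4 | h4
          · rw [Nat.mod_eq_of_lt h4] at h2; omega
          · have : m + 1 = n := by omega
            rw [this, Nat.mod_self] at h2; omega
      obtain ⟨c, C, hC, hCa, hCg⟩ := (hCq m hmn).shrink (hZc.isClosed.isOpen_compl.mem_nhds hqZ)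
      obtain ⟨d, D, hD, hDa, hDg⟩ := (hCp _ (nx m)).shrink (hZc.isClosed.isOpen_compl.mem_nhds hpZ)
      have hne : q m ≠ p ((m + 1) % n) := by
        intro h
        have h2 := sep m hmn _ (nx m) (q m) (hq m hmn) (h ▸ hp _ (nx m))
        rw [← h2] at h
        exact hqp m hmn h
      obtain ⟨E, hEa, hEX, hEg1, hEg2⟩ := connect_step (hLc.union hZc) heIn
        (Or.inl (memL m hmn _ (hq m hmn))) (Or.inl (memL _ (nx m) _ (hp _ (nx m)))) hne hCa hDa
        (by
          rintro z ⟨hz, hz' | hz'⟩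
          · exact hCqK m hmn ⟨(hC hz).1, hz'⟩
          · exact absurd hz' (hC hz).2)
        (by
          rintro z ⟨hz, hz' | hz'⟩
          · exact hCpK _ (nx m) ⟨(hD hz).1, hz'⟩
          · exact absurd hz' (hD hz).2)
      have hEZ : ∀ z ∈ E, z ∉ Z := by
        intro z hz hz'
        have : z ∈ E ∩ (L ∪ Z) := ⟨hz, Or.inr hz'⟩
        rw [hEX] at this
        rcases this with h | h
        · exact hqZ (h ▸ hz')
        · exact hpZ ((h : z = _) ▸ hz')
      have hEL : E ∩ L = {q m, p ((m + 1) % n)} := by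
        rw [← hEX]
        ext z; constructor
        · exact fun h => ⟨h.1, Or.inl h.2⟩
        · exact fun h => ⟨h.1, h.2.resolve_right (hEZ z h.1)⟩
      have hlt : ∀ i < m, (fun i => if i = m then E else e i) i = e i := fun i hi =>
        if_neg (by omega)
      have hmm : (fun i => if i = m then E else e i) m = E := if_pos rfl
      refine ⟨fun i => if i = m then E else e i, ?_, ?_⟩
      · intro i hi
        rcases Nat.lt_succ_iff_lt_or_eq.1 hi with hi | rfl
        · rw [hlt i hi]
          obtain ⟨h1, h2, h3, h4, h5⟩ := he i hi
          refine ⟨h1, h2, h3, h4, fun j hj hji => ?_⟩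
          rcases Nat.lt_succ_iff_lt_or_eq.1 hj with hj | rfl
          · rw [hlt j hj]; exact h5 j hj hji
          · rw [hmm]
            exact Set.disjoint_left.2 fun z hz hz' => hEZ z hz' ((memZ z).2 ⟨i, hi, hz⟩)
        · rw [hmm]
          refine ⟨hEa, hEL, ?_, ?_, fun j hj hji => ?_⟩
          · filter_upwards [hCg, hEg1] with x h1 h2 h using h2 (h1 h)
          · filter_upwards [hDg, hEg2] with x h1 h2 h using h2 (h1 h)
          · have hj : j < i := by omega
            rw [hlt j hj]
            exact Set.disjoint_left.2 fun z hz hz' => hEZ z hz ((memZ z).2 ⟨j, hj, hz'⟩)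
      · intro hm1
        have hmod : (m + 1) % n = m + 1 := Nat.mod_eq_of_lt hm1
        rw [hmod] at hEa hEX hEL hpZ
        set Y := (⋃ j ∈ Iic m, K j) ∪ Z with hY
        set R := ⋃ j ∈ Ioo m n, K j with hR
        have memY : ∀ z, z ∈ (⋃ j ∈ Iic m, K j) ↔ ∃ i ≤ m, z ∈ K i := fun z => by
          simp only [mem_iUnion, mem_Iic, exists_prop]
        have memR : ∀ z, z ∈ R ↔ ∃ i, (m < i ∧ i < n) ∧ z ∈ K i := fun z => by
          simp only [hR, mem_iUnion, mem_Ioo, exists_prop]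
        have hYc : IsCompact Y := ((finite_Iic m).isCompact_biUnion fun i hi => hK i (by
          have : i ≤ m := hi
          omega)).union hZc
        have hRc : IsCompact R := (finite_Ioo m n).isCompact_biUnion fun i hi => hK i hi.2
        have hYR : Y ∪ R = L ∪ Z := by
          ext z
          simp only [hY, mem_union, memY, memR]
          constructor
          · rintro ((⟨i, hi, hz⟩ | h) | ⟨i, hi, hz⟩)
            · exact Or.inl (memL i (by omega) z hz)
            · exact Or.inr h
            · exact Or.inl (memL i (by omega) z hz)
          · rintro (h | h)
            · simp only [hL, mem_iUnion, mem_Iio, exists_prop] at h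
              obtain ⟨i, hi, hz⟩ := h
              rcases Nat.lt_or_ge m i with h | h
              · exact Or.inr ⟨i, ⟨h, hi⟩, hz⟩
              · exact Or.inl (Or.inl ⟨i, h, hz⟩)
            · exact Or.inl (Or.inr h)
        have hdYR : Disjoint Y R := by
          refine Set.disjoint_left.2 fun z hz hz' => ?_
          obtain ⟨j, hj, hzj⟩ := (memR z).1 hz'
          rcases hz with h | h
          · obtain ⟨i, hi, hz⟩ := (memY z).1 h
            have := sep i (by omega) j hj.2 z hz hzj
            omega
          · obtain ⟨i, hi, hz⟩ := (memZ z).1 h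
            have : z ∈ e i ∩ L := ⟨hz, memL j hj.2 z hzj⟩
            rw [(he i hi).2.1] at this
            have h3 : (i + 1) % n = i + 1 := Nat.mod_eq_of_lt (by omega)
            rw [h3] at this
            rcases this with h | h
            · have := sep i (by omega) j hj.2 z (h ▸ hq i (by omega)) hzj
              omega
            · have := sep (i + 1) (by omega) j hj.2 z ((h : z = _) ▸ hp (i + 1) (by omega)) hzj
              omega
        have hqY : q m ∈ Y := Or.inl ((memY _).2 ⟨m, le_rfl, hq m hmn⟩)
        have hpR : p (m + 1) ∈ R := (memR _).2 ⟨m + 1, by omega, hp _ hm1⟩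
        have hYE : Y ∩ E = {q m} := by
          refine Subset.antisymm ?_ ?_
          · rintro z ⟨hz, hzE⟩
            have : z ∈ E ∩ (L ∪ Z) := ⟨hzE, hYR ▸ Or.inl hz⟩
            rw [hEX] at this
            rcases this with h | h
            · exact h
            · exact absurd ((h : z = _) ▸ hpR) (Set.disjoint_left.1 hdYR hz)
          · rintro z rfl; exact ⟨hqY, hEa.left_mem⟩
        have hRE : R ∩ E = {p (m + 1)} := by
          refine Subset.antisymm ?_ ?_
          · rintro z ⟨hz, hzE⟩
            have : z ∈ E ∩ (L ∪ Z) := ⟨hzE, hYR ▸ Or.inr hz⟩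
            rw [hEX] at this
            rcases this with h | h
            · exact absurd hz (Set.disjoint_left.1 hdYR (h ▸ hqY))
            · exact h
          · rintro z rfl; exact ⟨hpR, hEa.right_mem⟩
        have hfin := In_step hYc.isClosed hRc.isClosed hEa hdYR hYE hRE (by rw [hYR]; exact heIn)
        rw [hYR] at hfin
        convert! hfin using 2
        rw [union_assoc]
        congr 1
        ext z
        simp only [mem_iUnion, mem_Iio, exists_prop, mem_union, memZ]
        constructor
        · rintro ⟨i, hi, hz⟩
          by_cases h : i = m
          · rw [if_pos h] at hz; exact Or.inr hz
          · rw [if_neg h] at hz; exact Or.inl ⟨i, by omega, hz⟩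
        · rintro (⟨i, hi, hz⟩ | hz)
          · exact ⟨i, by omega, by rw [if_neg (by omega)]; exact hz⟩
          · exact ⟨m, by omega, by rw [if_pos rfl]; exact hz⟩
  obtain ⟨e, he, -⟩ := main n le_rfl
  exact ⟨e, he⟩

end TQ


namespace TQ

/-- Combinatorial data for the invariant loop. -/
structure Cyc (n : ℕ) (X : Type*) [MetricSpace X] where
  b : ZMod n → ZMod n
  T : ZMod n → X → X
  e : ZMod n → ℝ → X
  h : ZMod n → ℝ → X
  p : ZMod n → X
  q : ZMod n → X
  K : ZMod n → Set X
  hn : 2 ≤ n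
  bb : ∀ k, b (b k) = k
  TT : ∀ k x, T (b k) (T k x) = x
  Tc : ∀ k, Continuous (T k)
  ec : ∀ k, ContinuousOn (e k) (Icc 0 1)
  einj : ∀ k, InjOn (e k) (Icc 0 1)
  e0 : ∀ k, e k 0 = q k
  e1 : ∀ k, e k 1 = p (k + 1)
  eK : ∀ k j, ∀ s ∈ Icc (0 : ℝ) 1, e k s ∈ K j → (s = 0 ∧ j = k) ∨ (s = 1 ∧ j = k + 1)
  ee : ∀ k j, ∀ s ∈ Icc (0 : ℝ) 1, ∀ t ∈ Icc (0 : ℝ) 1, e k s = e j t → k = j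
  pK : ∀ k, p k ∈ K k
  qK : ∀ k, q k ∈ K k
  pq : ∀ k, p k ≠ q k
  KK : ∀ k j x, x ∈ K k → x ∈ K j → k = j
  Kc : ∀ k, IsClosed (K k)
  TK : ∀ k x, x ∉ K (b k) → T k x ∈ K k
  Tq : ∀ k, T k (q (b k)) = p k
  Tp : ∀ k, T k (p (b k)) = q k
  hc : ∀ k, ContinuousOn (h k) (Icc 0 1)
  hK : ∀ k, ∀ s ∈ Icc (0 : ℝ) 1, h k s ∈ K k
  h0 : ∀ k, h k 0 = p k
  h1 : ∀ k, h k 1 = q k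

namespace Cyc

variable {n : ℕ} {X : Type*} [MetricSpace X] (S : Cyc n X)

inductive Cyl : ℕ → ZMod n → Set X → Prop
  | one (k : ZMod n) : Cyl 1 k (S.K k)
  | succ (N : ℕ) (j k : ZMod n) (A : Set X) (h : Cyl N j A) (hj : j ≠ S.b k) :
      Cyl (N + 1) k (S.T k '' A)

structure Adm (G : ℝ → X) : Prop where
  cont : Continuous G
  per : ∀ x, G (x + n) = G x
  E : ∀ (m : ℤ), ∀ s ∈ Icc (0 : ℝ) (1/2), G (m + s) = S.e m (2 * s)
  D : ∀ (m : ℤ), ∀ s ∈ Icc (0 : ℝ) (1/2), G (m + 1/2 + s) ∈ S.K ((m + 1 : ℤ) : ZMod n)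

def piece (u v : ℤ → ℝ → X) (x : ℝ) : X :=
  if Int.fract x ≤ 1/2 then u ⌊x⌋ (Int.fract x) else v ⌊x⌋ (Int.fract x - 1/2)

lemma piece_left (u v : ℤ → ℝ → X) (m : ℤ) (s : ℝ) (hs : s ∈ Icc (0 : ℝ) (1/2)) :
    piece u v (m + s) = u m s := by
  have h1 : ⌊(m + s : ℝ)⌋ = m := by
    rw [Int.floor_eq_iff]; constructor <;> linarith [hs.1, hs.2]
  have h2 : Int.fract (m + s : ℝ) = s := by rw [Int.fract, h1]; ring
  rw [piece, h1, h2, if_pos hs.2]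

lemma piece_right (u v : ℤ → ℝ → X) (h : ∀ m, u m (1/2) = v m 0) (h' : ∀ m, v m (1/2) = u (m + 1) 0)
    (m : ℤ) (s : ℝ) (hs : s ∈ Icc (0 : ℝ) (1/2)) :
    piece u v (m + 1/2 + s) = v m s := by
  rcases hs.1.eq_or_lt with h0 | h0
  · rw [← h0, add_zero, piece_left _ _ _ _ (by norm_num), h]
  rcases hs.2.eq_or_lt with h2 | h2
  · have : (m : ℝ) + 1/2 + s = ((m + 1 : ℤ) : ℝ) + 0 := by rw [h2]; push_cast; ring
    rw [this, piece_left _ _ _ _ (by norm_num), h2, h']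
  have h1 : ⌊(m + 1/2 + s : ℝ)⌋ = m := by
    rw [Int.floor_eq_iff]; constructor <;> linarith [hs.1, hs.2]
  have h3 : Int.fract (m + 1/2 + s : ℝ) = 1/2 + s := by rw [Int.fract, h1]; ring
  rw [piece, h1, h3, if_neg (by linarith)]
  congr 1; ring

lemma half_cases (x : ℝ) : ∃ m : ℤ, (∃ s ∈ Icc (0 : ℝ) (1/2), x = m + s) ∨
    (∃ s ∈ Ioo (0 : ℝ) (1/2), x = m + 1/2 + s) := by
  refine ⟨⌊x⌋, ?_⟩
  have h1 := Int.fract_nonneg x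
  have h2 := Int.fract_lt_one x
  have h3 := Int.floor_add_fract x
  rcases le_or_gt (Int.fract x) (1/2) with h | h
  · exact Or.inl ⟨_, ⟨h1, h⟩, h3.symm⟩
  · exact Or.inr ⟨Int.fract x - 1/2, ⟨by linarith, by linarith⟩, by linarith⟩

lemma cont_of_Icc {F : ℝ → X} (h : ∀ m : ℤ, ContinuousOn F (Icc (m : ℝ) (m + 1/2)))
    (h' : ∀ m : ℤ, ContinuousOn F (Icc (m + 1/2 : ℝ) (m + 1))) : Continuous F := by
  have h2 : ∀ m : ℤ, ContinuousOn F (Icc (m : ℝ) (m + 1)) := fun m => by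
    have := (h m).union_of_isClosed (h' m) isClosed_Icc isClosed_Icc
    rwa [Icc_union_Icc_eq_Icc (by linarith) (by linarith)] at this
  rw [continuous_iff_continuousAt]
  intro x
  have h3 : ContinuousOn F (Icc ((⌊x⌋ - 1 : ℤ) : ℝ) (⌊x⌋ + 1)) := by
    have := (h2 (⌊x⌋ - 1)).union_of_isClosed (h2 ⌊x⌋) isClosed_Icc isClosed_Icc
    have e : (((⌊x⌋ - 1 : ℤ) : ℝ) + 1) = ⌊x⌋ := by push_cast; ring
    rw [e] at this
    rwa [Icc_union_Icc_eq_Icc (by push_cast; linarith) (by linarith)] at this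
  refine h3.continuousAt (Icc_mem_nhds ?_ ?_)
  · push_cast; linarith [Int.floor_le x]
  · exact Int.lt_floor_add_one x

lemma piece_cont (u v : ℤ → ℝ → X) (h : ∀ m, u m (1/2) = v m 0) (h' : ∀ m, v m (1/2) = u (m + 1) 0)
    (hu : ∀ m, ContinuousOn (u m) (Icc 0 (1/2))) (hv : ∀ m, ContinuousOn (v m) (Icc 0 (1/2))) :
    Continuous (piece u v) := by
  refine cont_of_Icc (fun m => ?_) (fun m => ?_)
  · have : ContinuousOn (fun x : ℝ => u m (x - m)) (Icc (m : ℝ) (m + 1/2)) := by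
      refine (hu m).comp (by fun_prop) fun x hx => ⟨by linarith [hx.1], by linarith [hx.2]⟩
    refine this.congr fun x hx => ?_
    show _ = u m (x - m)
    rw [← piece_left u v m (x - m) ⟨by linarith [hx.1], by linarith [hx.2]⟩]
    congr 1; ring
  · have : ContinuousOn (fun x : ℝ => v m (x - m - 1/2)) (Icc (m + 1/2 : ℝ) (m + 1)) := by
      refine (hv m).comp (by fun_prop) fun x hx => ⟨by linarith [hx.1], by linarith [hx.2]⟩
    refine this.congr fun x hx => ?_
    show _ = v m (x - m - 1/2)
    rw [← piece_right u v h h' m (x - m - 1/2) ⟨by linarith [hx.1], by linarith [hx.2]⟩]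
    congr 1; ring

lemma castn (m : ℤ) : ((m + n : ℤ) : ZMod n) = m := by simp

lemma piece_per (u v : ℤ → ℝ → X) (hu : ∀ m, u (m + n) = u m) (hv : ∀ m, v (m + n) = v m) (x : ℝ) :
    piece u v (x + n) = piece u v x := by
  have h1 : ⌊x + (n : ℝ)⌋ = ⌊x⌋ + n := by
    have := Int.floor_add_intCast x (n : ℤ)
    simpa using this
  have h2 : Int.fract (x + (n : ℝ)) = Int.fract x := by
    have := Int.fract_add_intCast x (n : ℤ)
    simpa using this
  rw [piece, piece, h1, h2, hu, hv]

def lft (k : ZMod n) : ℤ := (k.val : ℤ)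

lemma cast_lft (k : ZMod n) (hn : 2 ≤ n) : ((lft k : ℤ) : ZMod n) = k := by
  haveI : NeZero n := ⟨by omega⟩
  simp [lft]

def uE (m : ℤ) (s : ℝ) : X := S.e m (2 * s)
def vH (m : ℤ) (s : ℝ) : X := S.h ((m + 1 : ℤ) : ZMod n) (2 * s)
def vT (G : ℝ → X) (m : ℤ) (s : ℝ) : X :=
  S.T ((m + 1 : ℤ) : ZMod n) (G (lft (S.b ((m + 1 : ℤ) : ZMod n)) + (2 * n - 1) * s))

def G0 : ℝ → X := piece S.uE S.vH
def Th (G : ℝ → X) : ℝ → X := piece S.uE (S.vT G)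

variable {S}

lemma uE_cont (m : ℤ) : ContinuousOn (S.uE m) (Icc 0 (1/2)) :=
  (S.ec m).comp (by fun_prop) fun x hx => ⟨by linarith [hx.1], by linarith [hx.2]⟩

lemma uE_half (m : ℤ) : S.uE m (1/2) = S.p ((m + 1 : ℤ) : ZMod n) := by
  rw [uE]; norm_num [S.e1]

lemma uE_zero (m : ℤ) : S.uE m 0 = S.q m := by
  rw [uE]; norm_num [S.e0]

lemma adm_G0 : S.Adm S.G0 := by
  have h : ∀ m, S.uE m (1/2) = S.vH m 0 := fun m => by rw [uE_half, vH, mul_zero, S.h0]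
  have h' : ∀ m, S.vH m (1/2) = S.uE (m + 1) 0 := fun m => by
    rw [uE_zero, vH]; norm_num [S.h1]
  refine ⟨piece_cont _ _ h h' uE_cont fun m => ?_, piece_per _ _ ?_ ?_, ?_, ?_⟩
  · exact (S.hc _).comp (by fun_prop) fun x hx => ⟨by linarith [hx.1], by linarith [hx.2]⟩
  · intro m; ext s; simp [uE]
  · intro m; ext s; rw [vH, vH]; congr 1; push_cast; simp
  · intro m s hs; exact piece_left _ _ _ _ hs
  · intro m s hs; rw [G0, piece_right _ _ h h' _ _ hs]
    exact S.hK _ _ ⟨by linarith [hs.1], by linarith [hs.2]⟩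

lemma Adm.q {G : ℝ → X} (hG : S.Adm G) (m : ℤ) : G m = S.q m := by
  have := hG.E m 0 (by norm_num)
  rwa [add_zero, mul_zero, S.e0] at this

lemma Adm.p {G : ℝ → X} (hG : S.Adm G) (m : ℤ) : G (m + 1/2) = S.p ((m + 1 : ℤ) : ZMod n) := by
  have := hG.E m (1/2) (by norm_num)
  rw [this]; norm_num [S.e1]

lemma Adm.per_int {G : ℝ → X} (hG : S.Adm G) (x : ℝ) (a : ℤ) : G (x + n * a) = G x := by
  have : Function.Periodic G (n : ℝ) := hG.per
  rw [mul_comm]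
  exact this.int_mul a x

lemma zmod_eq {m j : ℤ} (h : (m : ZMod n) = j) : ∃ a : ℤ, m = j + n * a := by
  rw [ZMod.intCast_eq_intCast_iff_dvd_sub] at h
  obtain ⟨a, ha⟩ := h
  exact ⟨-a, by linarith⟩

lemma Adm.notK {G : ℝ → X} (hG : S.Adm G) {j : ℤ} {x : ℝ} (hx : x ∈ Icc (j : ℝ) (j + n - 1/2))
    (hK : G x ∈ S.K j) : x = j ∨ x = j + n - 1/2 := by
  have hn := S.hn
  have hn' : (2 : ℝ) ≤ n := by exact_mod_cast hn
  obtain ⟨m, ⟨s, hs, rfl⟩ | ⟨s, hs, rfl⟩⟩ := half_cases x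
  · rw [hG.E m s hs] at hK
    rcases S.eK _ _ _ ⟨by linarith [hs.1], by linarith [hs.2]⟩ hK with ⟨h1, h2⟩ | ⟨h1, h2⟩
    · obtain ⟨a, ha⟩ := zmod_eq h2
      have hs0 : s = 0 := by linarith
      subst hs0
      rw [add_zero] at hx ⊢
      have h3 : j ≤ m := by exact_mod_cast hx.1
      have h4 : m < j + n := by
        have : (m : ℝ) < j + n := by linarith [hx.2]
        exact_mod_cast this
      have h5 : a = 0 := by nlinarith
      left; subst h5; simp at ha; simp [ha]
    · have h2 : ((j : ℤ) : ZMod n) = ((m + 1 : ℤ) : ZMod n) := by rw [h2]; push_cast; rfl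
      obtain ⟨a, ha⟩ := zmod_eq h2
      have hs0 : s = 1/2 := by linarith
      subst hs0
      have h3 : j < m + 1 := by
        have : (j : ℝ) < m + 1 := by linarith [hx.1]
        exact_mod_cast this
      have h4 : m + 1 ≤ j + n := by
        have : (m : ℝ) + 1 ≤ j + n := by linarith [hx.2]
        exact_mod_cast this
      have h5 : a = -1 := by nlinarith
      right; subst h5
      have : (j : ℝ) = m + 1 + n * (-1) := by exact_mod_cast ha
      linarith
  · exfalso
    have h2 := S.KK _ _ _ (hG.D m s ⟨hs.1.le, hs.2.le⟩) hK
    obtain ⟨a, ha⟩ := zmod_eq h2.symm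
    have h3 : j < m + 1 := by
      have : (j : ℝ) < m + 1 := by linarith [hx.1, hs.2]
      exact_mod_cast this
    have h4 : m + 1 < j + n := by
      have : (m : ℝ) + 1 < j + n := by linarith [hx.2, hs.1]
      exact_mod_cast this
    have h5 : a < 0 := by nlinarith
    have h6 : -1 < a := by nlinarith
    omega

lemma Adm.end {G : ℝ → X} (hG : S.Adm G) (j : ℤ) : G (j + n - 1/2) = S.p j := by
  have h := hG.p (j - 1)
  have h2 := hG.per ((j - 1 : ℤ) + 1/2 : ℝ)
  rw [h] at h2
  have e : ((j - 1 : ℤ) + 1/2 + n : ℝ) = j + n - 1/2 := by push_cast; ring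
  rw [e] at h2
  rw [h2]; congr 1; push_cast; ring

lemma vT_ends {G : ℝ → X} (hG : S.Adm G) (m : ℤ) :
    S.uE m (1/2) = S.vT G m 0 ∧ S.vT G m (1/2) = S.uE (m + 1) 0 := by
  constructor
  · rw [uE_half, vT, mul_zero, add_zero, hG.q, cast_lft _ S.hn, S.Tq]
  · rw [uE_zero, vT]
    have e : ∀ l : ℤ, (l : ℝ) + (2 * n - 1) * (1/2) = l + n - 1/2 := fun l => by ring
    rw [e, hG.end, cast_lft _ S.hn, S.Tp]

lemma mem_lft {s : ℝ} (hs : s ∈ Icc (0 : ℝ) (1/2)) (hn : 2 ≤ n) (l : ℤ) :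
    (l : ℝ) + (2 * n - 1) * s ∈ Icc (l : ℝ) (l + n - 1/2) := by
  have hn' : (2 : ℝ) ≤ n := by exact_mod_cast hn
  constructor <;> nlinarith [hs.1, hs.2]

lemma TG_mem {G : ℝ → X} (hG : S.Adm G) (k : ZMod n) {x : ℝ}
    (hx : x ∈ Icc (lft (S.b k) : ℝ) (lft (S.b k) + n - 1/2)) : S.T k (G x) ∈ S.K k := by
  by_cases h : G x ∈ S.K (S.b k)
  · have h2 : G x ∈ S.K (lft (S.b k) : ℤ) := by rwa [cast_lft _ S.hn]
    rcases hG.notK hx h2 with h3 | h3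
    · rw [h3, hG.q, cast_lft _ S.hn, S.Tq]; exact S.pK k
    · rw [h3, hG.end, cast_lft _ S.hn, S.Tp]; exact S.qK k
  · exact S.TK _ _ h

lemma Th_right {G : ℝ → X} (hG : S.Adm G) (m : ℤ) (s : ℝ) (hs : s ∈ Icc (0 : ℝ) (1/2)) :
    S.Th G (m + 1/2 + s) = S.vT G m s :=
  piece_right _ _ (fun m => (vT_ends hG m).1) (fun m => (vT_ends hG m).2) _ _ hs

lemma adm_Th {G : ℝ → X} (hG : S.Adm G) : S.Adm (S.Th G) := by
  refine ⟨piece_cont _ _ (fun m => (vT_ends hG m).1) (fun m => (vT_ends hG m).2) uE_cont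
    fun m => ?_, piece_per _ _ ?_ ?_, ?_, ?_⟩
  · exact ((S.Tc _).comp (hG.cont.comp (by fun_prop))).continuousOn
  · intro m; ext s; simp [uE]
  · intro m; ext s; rw [vT, vT]
    have : ((m + n + 1 : ℤ) : ZMod n) = ((m + 1 : ℤ) : ZMod n) := by push_cast; simp
    rw [this]
  · intro m s hs; exact piece_left _ _ _ _ hs
  · intro m s hs; rw [Th_right hG _ _ hs]
    exact TG_mem hG _ (mem_lft hs S.hn _)

lemma adm_iter {G : ℝ → X} (hG : S.Adm G) (N : ℕ) : S.Adm (S.Th^[N] G) := by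
  induction N with
  | zero => exact hG
  | succ N ih => rw [Function.iterate_succ_apply']; exact adm_Th ih

lemma iter_close {G H : ℝ → X} (hG : S.Adm G) (hH : S.Adm H) (N : ℕ) (x : ℝ) :
    S.Th^[N] G x = S.Th^[N] H x ∨ ∃ (m : ℤ) (s : ℝ) (A : Set X), s ∈ Ioo (0 : ℝ) (1/2) ∧
      x = m + 1/2 + s ∧
      S.Cyl (N + 1) ((m + 1 : ℤ) : ZMod n) A ∧ S.Th^[N] G x ∈ A ∧ S.Th^[N] H x ∈ A := by
  induction N generalizing x with
  | zero =>
    obtain ⟨m, ⟨s, hs, rfl⟩ | ⟨s, hs, rfl⟩⟩ := half_cases x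
    · left; exact (hG.E m s hs).trans (hH.E m s hs).symm
    · right
      exact ⟨m, s, _, hs, rfl, Cyl.one _, hG.D m s ⟨hs.1.le, hs.2.le⟩,
        hH.D m s ⟨hs.1.le, hs.2.le⟩⟩
  | succ N ih =>
    have aG := adm_iter hG N
    have aH := adm_iter hH N
    rw [Function.iterate_succ_apply', Function.iterate_succ_apply']
    obtain ⟨m, ⟨s, hs, rfl⟩ | ⟨s, hs, rfl⟩⟩ := half_cases x
    · left; exact ((adm_Th aG).E m s hs).trans ((adm_Th aH).E m s hs).symm
    · have hs' : s ∈ Icc (0 : ℝ) (1/2) := ⟨hs.1.le, hs.2.le⟩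
      rw [Th_right aG _ _ hs', Th_right aH _ _ hs', vT, vT]
      set k := ((m + 1 : ℤ) : ZMod n) with hk
      have hx' := mem_lft hs' S.hn (lft (S.b k))
      rcases ih (lft (S.b k) + (2 * n - 1) * s) with h | ⟨m', s', A, hs1, hm', hA, h1, h2⟩
      · left; rw [h]
      · right
        refine ⟨m, s, S.T k '' A, hs, rfl, Cyl.succ _ _ _ _ hA ?_, mem_image_of_mem _ h1,
          mem_image_of_mem _ h2⟩
        intro hj
        have h3 := aG.D m' s' ⟨hs1.1.le, hs1.2.le⟩
        rw [← hm', hj] at h3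
        have h3 : S.Th^[N] G (lft (S.b k) + (2 * n - 1) * s) ∈ S.K ((lft (S.b k) : ℤ) : ZMod n) := by
          rw [cast_lft (S.b k) S.hn]; exact h3
        have hn' : (2 : ℝ) ≤ n := by exact_mod_cast S.hn
        rcases aG.notK hx' h3 with h4 | h4
        · have : (2 * n - 1) * s = 0 := by linarith
          nlinarith [hs.1]
        · nlinarith [hs.2]

/-- The shrinking hypothesis. -/
def Shrink (S : Cyc n X) : Prop :=
  ∀ ε > 0, ∃ N, ∀ M ≥ N, ∀ k A, S.Cyl M k A → ∀ x ∈ A, ∀ y ∈ A, dist x y ≤ ε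

theorem exists_fixed [CompleteSpace X] (hS : S.Shrink) :
    ∃ G, S.Adm G ∧ ∀ (m : ℤ), ∀ s ∈ Icc (0 : ℝ) (1/2), G (m + 1/2 + s) = S.vT G m s := by
  have key : ∀ ε > 0, ∃ N, ∀ M ≥ N, ∀ x, dist (S.Th^[N] S.G0 x) (S.Th^[M] S.G0 x) ≤ ε := by
    intro ε hε
    obtain ⟨N, hN⟩ := hS ε hε
    refine ⟨N, fun M hM x => ?_⟩
    obtain ⟨j, rfl⟩ := Nat.exists_eq_add_of_le hM
    rw [Function.iterate_add_apply]
    rcases iter_close adm_G0 (adm_iter (S := S) adm_G0 j) N x with h | ⟨m, s, A, _, _, hA, h1, h2⟩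
    · rw [h, dist_self]; exact hε.le
    · exact hN _ (by omega) _ _ hA _ h1 _ h2
  have hlim : ∀ x, ∃ y, Tendsto (fun N => S.Th^[N] S.G0 x) atTop (𝓝 y) := by
    intro x
    refine cauchySeq_tendsto_of_complete ?_
    rw [Metric.cauchySeq_iff']
    intro ε hε
    obtain ⟨N, hN⟩ := key (ε/2) (by linarith)
    refine ⟨N, fun M hM => ?_⟩
    rw [dist_comm]
    linarith [hN M hM x]
  choose G hG using hlim
  have hU : TendstoUniformly (fun N => S.Th^[N] S.G0) G atTop := by
    rw [Metric.tendstoUniformly_iff]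
    intro ε hε
    obtain ⟨N, hN⟩ := key (ε/4) (by linarith)
    filter_upwards [eventually_ge_atTop N] with M hM x
    have h1 : dist (S.Th^[N] S.G0 x) (G x) ≤ ε/4 :=
      le_of_tendsto (tendsto_const_nhds.dist (hG x)) (by
        filter_upwards [eventually_ge_atTop N] with M hM using hN M hM x)
    have h2 := hN M hM x
    have h3 := dist_triangle_left (G x) (S.Th^[M] S.G0 x) (S.Th^[N] S.G0 x)
    linarith
  have adm := fun N => adm_iter (S := S) adm_G0 N
  have hc : Continuous G := hU.continuous (Eventually.frequently (Eventually.of_forall fun N => (adm N).cont))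
  have ha : S.Adm G := by
    refine ⟨hc, fun x => ?_, fun m s hs => ?_, fun m s hs => ?_⟩
    · refine tendsto_nhds_unique (hG _) ?_
      simpa only [(adm _).per] using hG x
    · refine tendsto_nhds_unique (hG _) ?_
      simp only [(adm _).E m s hs]; exact tendsto_const_nhds
    · exact (S.Kc _).mem_of_tendsto (hG _) (Eventually.of_forall fun N => (adm N).D m s hs)
  refine ⟨G, ha, fun m s hs => ?_⟩
  refine tendsto_nhds_unique ((tendsto_add_atTop_iff_nat 1).2 (hG (m + 1/2 + s))) ?_
  have : ∀ N, S.Th^[N + 1] S.G0 (m + 1/2 + s) = S.vT (S.Th^[N] S.G0) m s := fun N => by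
    rw [Function.iterate_succ_apply', Th_right (adm N) _ _ hs]
  simp only [this]
  exact ((S.Tc _).tendsto _).comp (hG _)

lemma T_inj (k : ZMod n) : Function.Injective (S.T k) := fun x y h => by
  rw [← S.TT k x, h, S.TT]

section fixed


/-- equal values lie in a common disc interval, or parameters agree -/
lemma same {G : ℝ → X} (hG : S.Adm G) {x y : ℝ} (h : G x = G y) : (∃ a : ℤ, x = y + n * a) ∨
    ∃ (m a : ℤ) (s t : ℝ), s ∈ Icc (0 : ℝ) (1/2) ∧ t ∈ Icc (0 : ℝ) (1/2) ∧
      x = m + 1/2 + s ∧ y = m + 1/2 + t + n * a := by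
  -- description of points in discs
  have disc : ∀ x k, G x ∈ S.K k → ∃ (m : ℤ) (s : ℝ), ((m + 1 : ℤ) : ZMod n) = k ∧
      s ∈ Icc (0 : ℝ) (1/2) ∧ x = m + 1/2 + s := by
    intro x k hx
    obtain ⟨m, ⟨s, hs, rfl⟩ | ⟨s, hs, rfl⟩⟩ := half_cases x
    · rw [hG.E m s hs] at hx
      rcases S.eK _ _ _ ⟨by linarith [hs.1], by linarith [hs.2]⟩ hx with ⟨h1, h2⟩ | ⟨h1, h2⟩
      · exact ⟨m - 1, 1/2, by rw [h2]; push_cast; ring, by norm_num, by push_cast; linarith⟩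
      · exact ⟨m, 0, by rw [h2]; push_cast; ring, by norm_num, by linarith⟩
    · exact ⟨m, s, S.KK _ _ _ (hG.D m s ⟨hs.1.le, hs.2.le⟩) hx, ⟨hs.1.le, hs.2.le⟩, rfl⟩
  by_cases hk : ∃ k, G x ∈ S.K k
  · right
    obtain ⟨k, hk⟩ := hk
    obtain ⟨m, s, h1, hs, rfl⟩ := disc x k hk
    obtain ⟨m', t, h1', ht, rfl⟩ := disc y k (h ▸ hk)
    obtain ⟨a, ha⟩ := zmod_eq (h1'.trans h1.symm)
    refine ⟨m, a, s, t, hs, ht, rfl, ?_⟩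
    have : (m' : ℝ) + 1 = m + 1 + n * a := by exact_mod_cast ha
    linarith
  · left
    have hk' : ¬ ∃ k, G y ∈ S.K k := by rwa [← h]
    obtain ⟨m, ⟨s, hs, rfl⟩ | ⟨s, hs, rfl⟩⟩ := half_cases x
    · obtain ⟨m', ⟨t, ht, rfl⟩ | ⟨t, ht, rfl⟩⟩ := half_cases y
      · rw [hG.E m s hs, hG.E m' t ht] at h
        have hs2 : 2 * s ∈ Icc (0 : ℝ) 1 := ⟨by linarith [hs.1], by linarith [hs.2]⟩
        have ht2 : 2 * t ∈ Icc (0 : ℝ) 1 := ⟨by linarith [ht.1], by linarith [ht.2]⟩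
        have h2 := S.ee _ _ _ hs2 _ ht2 h
        rw [h2] at h
        have h3 := S.einj _ hs2 ht2 h
        obtain ⟨a, ha⟩ := zmod_eq h2
        have : (m : ℝ) = m' + n * a := by exact_mod_cast ha
        exact ⟨a, by linarith⟩
      · exact absurd ⟨_, hG.D m' t ⟨ht.1.le, ht.2.le⟩⟩ hk'
    · exact absurd ⟨_, hG.D m s ⟨hs.1.le, hs.2.le⟩⟩ hk



lemma expand {G : ℝ → X} (hG : S.Adm G)
    (hT : ∀ (m : ℤ), ∀ s ∈ Icc (0 : ℝ) (1/2), G (m + 1/2 + s) = S.vT G m s) (N : ℕ) : ∀ (m : ℤ) (s t : ℝ), s ∈ Icc (0 : ℝ) (1/2) → t ∈ Icc (0 : ℝ) (1/2) →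
    G (m + 1/2 + s) = G (m + 1/2 + t) → |s - t| * 3 ^ N ≤ 1/2 := by
  have hn' : (2 : ℝ) ≤ n := by exact_mod_cast S.hn
  induction N with
  | zero =>
    intro m s t hs ht _
    rw [pow_zero, mul_one, abs_le]; constructor <;> linarith [hs.1, hs.2, ht.1, ht.2]
  | succ N ih =>
    intro m s t hs ht h
    by_cases hst : s = t
    · subst hst; simp
    rw [hT m s hs, hT m t ht, vT, vT] at h
    have h := T_inj _ h
    set l := lft (S.b ((m + 1 : ℤ) : ZMod n))
    have bd : |(2 * n - 1) * s - (2 * n - 1) * t| ≤ n - 1/2 := by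
      rw [abs_le]; constructor <;> nlinarith [hs.1, hs.2, ht.1, ht.2]
    have sub : s - t ≠ 0 := sub_ne_zero.2 hst
    have small : ∀ a : ℤ, |(n : ℝ) * a| < n → a = 0 := by
      intro a ha
      rw [abs_mul, abs_of_pos (by linarith : (0:ℝ) < n)] at ha
      have : |(a : ℝ)| < 1 := by nlinarith
      have h2 : |a| < 1 := by exact_mod_cast this
      exact Int.abs_lt_one_iff.1 h2
    rcases same hG h with ⟨a, ha⟩ | ⟨m', a, s', t', hs', ht', h1, h2⟩
    · have h3 : a = 0 := small a (by
        have : (n : ℝ) * a = (2 * n - 1) * s - (2 * n - 1) * t := by linarith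
        rw [this]; linarith)
      subst h3
      exfalso
      have : (2 * (n:ℝ) - 1) * (s - t) = 0 := by push_cast at ha; linarith
      rcases mul_eq_zero.1 this with h | h
      · linarith
      · exact sub h
    · -- s' - t' - n a = (2n-1)(s-t)
      have e1 : (2 * (n:ℝ) - 1) * s - (2 * n - 1) * t = s' - t' - n * a := by linarith
      by_cases ha : a = 0
      · subst ha
        have h3 := ih m' s' t' hs' ht' (by
          rw [h1, h2] at h
          simpa using h)
        have e2 : |s' - t'| = (2 * n - 1) * |s - t| := by
          have : s' - t' = (2 * n - 1) * (s - t) := by push_cast at e1; linarith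
          rw [this, abs_mul, abs_of_pos (by linarith)]
        rw [e2] at h3
        have h5 : (0:ℝ) ≤ 3 ^ N := by positivity
        have h4 : 3 * (|s - t| * 3 ^ N) ≤ (2 * n - 1) * (|s - t| * 3 ^ N) :=
          mul_le_mul_of_nonneg_right (by linarith) (by positivity)
        rw [pow_succ]; nlinarith
      · exfalso
        have h6 : 1 ≤ |a| := Int.one_le_abs ha
        have h6 : (1:ℝ) ≤ |(a:ℝ)| := by exact_mod_cast h6
        rw [abs_le] at bd
        -- endpoints
        have ends : (s = 0 ∧ t = 1/2) ∨ (s = 1/2 ∧ t = 0) := by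
          rcases le_or_gt 0 (a : ℝ) with h7 | h7
          · rw [abs_of_nonneg h7] at h6
            have h8 : (n : ℝ) ≤ n * a := by nlinarith
            have h9 : (2 * (n:ℝ) - 1) * (t - s) ≥ n - 1/2 := by nlinarith [hs'.2, ht'.1]
            have : t - s ≥ 1/2 := by nlinarith
            left; constructor <;> linarith [hs.1, ht.2]
          · rw [abs_of_neg h7] at h6
            have h8 : (n : ℝ) ≤ -(n * a) := by nlinarith
            have h9 : (2 * (n:ℝ) - 1) * (s - t) ≥ n - 1/2 := by nlinarith [hs'.1, ht'.2]
            have : s - t ≥ 1/2 := by nlinarith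
            right; constructor <;> linarith [ht.1, hs.2]
        have e3 : (l : ℝ) + (2 * n - 1) * (1/2) = l + n - 1/2 := by ring
        rcases ends with ⟨rfl, rfl⟩ | ⟨rfl, rfl⟩
        · rw [mul_zero, add_zero, e3, hG.end, hG.q] at h
          exact S.pq _ h.symm
        · rw [mul_zero, add_zero, e3, hG.end, hG.q] at h
          exact S.pq _ h

theorem G_inj {G : ℝ → X} (hG : S.Adm G)
    (hT : ∀ (m : ℤ), ∀ s ∈ Icc (0 : ℝ) (1/2), G (m + 1/2 + s) = S.vT G m s) {x y : ℝ} (h : G x = G y) : ∃ a : ℤ, x = y + n * a := by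
  rcases same hG h with h1 | ⟨m, a, s, t, hs, ht, rfl, rfl⟩
  · exact h1
  · rw [hG.per_int] at h
    have h2 := fun N => expand hG hT N m s t hs ht h
    have h3 : s = t := by
      by_contra hne
      have hpos : 0 < |s - t| := abs_pos.2 (sub_ne_zero.2 hne)
      obtain ⟨N, hN⟩ := pow_unbounded_of_one_lt (1/2 / |s - t|) (by norm_num : (1:ℝ) < 3)
      rw [div_lt_iff₀ hpos] at hN
      linarith [h2 N]
    subst h3
    exact ⟨-a, by push_cast; ring⟩

theorem T_range_subset {G : ℝ → X} (hG : S.Adm G)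
    (hT : ∀ (m : ℤ), ∀ s ∈ Icc (0 : ℝ) (1/2), G (m + 1/2 + s) = S.vT G m s) (k : ZMod n) (x : ℝ) : S.T k (G x) ∈ range G := by
  have hn' : (2 : ℝ) ≤ n := by exact_mod_cast S.hn
  -- general position
  have h1 : ∀ k, ∀ y ∈ Icc (lft (S.b k) : ℝ) (lft (S.b k) + n - 1/2), S.T k (G y) ∈ range G := by
    intro k y hy
    set s := (y - lft (S.b k)) / (2 * n - 1) with hs
    have hpos : (0:ℝ) < 2 * n - 1 := by linarith
    have hs' : s ∈ Icc (0 : ℝ) (1/2) := by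
      constructor
      · exact div_nonneg (by linarith [hy.1]) hpos.le
      · rw [hs, div_le_iff₀ hpos]; linarith [hy.2]
    refine ⟨((lft k - 1 : ℤ) : ℝ) + 1/2 + s, ?_⟩
    rw [hT _ s hs', vT]
    have : ((lft k - 1 + 1 : ℤ) : ZMod n) = k := by rw [sub_add_cancel, cast_lft _ S.hn]
    rw [this]
    congr 2
    rw [hs]; field_simp; ring
  -- reduce x into [l, l+n)
  set l := lft (S.b k) with hl
  set a := ⌊(x - l) / n⌋ with ha
  have hnp : (0:ℝ) < n := by linarith
  have b1 : (a : ℝ) * n ≤ x - l := by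
    have := Int.floor_le ((x - l) / n); rwa [le_div_iff₀ hnp] at this
  have b2 : x - l < (a + 1) * n := by
    have := Int.lt_floor_add_one ((x - l) / n); rwa [div_lt_iff₀ hnp] at this
  have hx : G x = G (x - n * a) := by
    have := hG.per_int (x - n * a) a
    rw [← this]; congr 1; ring
  rw [hx]
  by_cases h2 : x - n * a ≤ l + n - 1/2
  · exact h1 k _ ⟨by linarith, h2⟩
  · -- passage through the disc `b k`
    push Not at h2
    set m : ℤ := l + n - 1 with hm
    set s := x - n * a - m - 1/2 with hs
    have hs' : s ∈ Icc (0 : ℝ) (1/2) := by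
      rw [hs, hm]; push_cast; constructor <;> linarith
    have e1 : x - n * a = m + 1/2 + s := by rw [hs]; ring
    rw [e1, hT m s hs', vT]
    have e2 : ((m + 1 : ℤ) : ZMod n) = S.b k := by
      rw [hm]; push_cast; rw [hl, cast_lft _ S.hn]; simp
    rw [e2]
    have := S.TT (S.b k) (G (lft (S.b (S.b k)) + (2 * n - 1) * s))
    rw [S.bb] at this ⊢
    rw [this]
    exact mem_range_self _

theorem T_range {G : ℝ → X} (hG : S.Adm G)
    (hT : ∀ (m : ℤ), ∀ s ∈ Icc (0 : ℝ) (1/2), G (m + 1/2 + s) = S.vT G m s) (k : ZMod n) : S.T k '' range G = range G := by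
  apply Subset.antisymm
  · rintro _ ⟨_, ⟨x, rfl⟩, rfl⟩
    exact T_range_subset hG hT k x
  · rintro _ ⟨x, rfl⟩
    refine ⟨S.T (S.b k) (G x), T_range_subset hG hT _ _, ?_⟩
    have := S.TT (S.b k) (G x)
    rwa [S.bb] at this

lemma isCompact_range {G : ℝ → X} (hG : S.Adm G) : IsCompact (range G) := by
  have : range G = G '' Icc (0:ℝ) n := by
    apply Subset.antisymm
    · rintro _ ⟨x, rfl⟩
      have hnp : (0:ℝ) < n := by have := S.hn; exact_mod_cast (by omega : 0 < n)
      refine ⟨x - n * ⌊x / n⌋, ⟨?_, ?_⟩, ?_⟩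
      · have := Int.floor_le (x / n); rw [le_div_iff₀ hnp] at this; linarith
      · have := Int.lt_floor_add_one (x / n); rw [div_lt_iff₀ hnp] at this; linarith
      · have := hG.per_int (x - n * ⌊x / n⌋) ⌊x / n⌋
        rw [← this]; congr 1; ring
    · rintro _ ⟨x, _, rfl⟩; exact mem_range_self _
  rw [this]; exact isCompact_Icc.image hG.cont

lemma cyl_meets {G : ℝ → X} (hG : S.Adm G)
    (hT : ∀ (m : ℤ), ∀ s ∈ Icc (0 : ℝ) (1/2), G (m + 1/2 + s) = S.vT G m s) (N : ℕ) (k : ZMod n) (A : Set X) (h : S.Cyl N k A) : (A ∩ range G).Nonempty := by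
  induction h with
  | one k =>
    refine ⟨S.q k, S.qK k, ⟨(lft k : ℝ), ?_⟩⟩
    rw [hG.q, cast_lft _ S.hn]
  | succ N j k A h hj ih =>
    obtain ⟨x, hx, y, rfl⟩ := ih
    exact ⟨_, mem_image_of_mem _ hx, T_range_subset hG hT k y⟩

theorem mem_of_cyl {G : ℝ → X} (hG : S.Adm G)
    (hT : ∀ (m : ℤ), ∀ s ∈ Icc (0 : ℝ) (1/2), G (m + 1/2 + s) = S.vT G m s) (hS : S.Shrink) {z : X} (hz : ∀ N, ∃ M ≥ N, ∃ k A, S.Cyl M k A ∧ z ∈ A) :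
    z ∈ range G := by
  rw [← (isCompact_range hG).isClosed.closure_eq, Metric.mem_closure_iff]
  intro ε hε
  obtain ⟨N, hN⟩ := hS (ε/2) (by linarith)
  obtain ⟨M, hM, k, A, hA, hzA⟩ := hz N
  obtain ⟨y, hy, hy'⟩ := cyl_meets hG hT _ _ _ hA
  exact ⟨y, hy', by linarith [hN M hM k A hA z hzA y hy]⟩

/-- points of `η` in a disc come from outside of the opposite disc -/
theorem disc_mem {G : ℝ → X} (hG : S.Adm G)
    (hT : ∀ (m : ℤ), ∀ s ∈ Icc (0 : ℝ) (1/2), G (m + 1/2 + s) = S.vT G m s) {z : X} {k : ZMod n} (hz : z ∈ range G) (hk : z ∈ S.K k)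
    (hb : S.T (S.b k) z ∈ S.K (S.b k)) : z = S.p k ∨ z = S.q k := by
  have hn' : (2 : ℝ) ≤ n := by exact_mod_cast S.hn
  obtain ⟨x, rfl⟩ := hz
  have hq : G ((lft k - 1 : ℤ) + 1 : ℝ) = S.q k := by
    have := hG.q (lft k)
    rw [cast_lft _ S.hn] at this
    rw [← this]; congr 1; push_cast; ring
  obtain ⟨m, ⟨s, hs, rfl⟩ | ⟨s, hs, rfl⟩⟩ := half_cases x
  · rw [hG.E m s hs] at hk ⊢
    rcases S.eK _ _ _ ⟨by linarith [hs.1], by linarith [hs.2]⟩ hk with ⟨h1, h2⟩ | ⟨h1, h2⟩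
    · right; rw [h1, S.e0, h2]
    · left; rw [h1, S.e1, h2]
  · have hs' : s ∈ Icc (0:ℝ) (1/2) := ⟨hs.1.le, hs.2.le⟩
    have h2 := S.KK _ _ _ (hG.D m s hs') hk
    rw [hT m s hs', vT, h2, S.TT] at hb
    exfalso
    have hx' := mem_lft hs' S.hn (lft (S.b k))
    have hb2 : G (lft (S.b k) + (2 * n - 1) * s) ∈ S.K ((lft (S.b k) : ℤ) : ZMod n) := by
      rw [cast_lft (S.b k) S.hn]; exact hb
    rcases hG.notK hx' hb2 with h4 | h4
    · nlinarith [hs.1]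
    · nlinarith [hs.2]

end fixed

end Cyc
end TQ


namespace TQ

/-! ### The sphere -/

lemma rs_cases (x : RSphere) : x = infty ∨ ∃ z, x = ofC z := by
  induction x using OnePoint.rec with
  | infty => exact Or.inl rfl
  | coe z => exact Or.inr ⟨z, rfl⟩

lemma emb_inf : chordalEmbed infty = (0, 1) := rfl
lemma emb_C (w : ℂ) : chordalEmbed (ofC w) =
  (2 * w / (1 + ‖w‖ ^ 2), (‖w‖ ^ 2 - 1) / (‖w‖ ^ 2 + 1)) := rfl

lemma isometry_emb : Isometry chordalEmbed := fun _ _ => rfl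

lemma ofC_inj : Function.Injective ofC := OnePoint.coe_injective
lemma ofC_ne_inf (z : ℂ) : ofC z ≠ infty := OnePoint.coe_ne_infty z

/-- the identity from `OnePoint ℂ` to the metric sphere -/
def toRS (x : OnePoint ℂ) : RSphere := x

lemma cont_emb_C : Continuous fun w : ℂ => chordalEmbed (ofC w) := by
  simp only [emb_C]
  refine Continuous.prodMk ?_ ?_
  · refine Continuous.div (by fun_prop) (by fun_prop) fun w => ?_
    have : (1 + ‖w‖ ^ 2 : ℝ) ≠ 0 := by positivity
    exact_mod_cast this
  · exact Continuous.div (by fun_prop) (by fun_prop) fun w => by positivity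

lemma cont_toRS : Continuous toRS := by
  rw [isometry_emb.isEmbedding.continuous_iff, continuous_iff_continuousAt]
  intro x
  induction x using OnePoint.rec with
  | infty =>
    rw [OnePoint.continuousAt_infty']
    rw [coclosedCompact_eq_cocompact]
    have e : (chordalEmbed ∘ toRS) OnePoint.infty = (0, 1) := rfl
    rw [e]
    have hn : Tendsto (fun w : ℂ => ‖w‖) (cocompact ℂ) atTop := tendsto_norm_cocompact_atTop
    show Tendsto (fun w : ℂ => ((2 * w / (1 + ‖w‖ ^ 2) : ℂ), ((‖w‖ ^ 2 - 1) / (‖w‖ ^ 2 + 1) : ℝ)))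
      (cocompact ℂ) (𝓝 (0, 1))
    refine Tendsto.prodMk_nhds ?_ ?_
    · have h1 : Tendsto (fun w : ℂ => 2 * ‖w‖⁻¹) (cocompact ℂ) (𝓝 0) := by
        simpa using (tendsto_inv_atTop_zero.comp hn).const_mul 2
      refine squeeze_zero_norm (fun w => ?_) h1
      have e1 : ‖(1 + ‖w‖ ^ 2 : ℂ)‖ = 1 + ‖w‖ ^ 2 := by
        have : (1 + ‖w‖ ^ 2 : ℂ) = ((1 + ‖w‖ ^ 2 : ℝ) : ℂ) := by push_cast; rfl
        rw [this, Complex.norm_real, Real.norm_of_nonneg (by positivity)]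
      rw [norm_div, norm_mul, e1, div_le_iff₀ (by positivity)]
      rcases eq_or_ne w 0 with rfl | hw
      · simp
      · have hw' : 0 < ‖w‖ := norm_pos_iff.2 hw
        have e2 : 2 * ‖w‖⁻¹ * (1 + ‖w‖ ^ 2) = 2 * ‖w‖⁻¹ + 2 * ‖w‖ := by field_simp
        rw [e2]
        have : 0 < ‖w‖⁻¹ := inv_pos.2 hw'
        norm_num
    · have h1 : Tendsto (fun w : ℂ => 1 - 2 * (‖w‖ ^ 2 + 1)⁻¹) (cocompact ℂ) (𝓝 (1 - 2 * 0)) := by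
        refine tendsto_const_nhds.sub (Tendsto.const_mul 2 ?_)
        refine tendsto_inv_atTop_zero.comp ?_
        exact tendsto_atTop_add_const_right _ _ ((tendsto_pow_atTop (by norm_num)).comp hn)
      simp only [mul_zero, sub_zero] at h1
      refine h1.congr fun w => ?_
      have : (‖w‖ ^ 2 + 1) ≠ 0 := by positivity
      field_simp; ring
  | coe z =>
    rw [OnePoint.continuousAt_coe]
    exact cont_emb_C.continuousAt

def hRS : OnePoint ℂ ≃ₜ RSphere :=
  Continuous.homeoOfEquivCompactToT2 (f := Equiv.refl (OnePoint ℂ)) cont_toRS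

lemma hRS_apply (x : OnePoint ℂ) : hRS x = x := rfl

instance : CompactSpace RSphere := hRS.compactSpace

instance : ConnectedSpace RSphere :=
  hRS.surjective.connectedSpace hRS.continuous

lemma oe_ofC : IsOpenEmbedding ofC :=
  hRS.isOpenEmbedding.comp OnePoint.isOpenEmbedding_coe

lemma cont_ofC : Continuous ofC := oe_ofC.continuous

lemma range_ofC : range ofC = {infty}ᶜ := by
  ext x
  rcases rs_cases x with rfl | ⟨z, rfl⟩
  · simp [ofC_ne_inf]
  · simp [ofC_ne_inf]

lemma nhds_inf (s : Set RSphere) : s ∈ 𝓝 infty ↔ infty ∈ s ∧ ∃ R : ℝ, ∀ z : ℂ, R < ‖z‖ → ofC z ∈ s := by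
  have h1 : 𝓝 infty = map hRS (𝓝 (OnePoint.infty : OnePoint ℂ)) := by
    rw [hRS.map_nhds_eq]; rfl
  rw [h1, mem_map, OnePoint.nhds_infty_eq, mem_sup, mem_pure, mem_map, coclosedCompact_eq_cocompact,
    ← Metric.cobounded_eq_cocompact, ← comap_norm_atTop, and_comm]
  refine and_congr Iff.rfl ?_
  rw [mem_comap]
  constructor
  · rintro ⟨t, ht, h⟩
    obtain ⟨R, hR⟩ := mem_atTop_sets.1 ht
    exact ⟨R, fun z hz => h (hR _ hz.le)⟩
  · rintro ⟨R, hR⟩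
    exact ⟨Ioi R, Ioi_mem_atTop R, fun z hz => hR z hz⟩

/-! ### Möbius maps -/

open scoped MatrixGroups

lemma mob_eq_smul (g : SL2C) (x : OnePoint ℂ) :
    mobius g (toRS x) = toRS ((g : GL (Fin 2) ℂ) • x) := by
  induction x using OnePoint.rec with
  | infty =>
    rw [OnePoint.smul_infty_eq_ite]
    show (if g.1 1 0 = 0 then RSphere.infty else RSphere.ofC (g.1 0 0 / g.1 1 0)) = _
    rw [apply_ite toRS]
    simp only [Matrix.SpecialLinearGroup.coe_GL_coe_matrix]
    rfl
  | coe z =>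
    rw [OnePoint.smul_some_eq_ite]
    show (if g.1 1 0 * z + g.1 1 1 = 0 then RSphere.infty
      else RSphere.ofC ((g.1 0 0 * z + g.1 0 1) / (g.1 1 0 * z + g.1 1 1))) = _
    rw [apply_ite toRS]
    simp only [Matrix.SpecialLinearGroup.coe_GL_coe_matrix]
    rfl

lemma mob_mul (g h : SL2C) (x : RSphere) : mobius (g * h) x = mobius g (mobius h x) := by
  have e : ∀ y : OnePoint ℂ, mobius (g * h) (toRS y) = mobius g (mobius h (toRS y)) := fun y => by
    rw [mob_eq_smul, map_mul, mul_smul, ← mob_eq_smul, ← mob_eq_smul]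
  exact e x

lemma mob_one (x : RSphere) : mobius 1 x = x := by
  have e : ∀ y : OnePoint ℂ, mobius 1 (toRS y) = toRS y := fun y => by
    rw [mob_eq_smul, map_one, one_smul]
  exact e x

lemma mob_inv_mob (g : SL2C) (x : RSphere) : mobius g⁻¹ (mobius g x) = x := by
  rw [← mob_mul, inv_mul_cancel, mob_one]

lemma mob_mob_inv (g : SL2C) (x : RSphere) : mobius g (mobius g⁻¹ x) = x := by
  rw [← mob_mul, mul_inv_cancel, mob_one]

lemma det_eq (g : SL2C) : g.1 0 0 * g.1 1 1 - g.1 0 1 * g.1 1 0 = 1 := by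
  rw [← Matrix.det_fin_two]; exact g.2

lemma mob_C (g : SL2C) {z : ℂ} (h : g.1 1 0 * z + g.1 1 1 ≠ 0) :
    mobius g (ofC z) = ofC ((g.1 0 0 * z + g.1 0 1) / (g.1 1 0 * z + g.1 1 1)) := if_neg h

lemma mob_pole (g : SL2C) {z : ℂ} (h : g.1 1 0 * z + g.1 1 1 = 0) :
    mobius g (ofC z) = infty := if_pos h

lemma mob_inf (g : SL2C) (h : g.1 1 0 ≠ 0) :
    mobius g infty = ofC (g.1 0 0 / g.1 1 0) := if_neg h

lemma mob_inf0 (g : SL2C) (h : g.1 1 0 = 0) : mobius g infty = infty := if_pos h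

lemma emb_mob_C (g : SL2C) (z : ℂ) : chordalEmbed (mobius g (ofC z)) =
    (2 * (g.1 0 0 * z + g.1 0 1) * (starRingEnd ℂ) (g.1 1 0 * z + g.1 1 1) /
      ((‖g.1 1 0 * z + g.1 1 1‖ ^ 2 + ‖g.1 0 0 * z + g.1 0 1‖ ^ 2 : ℝ) : ℂ),
     (‖g.1 0 0 * z + g.1 0 1‖ ^ 2 - ‖g.1 1 0 * z + g.1 1 1‖ ^ 2) /
      (‖g.1 0 0 * z + g.1 0 1‖ ^ 2 + ‖g.1 1 0 * z + g.1 1 1‖ ^ 2)) ∧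
    0 < ‖g.1 0 0 * z + g.1 0 1‖ ^ 2 + ‖g.1 1 0 * z + g.1 1 1‖ ^ 2 := by
  have hdet := det_eq g
  set X := g.1 0 0 * z + g.1 0 1 with hX
  set Y := g.1 1 0 * z + g.1 1 1 with hY
  have hXY : X ≠ 0 ∨ Y ≠ 0 := by
    by_contra hcon
    push Not at hcon
    have : g.1 0 0 * Y - g.1 1 0 * X = 1 := by rw [hX, hY]; linear_combination hdet
    rw [hcon.1, hcon.2] at this; simp at this
  have hpos : 0 < ‖X‖ ^ 2 + ‖Y‖ ^ 2 := by
    rcases hXY with h | h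
    · have := norm_pos_iff.2 h; positivity
    · have := norm_pos_iff.2 h; positivity
  refine ⟨?_, hpos⟩
  by_cases h : Y = 0
  · rw [mob_pole g h, emb_inf, h]
    have : ‖X‖ ≠ 0 := by simpa [h] using hXY
    simp [this]
  · rw [mob_C g h, emb_C, norm_div, ← hX, ← hY]
    have hY' : ‖Y‖ ≠ 0 := by simpa using h
    have hc : (‖Y‖ : ℂ) ≠ 0 := by exact_mod_cast hY'
    have e0 : (‖Y‖ : ℂ) ^ 2 = Y * (starRingEnd ℂ) Y := by
      rw [Complex.mul_conj, Complex.normSq_eq_norm_sq]; push_cast; rfl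
    have e1 : ((‖Y‖ ^ 2 + ‖X‖ ^ 2 : ℝ) : ℂ) ≠ 0 := by
      have : ‖Y‖ ^ 2 + ‖X‖ ^ 2 ≠ 0 := by linarith
      exact_mod_cast this
    refine Prod.ext ?_ ?_
    · show 2 * (X / Y) / (1 + ((‖X‖ / ‖Y‖ : ℝ) : ℂ) ^ 2) = _
      have e2 : (1 + ((‖X‖ / ‖Y‖ : ℝ) : ℂ) ^ 2) = ((‖Y‖ ^ 2 + ‖X‖ ^ 2 : ℝ) : ℂ) / (‖Y‖ : ℂ) ^ 2 := by
        push_cast; field_simp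
      rw [e2, e0]
      have : (starRingEnd ℂ) Y ≠ 0 := by simpa using h
      field_simp
    · show ((‖X‖ / ‖Y‖) ^ 2 - 1) / ((‖X‖ / ‖Y‖) ^ 2 + 1) = _
      field_simp

lemma mob_contAt_C (g : SL2C) (z : ℂ) : ContinuousAt (mobius g) (ofC z) := by
  have h : Continuous (fun z => mobius g (ofC z)) := by
    rw [isometry_emb.isEmbedding.continuous_iff]
    have e : (chordalEmbed ∘ fun z => mobius g (ofC z)) = fun z => _ :=
      funext fun z => (emb_mob_C g z).1
    rw [e]
    refine Continuous.prodMk ?_ ?_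
    · refine Continuous.div (by fun_prop) (by fun_prop) fun z => ?_
      have := (emb_mob_C g z).2
      have h2 : ‖g.1 1 0 * z + g.1 1 1‖ ^ 2 + ‖g.1 0 0 * z + g.1 0 1‖ ^ 2 ≠ 0 := by linarith
      exact_mod_cast h2
    · exact Continuous.div (by fun_prop) (by fun_prop) fun z => (emb_mob_C g z).2.ne'
  exact oe_ofC.continuousAt_iff.1 h.continuousAt

/-- the rotation `z ↦ -1/z` -/
def Jm : SL2C := ⟨!![0, -1; 1, 0], by simp [Matrix.det_fin_two]⟩

lemma emb_J (x : RSphere) : chordalEmbed (mobius Jm x) =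
    (-(starRingEnd ℂ) (chordalEmbed x).1, -(chordalEmbed x).2) := by
  rcases rs_cases x with rfl | ⟨z, rfl⟩
  · rw [mob_inf _ (by simp [Jm]), emb_C, emb_inf]; simp [Jm]
  · rw [(emb_mob_C Jm z).1, emb_C]
    refine Prod.ext ?_ ?_
    · have : (starRingEnd ℂ) 2 = 2 := Complex.conj_ofNat 2
      simp [Jm, this]; ring
    · simp [Jm]; rw [← neg_div]; ring

lemma mob_cont (g : SL2C) : Continuous (mobius g) := by
  rw [continuous_iff_continuousAt]
  intro x
  rcases rs_cases x with rfl | ⟨z, rfl⟩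
  · have hJ : Continuous (mobius Jm) := by
      rw [isometry_emb.isEmbedding.continuous_iff]
      have e : (chordalEmbed ∘ mobius Jm) = fun x => _ := funext emb_J
      rw [e]
      have := isometry_emb.continuous
      refine Continuous.prodMk ?_ ?_
      · exact (Complex.continuous_conj.comp this.fst).neg
      · exact this.snd.neg
    have e : mobius g = mobius (g * Jm⁻¹) ∘ mobius Jm := by
      ext x; rw [Function.comp, ← mob_mul, inv_mul_cancel_right]
    rw [e]
    refine ContinuousAt.comp ?_ hJ.continuousAt
    rw [mob_inf _ (by simp [Jm])]
    exact mob_contAt_C _ _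
  · exact mob_contAt_C g z

def mobH (g : SL2C) : RSphere ≃ₜ RSphere where
  toFun := mobius g
  invFun := mobius g⁻¹
  left_inv := mob_inv_mob g
  right_inv := mob_mob_inv g
  continuous_toFun := mob_cont g
  continuous_invFun := mob_cont g⁻¹

lemma mobH_apply (g : SL2C) (x : RSphere) : mobH g x = mobius g x := rfl
lemma mobH_coe (g : SL2C) : ⇑(mobH g) = mobius g := rfl

lemma mob_inj (g : SL2C) : Function.Injective (mobius g) := (mobH g).injective

lemma mob_center {c : SL2C} (hc : c ∈ Subgroup.center SL2C) (x : RSphere) : mobius c x = x := by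
  obtain ⟨r, hr, h⟩ := Matrix.SpecialLinearGroup.mem_center_iff.1 hc
  have h00 : c.1 0 0 = r := by rw [← h]; simp
  have h01 : c.1 0 1 = 0 := by rw [← h]; simp
  have h10 : c.1 1 0 = 0 := by rw [← h]; simp
  have h11 : c.1 1 1 = r := by rw [← h]; simp
  have hr0 : r ≠ 0 := by rintro rfl; simp at hr
  rcases rs_cases x with rfl | ⟨z, rfl⟩
  · exact mob_inf0 _ h10
  · rw [mob_C _ (by rw [h10, h11]; simpa using hr0), h00, h01, h10, h11]
    congr 1; simp only [add_zero, zero_mul, zero_add]; exact mul_div_cancel_left₀ z hr0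

lemma mob_congr {g h : SL2C} (e : (g : PSL2C) = h) (x : RSphere) : mobius g x = mobius h x := by
  rw [QuotientGroup.eq] at e
  have := mob_center e
  rw [← mob_mob_inv g (mobius h x), ← mob_mul g⁻¹, this]

end TQ


namespace TQ

/-! ### Jordan curves and loops -/

lemma mem_uc {z : ℂ} : z ∈ unitCircle ↔ ‖z‖ = 1 := by simp [unitCircle]

lemma exp_uc (t : ℝ) : Complex.exp (2 * Real.pi * t * Complex.I) ∈ unitCircle := by
  rw [mem_uc]
  have := Complex.norm_exp_ofReal_mul_I (2 * Real.pi * t)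
  push_cast at this; exact this

lemma arg_exp (z : ℂ) (hz : z ∈ unitCircle) :
    Complex.exp (2 * Real.pi * ((z.arg / (2 * Real.pi) : ℝ) : ℂ) * Complex.I) = z := by
  have h1 := Complex.norm_mul_exp_arg_mul_I z
  rw [mem_uc.1 hz] at h1
  conv_rhs => rw [← h1]
  have hp : (Real.pi : ℂ) ≠ 0 := by exact_mod_cast Real.pi_ne_zero
  push_cast
  rw [one_mul]
  congr 1; field_simp

lemma exp_inj {s t : ℝ} (h : Complex.exp (2 * Real.pi * s * Complex.I) =
    Complex.exp (2 * Real.pi * t * Complex.I)) : ∃ n : ℤ, s = t + n := by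
  obtain ⟨n, hn⟩ := Complex.exp_eq_exp_iff_exists_int.1 h
  refine ⟨n, ?_⟩
  have hp : (2 * Real.pi * Complex.I : ℂ) ≠ 0 := by
    simp [Real.pi_ne_zero]
  have : (s : ℂ) = t + n := by
    apply mul_left_cancel₀ hp; linear_combination hn
  exact_mod_cast this

lemma jordan_loop {C : Set RSphere} (h : IsJordanCurve C) :
    ∃ F : ℝ → RSphere, Loop F ∧ C = range F := by
  obtain ⟨f, hc, hi, rfl⟩ := h
  refine ⟨fun t => f (Complex.exp (2 * Real.pi * t * Complex.I)), ⟨?_, ?_, ?_⟩, ?_⟩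
  · exact hc.comp_continuous (by fun_prop) exp_uc
  · intro t
    have : (2 * Real.pi * ((t + 1 : ℝ) : ℂ) * Complex.I) =
      2 * Real.pi * t * Complex.I + 2 * Real.pi * Complex.I := by push_cast; ring
    simp only [this, Complex.exp_add, Complex.exp_two_pi_mul_I, mul_one]
  · intro s t hst
    exact exp_inj (hi (exp_uc s) (exp_uc t) hst)
  · ext x; constructor
    · rintro ⟨z, hz, rfl⟩
      exact ⟨z.arg / (2 * Real.pi), congrArg f (arg_exp z hz)⟩
    · rintro ⟨t, rfl⟩; exact ⟨_, exp_uc t, rfl⟩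

lemma loop_jordan {F : ℝ → RSphere} (hF : Loop F) : IsJordanCurve (range F) := by
  have key : ∀ t : ℝ, F ((Complex.exp (2 * Real.pi * t * Complex.I)).arg / (2 * Real.pi)) = F t := by
    intro t
    obtain ⟨n, hn⟩ := exp_inj (arg_exp _ (exp_uc t))
    rw [hn, hF.per_int]
  have him : unitCircle = (fun t : ℝ => Complex.exp (2 * Real.pi * t * Complex.I)) '' Icc 0 1 := by
    ext z; constructor
    · intro hz
      set s := z.arg / (2 * Real.pi) with hs
      refine ⟨Int.fract s, ⟨Int.fract_nonneg _, (Int.fract_lt_one _).le⟩, ?_⟩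
      have e : (2 * Real.pi * ((Int.fract s : ℝ) : ℂ) * Complex.I) =
        2 * Real.pi * (s : ℂ) * Complex.I + ((-⌊s⌋ : ℤ) : ℂ) * (2 * Real.pi * Complex.I) := by
        have : (Int.fract s) = s - ⌊s⌋ := rfl
        rw [this]; push_cast; ring
      simp only [e, Complex.exp_add, Complex.exp_int_mul_two_pi_mul_I, mul_one]
      exact arg_exp z hz
    · rintro ⟨t, -, rfl⟩; exact exp_uc t
  refine ⟨fun z => F (z.arg / (2 * Real.pi)), ?_, ?_, ?_⟩
  · rw [him]
    refine continuousOn_image_of_comp isCompact_Icc (by fun_prop) ?_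
    simp only [key]
    exact hF.cont.continuousOn
  · intro z hz w hw h
    obtain ⟨n, hn⟩ := hF.inj _ _ h
    rw [← arg_exp z hz, ← arg_exp w hw, hn]
    have e : (2 * Real.pi * ((w.arg / (2 * Real.pi) + n : ℝ) : ℂ) * Complex.I) =
        2 * Real.pi * ((w.arg / (2 * Real.pi) : ℝ) : ℂ) * Complex.I + (n : ℂ) * (2 * Real.pi * Complex.I) := by
        push_cast; ring
    rw [e, Complex.exp_add, Complex.exp_int_mul_two_pi_mul_I, mul_one]
  · ext x; constructor
    · rintro ⟨t, rfl⟩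
      exact ⟨_, exp_uc t, key t⟩
    · rintro ⟨z, -, rfl⟩; exact ⟨_, rfl⟩

lemma Loop.comp {Y Z : Type*} [TopologicalSpace Y] [T2Space Y] [TopologicalSpace Z] [T2Space Z]
    {F : ℝ → Y} (hF : Loop F) {φ : Y → Z} (hφ : ContinuousOn φ (range F))
    (hi : InjOn φ (range F)) : Loop (fun t => φ (F t)) :=
  ⟨hφ.comp_continuous hF.cont fun t => mem_range_self t, fun t => by simp only [hF.per],
    fun s t h => hF.inj s t (hi (mem_range_self s) (mem_range_self t) h)⟩

lemma jordan_mob {C : Set RSphere} (h : IsJordanCurve C) (g : SL2C) :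
    IsJordanCurve (mobius g '' C) := by
  obtain ⟨F, hF, rfl⟩ := jordan_loop h
  rw [← range_comp]
  exact loop_jordan (hF.comp (mob_cont g).continuousOn (mob_inj g).injOn)

/-- a loop on the sphere avoiding `∞` comes from a plane loop -/
lemma loop_plane {F : ℝ → RSphere} (hF : Loop F) (h : infty ∉ range F) :
    ∃ f : ℝ → ℂ, Loop f ∧ ∀ t, F t = ofC (f t) := by
  have h1 : ∀ t, ∃ z, F t = ofC z := fun t => by
    rcases rs_cases (F t) with h2 | h2
    · exact absurd ⟨t, h2⟩ h
    · exact h2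
  choose f hf using h1
  refine ⟨f, ⟨?_, fun t => ?_, fun s t hst => ?_⟩, hf⟩
  · rw [oe_ofC.isEmbedding.continuous_iff]
    exact hF.cont.congr hf
  · apply ofC_inj; rw [← hf, ← hf, hF.per]
  · exact hF.inj s t (by rw [hf, hf, hst])

lemma loop_ofC {f : ℝ → ℂ} (hf : Loop f) : Loop (fun t => ofC (f t)) :=
  hf.comp cont_ofC.continuousOn ofC_inj.injOn

/-! ### Orthogonality is conformally invariant -/

lemma mob_deriv (g : SL2C) {f : ℝ → ℂ} {u z : ℂ} (hf : HasDerivAt f u 0) (h0 : f 0 = z)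
    (hz : g.1 1 0 * z + g.1 1 1 ≠ 0) :
    HasDerivAt (fun t => (g.1 0 0 * f t + g.1 0 1) / (g.1 1 0 * f t + g.1 1 1))
      (u * (1 / (g.1 1 0 * z + g.1 1 1) ^ 2)) 0 := by
  have hd := det_eq g
  have h1 := ((hf.const_mul (g.1 0 0)).add_const (g.1 0 1))
  have h2 := ((hf.const_mul (g.1 1 0)).add_const (g.1 1 1))
  have h3 := h1.div h2 (by rw [h0]; exact hz)
  refine h3.congr_deriv ?_
  rw [h0]
  field_simp
  linear_combination u * hd

lemma orth_mob {A B : Set RSphere} {x : RSphere} (g : SL2C) (h : MeetsOrthogonallyAt A B x)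
    (hx : mobius g x ≠ infty) :
    MeetsOrthogonallyAt (mobius g '' A) (mobius g '' B) (mobius g x) := by
  obtain ⟨z, u, v, f, k, rfl, hu, hv, hf, hk, f0, k0, hA, hB, ho⟩ := h
  have hz : g.1 1 0 * z + g.1 1 1 ≠ 0 := fun h => hx (mob_pole g h)
  have ev : ∀ {f : ℝ → ℂ} {u : ℂ}, HasDerivAt f u 0 → f 0 = z → ∀ᶠ t in 𝓝 (0 : ℝ),
      g.1 1 0 * f t + g.1 1 1 ≠ 0 := by
    intro f u hf h0
    have : ContinuousAt (fun t => g.1 1 0 * f t + g.1 1 1) 0 :=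
      (hf.continuousAt.const_mul _).add continuousAt_const
    exact this.eventually_ne (by simpa [h0] using hz)
  refine ⟨_, _, _, _, _, mob_C g hz, ?_, ?_, mob_deriv g hf f0 hz, mob_deriv g hk k0 hz, ?_, ?_,
    ?_, ?_, ?_⟩
  · exact mul_ne_zero hu (one_div_ne_zero (pow_ne_zero _ hz))
  · exact mul_ne_zero hv (one_div_ne_zero (pow_ne_zero _ hz))
  · rw [f0]
  · rw [k0]
  · filter_upwards [hA, ev hf f0] with t h1 h2
    rw [← mob_C g h2]; exact mem_image_of_mem _ h1
  · filter_upwards [hB, ev hk k0] with t h1 h2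
    rw [← mob_C g h2]; exact mem_image_of_mem _ h1
  · set m := 1 / (g.1 1 0 * z + g.1 1 1) ^ 2
    have e : u * m * (starRingEnd ℂ) (v * m) = (Complex.normSq m : ℂ) * (u * (starRingEnd ℂ) v) := by
      rw [map_mul, ← Complex.mul_conj]; ring
    rw [e, Complex.re_ofReal_mul, ho, mul_zero]

lemma orth_mono {A B A' B' : Set RSphere} {x : RSphere} (h : MeetsOrthogonallyAt A B x)
    (hA : A ⊆ A') (hB : B ⊆ B') : MeetsOrthogonallyAt A' B' x := by
  obtain ⟨z, u, v, f, k, h1, hu, hv, hf, hk, f0, k0, h2, h3, ho⟩ := h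
  exact ⟨z, u, v, f, k, h1, hu, hv, hf, hk, f0, k0, h2.mono fun _ h => hA h,
    h3.mono fun _ h => hB h, ho⟩

end TQ


namespace TQ

/-! ### Basic facts on Schottky data with `∞` in the domain -/

/-- letters -/
abbrev Lt (g : ℕ) := Fin g ⊕ Fin g

def tm {g : ℕ} (S : SchottkyData g) : Lt g → SL2C
  | Sum.inl i => (S.gen i)⁻¹
  | Sum.inr i => S.gen i

variable {g : ℕ} (S : SchottkyData g)

lemma tm_swap (k : Lt g) : tm S k.swap = (tm S k)⁻¹ := by
  rcases k with i | i <;> simp [tm]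

lemma swap_ne (k : Lt g) : k.swap ≠ k := by rcases k with i | i <;> simp

lemma tm_tm (k : Lt g) (x : RSphere) : mobius (tm S k.swap) (mobius (tm S k) x) = x := by
  rw [tm_swap, mob_inv_mob]

lemma tm_mem (k : Lt g) : ((tm S k : SL2C) : PSL2C) ∈ S.group := by
  rcases k with i | i
  · have : ((S.gen i : SL2C) : PSL2C) ∈ S.group := Subgroup.subset_closure ⟨i, rfl⟩
    simpa [tm] using S.group.inv_mem this
  · exact Subgroup.subset_closure ⟨i, rfl⟩

/-- value of a word -/
def wd : List (Lt g) → SL2C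
  | [] => 1
  | k :: l => tm S k * wd l

lemma wd_mem (l : List (Lt g)) : ((wd S l : SL2C) : PSL2C) ∈ S.group := by
  induction l with
  | nil => simp [wd]
  | cons k l ih =>
    have := S.group.mul_mem (tm_mem S k) ih
    simpa [wd] using this

lemma exists_wd {γ : SL2C} (h : (γ : PSL2C) ∈ S.group) :
    ∃ l, ∀ x, mobius γ x = mobius (wd S l) x := by
  have key : ∀ y : PSL2C, y ∈ S.group → ∃ l, ((wd S l : SL2C) : PSL2C) = y := by
    intro y hy
    induction hy using Subgroup.closure_induction_left with
    | one => exact ⟨[], rfl⟩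
    | mul_left x hx y hy ih =>
      obtain ⟨i, rfl⟩ := hx
      obtain ⟨l, rfl⟩ := ih
      exact ⟨Sum.inr i :: l, rfl⟩
    | inv_mul_cancel x hx y hy ih =>
      obtain ⟨i, rfl⟩ := hx
      obtain ⟨l, rfl⟩ := ih
      exact ⟨Sum.inl i :: l, rfl⟩
  obtain ⟨l, hl⟩ := key _ h
  exact ⟨l, fun x => (mob_congr hl x).symm⟩

lemma orbit_countable (x : RSphere) : (mobiusOrbit S.group x).Countable := by
  refine (countable_range fun l => mobius (wd S l) x).mono ?_
  rintro y ⟨γ, hγ, rfl⟩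
  obtain ⟨l, hl⟩ := exists_wd S hγ
  exact ⟨l, (hl x).symm⟩

/-- An invariance principle. -/
lemma inv_of_tm {A : Set RSphere} (h : ∀ k, mobius (tm S k) '' A = A) {γ : SL2C}
    (hγ : (γ : PSL2C) ∈ S.group) : mobius γ '' A = A := by
  obtain ⟨l, hl⟩ := exists_wd S hγ
  have e : mobius γ = mobius (wd S l) := funext hl
  rw [e]; clear hl e
  induction l with
  | nil =>
    have : mobius (wd S []) = id := funext fun x => mob_one x
    rw [this, image_id]
  | cons k l ih =>
    have : mobius (wd S (k :: l)) = mobius (tm S k) ∘ mobius (wd S l) :=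
      funext fun x => mob_mul _ _ x
    rw [this, image_comp, ih, h]

/-! ### planar description of a disc -/

lemma frontier_ofC_In {f : ℝ → ℂ} (hf : Loop f) (hne : (In (range f)).Nonempty) :
    closure (ofC '' In (range f)) = ofC '' (In (range f) ∪ range f) := by
  apply Subset.antisymm
  · refine closure_minimal (image_mono subset_union_left) ?_
    have : IsCompact (In (range f) ∪ range f) := by
      rw [← hf.closure_In hne]
      exact (In_bounded hf.isCompact).isCompact_closure
    exact (this.image cont_ofC).isClosed
  · rw [← hf.closure_In hne]
    exact image_closure_subset_closure_image cont_ofC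

lemma open_ofC_In {f : ℝ → ℂ} (hf : Loop f) : IsOpen (ofC '' In (range f)) :=
  oe_ofC.isOpenMap _ (isOpen_In hf.isCompact.isClosed)

lemma frontier_ofC_In' {f : ℝ → ℂ} (hf : Loop f) (hne : (In (range f)).Nonempty) :
    frontier (ofC '' In (range f)) = ofC '' range f := by
  rw [(open_ofC_In hf).frontier_eq, frontier_ofC_In hf hne, ← image_sdiff ofC_inj]
  congr 1
  ext z; constructor
  · rintro ⟨h | h, h'⟩
    · exact absurd h h'
    · exact h
  · intro h; exact ⟨Or.inr h, fun h' => h'.1 h⟩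

lemma ext_ofC_In {f : ℝ → ℂ} (hf : Loop f) (hne : (In (range f)).Nonempty) :
    (closure (ofC '' In (range f)))ᶜ = insert infty (ofC '' Out (range f)) := by
  rw [frontier_ofC_In hf hne]
  ext x
  rcases rs_cases x with rfl | ⟨z, rfl⟩
  · simp [ofC_ne_inf]
  · simp only [mem_compl_iff, ofC_inj.mem_set_image, mem_insert_iff, ofC_ne_inf, false_or]
    constructor
    · intro h
      rcases mem_trichotomy (range f) z with h1 | h1 | h1
      · exact absurd (Or.inr h1) h
      · exact absurd (Or.inl h1) h
      · exact h1
    · rintro h (h1 | h1)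
      · exact disj_In_Out _ h1 h
      · exact h.1 h1

lemma inf_closure_Out {K : Set ℂ} (hK : IsCompact K) : infty ∈ closure (ofC '' Out K) := by
  rw [mem_closure_iff_nhds]
  intro t ht
  obtain ⟨-, R, hR⟩ := (nhds_inf t).1 ht
  obtain ⟨R', hR'⟩ := (Out_cobounded hK).subset_ball 0
  set M : ℝ := max |R| |R'| + 1 with hM
  have h1 : |R| < M := by rw [hM]; linarith [le_max_left |R| |R'|]
  have h2 : |R'| < M := by rw [hM]; linarith [le_max_right |R| |R'|]
  have hn : ‖(M : ℂ)‖ = M := by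
    rw [Complex.norm_real, Real.norm_of_nonneg]; linarith [abs_nonneg R]
  refine ⟨ofC M, hR _ (by rw [hn]; linarith [le_abs_self R]), M, ?_, rfl⟩
  by_contra hcon
  have := hR' hcon
  rw [mem_ball_zero_iff, hn] at this
  linarith [le_abs_self R']

lemma ext_conn {f : ℝ → ℂ} (hf : Loop f) (hne : (In (range f)).Nonempty) :
    IsPreconnected (closure (ofC '' In (range f)))ᶜ := by
  rw [ext_ofC_In hf hne]
  have h1 : IsPreconnected (ofC '' Out (range f)) :=
    (isPreconnected_Out hf.isCompact).image _ cont_ofC.continuousOn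
  refine h1.subset_closure (subset_insert _ _) ?_
  exact insert_subset (inf_closure_Out hf.isCompact) subset_closure

lemma bdd_of_inf {A : Set RSphere} (h : infty ∉ closure A) :
    Bornology.IsBounded (ofC ⁻¹' A) := by
  have h1 : (closure A)ᶜ ∈ 𝓝 infty := isClosed_closure.isOpen_compl.mem_nhds h
  obtain ⟨-, R, hR⟩ := (nhds_inf _).1 h1
  refine (Metric.isBounded_closedBall (x := (0 : ℂ)) (r := R)).subset fun z hz => ?_
  rw [mem_closedBall_zero_iff]
  by_contra hcon
  exact hR z (not_le.1 hcon) (subset_closure hz)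

lemma plane_disc {D : Set RSphere} (hD : IsOpen D) (hne : D.Nonempty)
    (hJ : IsJordanCurve (frontier D)) (hinf : infty ∉ closure D) :
    ∃ f : ℝ → ℂ, Loop f ∧ (In (range f)).Nonempty ∧ D = ofC '' In (range f) ∧
      frontier D = ofC '' range f := by
  obtain ⟨F, hF, hFr⟩ := jordan_loop hJ
  have hi : infty ∉ range F := by
    rw [← hFr]; exact fun h => hinf (frontier_subset_closure h)
  obtain ⟨f, hf, hFf⟩ := loop_plane hF hi
  have hr : frontier D = ofC '' range f := by
    rw [hFr, ← range_comp]; exact congrArg range (funext hFf)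
  have hDi : ofC '' (ofC ⁻¹' D) = D := by
    rw [image_preimage_eq_iff, range_ofC]
    intro x hx h; rw [mem_singleton_iff] at h; subst h; exact hinf (subset_closure hx)
  have hpre : frontier (ofC ⁻¹' D) = range f := by
    rw [← oe_ofC.isOpenMap.preimage_frontier_eq_frontier_preimage cont_ofC, hr,
      preimage_image_eq _ ofC_inj]
  have hne' : (ofC ⁻¹' D).Nonempty := by
    obtain ⟨x, hx⟩ := hne
    rw [← hDi] at hx; obtain ⟨z, hz, -⟩ := hx; exact ⟨z, hz⟩
  have hU := hf.eq_In (hD.preimage cont_ofC) (bdd_of_inf hinf) hne' hpre.le (by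
    rw [← hpre, (hD.preimage cont_ofC).frontier_eq]; exact disjoint_sdiff_self_right)
  exact ⟨f, hf, hU ▸ hne', by rw [← hU, hDi], hr⟩

variable {S}


lemma inf_cl (hinf : infty ∈ S.domain) (k : Lt g) : infty ∉ closure (S.D k) := by
  intro h
  exact hinf (mem_iUnion.2 ⟨k, h⟩)

lemma disc (hinf : infty ∈ S.domain) (k : Lt g) : ∃ f : ℝ → ℂ, Loop f ∧ (In (range f)).Nonempty ∧
    S.D k = ofC '' In (range f) ∧ frontier (S.D k) = ofC '' range f :=
  plane_disc (S.isOpen k) (S.nonempty k) (S.jordan k) (inf_cl hinf k)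

lemma gen_D (hinf : infty ∈ S.domain) (i : Fin g) : mobius (S.gen i) '' (closure (S.D (Sum.inl i)))ᶜ = S.D (Sum.inr i) := by
  set G := S.gen i
  obtain ⟨f, hf, hne, hD, hfr⟩ := disc hinf (Sum.inl i)
  have hconn : IsPreconnected (mobius G '' (closure (S.D (Sum.inl i)))ᶜ) := by
    have := ext_conn hf hne
    rw [← hD] at this
    exact this.image _ (mob_cont G).continuousOn
  have hmb := S.maps_boundary i
  -- preimage of the target disc
  have h1 : S.D (Sum.inr i) ⊆ mobius G '' (closure (S.D (Sum.inl i)))ᶜ := by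
    intro x hx
    refine ⟨mobius G⁻¹ x, fun hc => ?_, mob_mob_inv G x⟩
    rw [closure_eq_self_union_frontier] at hc
    rcases hc with hc | hc
    · have : x ∈ mobius G '' S.D (Sum.inl i) ∩ S.D (Sum.inr i) :=
        ⟨⟨_, hc, mob_mob_inv G x⟩, hx⟩
      rw [S.maps_off i] at this; exact this
    · have : x ∈ frontier (S.D (Sum.inr i)) := by
        rw [← hmb]; exact ⟨_, hc, mob_mob_inv G x⟩
      rw [(S.isOpen _).frontier_eq] at this; exact this.2 hx
  refine Subset.antisymm ?_ h1
  have hmiss : ∀ x ∈ mobius G '' (closure (S.D (Sum.inl i)))ᶜ, x ∉ frontier (S.D (Sum.inr i)) := by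
    rintro _ ⟨x, hx, rfl⟩ h
    rw [← hmb] at h
    obtain ⟨y, hy, hyx⟩ := h
    rw [mob_inj G hyx] at hy
    exact hx (frontier_subset_closure hy)
  refine hconn.subset_left_of_subset_union (S.isOpen _)
    (isClosed_closure (s := S.D (Sum.inr i))).isOpen_compl
    (disjoint_compl_right.mono_left subset_closure) ?_ ?_
  · intro x hx
    by_cases h : x ∈ closure (S.D (Sum.inr i))
    · rw [closure_eq_self_union_frontier] at h
      exact h.elim Or.inl fun h => absurd h (hmiss x hx)
    · exact Or.inr h
  · obtain ⟨x, hx⟩ := S.nonempty (Sum.inr i)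
    exact ⟨x, h1 hx, hx⟩

/-- `T_k` maps the exterior of `D_{k̄}` onto `D_k`. -/
lemma tm_D (hinf : infty ∈ S.domain) (k : Lt g) (x : RSphere) : mobius (tm S k) x ∈ S.D k ↔ x ∉ closure (S.D k.swap) := by
  rcases k with i | i
  · have h := gen_D hinf i
    have hmb := S.maps_boundary i
    show mobius (S.gen i)⁻¹ x ∈ S.D (Sum.inl i) ↔ x ∉ closure (S.D (Sum.inr i))
    set y := mobius (S.gen i)⁻¹ x with hy
    have hx : x = mobius (S.gen i) y := (mob_mob_inv _ _).symm
    rw [hx, closure_eq_self_union_frontier, ← hmb, ← h, mem_union, (mob_inj _).mem_set_image,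
      (mob_inj _).mem_set_image, mem_compl_iff, (S.isOpen _).frontier_eq, Set.mem_sdiff]
    have := @subset_closure _ _ (S.D (Sum.inl i)) y
    tauto
  · show mobius (S.gen i) x ∈ S.D (Sum.inr i) ↔ x ∉ closure (S.D (Sum.inl i))
    rw [← gen_D hinf i, (mob_inj _).mem_set_image]; rfl

lemma tm_cl (hinf : infty ∈ S.domain) (k : Lt g) (x : RSphere) : mobius (tm S k) x ∈ closure (S.D k) ↔ x ∉ S.D k.swap := by
  have h := tm_D hinf k.swap (mobius (tm S k) x)
  rw [tm_tm, Sum.swap_swap] at h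
  rw [h, not_not]

lemma tm_fr (k : Lt g) : mobius (tm S k) '' frontier (S.D k.swap) = frontier (S.D k) := by
  rcases k with i | i
  · show mobius (S.gen i)⁻¹ '' frontier (S.D (Sum.inr i)) = _
    rw [← S.maps_boundary i, image_image]
    simp [mob_inv_mob]
  · exact S.maps_boundary i

lemma cl_disj {k j : Lt g} {x : RSphere} (h1 : x ∈ closure (S.D k)) (h2 : x ∈ closure (S.D j)) :
    k = j := by
  by_contra h
  have : x ∈ closure (S.D k) ∩ closure (S.D j) := ⟨h1, h2⟩
  rw [S.disjointClosures k j h] at this; exact this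

end TQ


namespace TQ

/-! ### Loops from arcs, crosscuts -/

lemma loop_of_Icc {Y : Type*} [TopologicalSpace Y] [T2Space Y] {h : ℝ → Y}
    (hc : ContinuousOn h (Icc 0 1)) (h01 : h 0 = h 1) (hi : InjOn h (Ico 0 1)) :
    ∃ F : ℝ → Y, Loop F ∧ range F = h '' Icc 0 1 := by
  have : Fact ((0 : ℝ) < 1) := ⟨one_pos⟩
  have hcont := AddCircle.liftIco_continuous (p := (1 : ℝ)) (a := 0) (f := h) (by simpa using h01)
    (by simpa using hc)
  have hval : ∀ t : ℝ, AddCircle.liftIco (1 : ℝ) 0 h (t : AddCircle (1:ℝ)) = h (Int.fract t) := by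
    intro t
    have e : ((t : ℝ) : AddCircle (1:ℝ)) = ((Int.fract t : ℝ) : AddCircle (1:ℝ)) := by
      refine QuotientAddGroup.eq.2 ⟨-⌊t⌋, ?_⟩
      have : t = ⌊t⌋ + Int.fract t := (Int.floor_add_fract t).symm
      simp only [zsmul_eq_mul, mul_one, Int.cast_neg]; linarith
    rw [e, AddCircle.liftIco_coe_apply]
    exact ⟨Int.fract_nonneg t, by simpa using Int.fract_lt_one t⟩
  refine ⟨fun t => AddCircle.liftIco (1 : ℝ) 0 h (t : AddCircle (1:ℝ)), ⟨?_, ?_, ?_⟩, ?_⟩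
  · exact hcont.comp (AddCircle.continuous_mk' 1)
  · intro t; simp only [hval, Int.fract_add_one]
  · intro s t hst
    simp only [hval] at hst
    have := hi ⟨Int.fract_nonneg s, Int.fract_lt_one s⟩ ⟨Int.fract_nonneg t, Int.fract_lt_one t⟩ hst
    exact Int.fract_eq_fract.1 this |>.imp fun n hn => by linarith
  · ext y; constructor
    · rintro ⟨t, rfl⟩
      simp only [hval]
      exact ⟨_, ⟨Int.fract_nonneg t, (Int.fract_lt_one t).le⟩, rfl⟩
    · rintro ⟨t, ht, rfl⟩
      rcases ht.2.lt_or_eq with h | h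
      · exact ⟨t, by simp only [hval, Int.fract_eq_self.2 ⟨ht.1, h⟩]⟩
      · refine ⟨0, ?_⟩
        simp only [hval, Int.fract_zero, h01, h]

lemma loop_of_arcs {Y : Type*} [TopologicalSpace Y] [T2Space Y] {A B : Set Y} {p q : Y}
    (hA : Arc A p q) (hB : Arc B q p) (hAB : A ∩ B ⊆ {p, q}) :
    ∃ F : ℝ → Y, Loop F ∧ range F = A ∪ B := by
  obtain ⟨f, hf, hi, h0, h1, rfl⟩ := hA
  obtain ⟨k, hk, hj, k0, k1, rfl⟩ := hB
  set h : ℝ → Y := fun t => if t ≤ 1/2 then f (2 * t) else k (2 * t - 1) with hh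
  have e1 : ∀ t ∈ Icc (0:ℝ) (1/2), h t = f (2 * t) := fun t ht => if_pos ht.2
  have e2 : ∀ t ∈ Icc (1/2:ℝ) 1, h t = k (2 * t - 1) := fun t ht => by
    rcases ht.1.lt_or_eq with h | h
    · exact if_neg (not_le.2 h)
    · rw [← h, hh]; norm_num [h1, k0]
  have hc : ContinuousOn h (Icc 0 1) := by
    have e : Icc (0:ℝ) 1 = Icc 0 (1/2) ∪ Icc (1/2) 1 := by
      rw [Icc_union_Icc_eq_Icc] <;> norm_num
    rw [e]
    refine ContinuousOn.union_of_isClosed ?_ ?_ isClosed_Icc isClosed_Icc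
    · exact (hf.comp (f := fun t : ℝ => 2 * t) (by fun_prop) fun t ht =>
        ⟨by linarith [ht.1], by linarith [ht.2]⟩).congr e1
    · exact (hk.comp (f := fun t : ℝ => 2 * t - 1) (by fun_prop) fun t ht =>
        ⟨by linarith [ht.1], by linarith [ht.2]⟩).congr e2
  obtain ⟨F, hF, hr⟩ := loop_of_Icc hc (by
    rw [e1 0 (by norm_num), e2 1 (by norm_num)]; norm_num [h0, k1]) (by
    have cross : ∀ s t : ℝ, s ∈ Icc (0:ℝ) (1/2) → t ∈ Ioo (1/2:ℝ) 1 → h s = h t → False := by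
      intro s t hs ht hst
      rw [e1 s hs, e2 t ⟨ht.1.le, ht.2.le⟩] at hst
      have m1 : f (2 * s) ∈ f '' Icc 0 1 := ⟨_, ⟨by linarith [hs.1], by linarith [hs.2]⟩, rfl⟩
      have mt : 2 * t - 1 ∈ Icc (0:ℝ) 1 := ⟨by linarith [ht.1], by linarith [ht.2]⟩
      have m2 : f (2 * s) ∈ k '' Icc 0 1 := ⟨_, mt, hst.symm⟩
      rcases hAB ⟨m1, m2⟩ with h | h
      · have := hj mt (by simp) (hst.symm.trans (h.trans k1.symm))
        linarith [ht.2]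
      · have := hj mt (by simp) (hst.symm.trans (h.trans k0.symm))
        linarith [ht.1]
    intro s hs t ht hst
    rcases le_or_gt s (1/2) with a | a <;> rcases le_or_gt t (1/2) with b | b
    · rw [e1 s ⟨hs.1, a⟩, e1 t ⟨ht.1, b⟩] at hst
      have := hi ⟨by linarith [hs.1], by linarith⟩ ⟨by linarith [ht.1], by linarith⟩ hst
      linarith
    · exact (cross s t ⟨hs.1, a⟩ ⟨b, ht.2⟩ hst).elim
    · exact (cross t s ⟨ht.1, b⟩ ⟨a, hs.2⟩ hst.symm).elim
    · rw [e2 s ⟨a.le, hs.2.le⟩, e2 t ⟨b.le, ht.2.le⟩] at hst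
      have := hj ⟨by linarith, by linarith [hs.2]⟩ ⟨by linarith, by linarith [ht.2]⟩ hst
      linarith)
  refine ⟨F, hF, hr.trans ?_⟩
  ext y; constructor
  · rintro ⟨t, ht, rfl⟩
    rcases le_or_gt t (1/2) with a | a
    · rw [e1 t ⟨ht.1, a⟩]; exact Or.inl ⟨_, ⟨by linarith [ht.1], by linarith⟩, rfl⟩
    · rw [e2 t ⟨a.le, ht.2⟩]; exact Or.inr ⟨_, ⟨by linarith, by linarith [ht.2]⟩, rfl⟩
  · rintro (⟨t, ht, rfl⟩ | ⟨t, ht, rfl⟩)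
    · have m : t / 2 ∈ Icc (0:ℝ) (1/2) := ⟨by linarith [ht.1], by linarith [ht.2]⟩
      refine ⟨t / 2, ⟨m.1, by linarith [m.2]⟩, ?_⟩
      rw [e1 _ m]; congr 1; ring
    · have m : (t + 1) / 2 ∈ Icc (1/2:ℝ) 1 := ⟨by linarith [ht.1], by linarith [ht.2]⟩
      refine ⟨(t + 1) / 2, ⟨by linarith [m.1], m.2⟩, ?_⟩
      rw [e2 _ m]; congr 1; ring

lemma crosscut_core {f : ℝ → ℂ} (hf : Loop f) {a b : ℝ} (hab : a < b) (hba : b < a + 1)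
    {y : ℂ} {r : ℝ} (hA1 : f '' Icc a b ⊆ Metric.ball y r) {X : Set ℂ} (hX : Arc X (f a) (f b))
    (hXb : X ⊆ Metric.ball y r) (hXC : X ∩ range f ⊆ {f a, f b})
    (hXD : X ⊆ In (range f) ∪ range f) :
    ∃ F : ℝ → ℂ, Loop F ∧ range F = f '' Icc b (a + 1) ∪ X ∧
      (∀ m ∈ In (range f), m ∉ Metric.ball y r → m ∈ In (range F)) ∧
      In (range F) ∪ range F ⊆ In (range f) ∪ range f := by
  have hA2 : Arc (f '' Icc b (a + 1)) (f b) (f a) := by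
    have := arc_of_Icc hba hf.cont.continuousOn (hf.injOn (by linarith : a + 1 < b + 1))
    rwa [hf.per] at this
  have hR : range f = f '' Icc a b ∪ f '' Icc b (a + 1) := by
    rw [← image_union, Icc_union_Icc_eq_Icc hab.le hba.le]; exact hf.range_eq a
  obtain ⟨F, hF, hr⟩ := loop_of_arcs hA2 hX (by
    rw [inter_comm, pair_comm]
    exact (inter_subset_inter_right _ (image_subset_range _ _)).trans hXC)
  have hFsub : range F ⊆ In (range f) ∪ range f := by
    rw [hr]; exact union_subset ((image_subset_range _ _).trans subset_union_right) hXD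
  refine ⟨F, hF, hr, ?_, union_subset ?_ hFsub⟩
  · intro m hm hmb
    refine ⟨fun h => ?_, fun hlog => hm.2 ?_⟩
    · rw [hr] at h
      rcases h with h | h
      · exact hm.1 (image_subset_range _ _ h)
      · exact hmb (hXb h)
    · have hA1c : IsClosed (f '' Icc a b) := (isCompact_Icc.image hf.cont).isClosed
      have l1 : HasLog (f '' Icc a b ∪ X) (fun z => z - m) :=
        hasLog_of_subset_ball (union_subset hA1 hXb) hmb
      have hintr : range F ∩ (f '' Icc a b ∪ X) = X := by
        rw [hr]
        apply Subset.antisymm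
        · rintro z ⟨h1 | h1, h2 | h2⟩
          · obtain ⟨s, hs, rfl⟩ := h1
            obtain ⟨t, ht, hst⟩ := h2
            obtain ⟨n, hn⟩ := hf.inj _ _ hst
            have h3 : (-1 : ℝ) ≤ n := by linarith [ht.1, hs.2]
            have h4 : (n : ℝ) ≤ 0 := by linarith [ht.2, hs.1]
            have h5 : -1 ≤ n := by exact_mod_cast h3
            have h6 : n ≤ 0 := by exact_mod_cast h4
            obtain rfl | rfl : n = -1 ∨ n = 0 := by omega
            · have : t = a := by push_cast at hn; linarith [ht.1, hs.2]
              rw [← hst, this]; exact hX.left_mem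
            · have : t = b := by push_cast at hn; linarith [ht.2, hs.1]
              rw [← hst, this]; exact hX.right_mem
          · exact h2
          · exact h1
          · exact h1
        · intro z hz; exact ⟨Or.inr hz, Or.inr hz⟩
      have := hasLog_union hF.isCompact.isClosed (hA1c.union hX.isClosed)
        (by rw [hintr]; exact hX.isPreconnected) hlog l1
      refine this.mono ?_
      rw [hR, hr]
      rintro z (h | h)
      · exact Or.inr (Or.inl h)
      · exact Or.inl (Or.inl h)
  · have hOut : Out (range f) ⊆ Out (range F) := by
      rcases preconnected_In_or_Out hF.isCompact.isClosed (isPreconnected_Out hf.isCompact)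
        (fun z hz h => by
          rcases hFsub h with h | h
          · exact disj_In_Out _ h hz
          · exact hz.1 h) with h | h
      · exfalso
        have hb := (In_bounded hF.isCompact).subset h
        have hu := hb.union (Out_cobounded hf.isCompact)
        rw [union_compl_self] at hu
        exact NormedSpace.unbounded_univ ℝ ℂ hu
      · exact h
    intro z hz
    rcases mem_trichotomy (range f) z with h | h | h
    · exact Or.inr h
    · exact Or.inl h
    · exact (disj_In_Out _ hz (hOut h)).elim

end TQ


namespace TQ

/-- a straight piece of a plane loop -/
def Edge (F : ℝ → ℂ) (z0 ν : ℂ) (ε : ℝ) : Prop :=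
  ∀ s t : ℝ, |s| < ε → |t| < ε →
    (t = 0 → z0 + s * (Complex.I * ν) + t * ν ∈ range F) ∧
    (0 < t → z0 + s * (Complex.I * ν) + t * ν ∈ Out (range F)) ∧
    (t < 0 → z0 + s * (Complex.I * ν) + t * ν ∈ In (range F))

lemma straight_edge {F : ℝ → ℂ} (hF : Loop F) (hne : (In (range F)).Nonempty) {z0 d : ℂ} {ρ : ℝ}
    (hd : d ≠ 0) (hρ : 0 < ρ) (hz0 : z0 ∈ range F)
    (hl : ∀ z ∈ Metric.ball z0 ρ, z ∈ range F ↔ ((z - z0) * (starRingEnd ℂ) d).im = 0) :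
    ∃ ν ε, ν ≠ 0 ∧ 0 < ε ∧ Edge F z0 ν ε := by
  have hcl := hF.isCompact.isClosed
  set L : ℂ → ℝ := fun z => ((z - z0) * (starRingEnd ℂ) d).im with hL
  have hconv : Convex ℝ {z | 0 < L z} ∧ Convex ℝ {z | L z < 0} := by
    have hlin : IsLinearMap ℝ (fun z : ℂ => (z * (starRingEnd ℂ) d).im) :=
      ⟨fun x y => by simp [add_mul], fun c x => by simp; ring⟩
    have h1 := convex_halfSpace_gt hlin (z0 * (starRingEnd ℂ) d).im
    have h2 := convex_halfSpace_lt hlin (z0 * (starRingEnd ℂ) d).im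
    have e : ∀ z, L z = (z * (starRingEnd ℂ) d).im - (z0 * (starRingEnd ℂ) d).im := fun z => by
      simp only [hL, sub_mul, Complex.sub_im]
    simp only [e, sub_pos, sub_neg]
    exact ⟨h1, h2⟩
  set H1 := Metric.ball z0 ρ ∩ {z | 0 < L z} with hH1
  set H2 := Metric.ball z0 ρ ∩ {z | L z < 0} with hH2
  have p1 : IsPreconnected H1 := ((convex_ball z0 ρ).inter hconv.1).isPreconnected
  have p2 : IsPreconnected H2 := ((convex_ball z0 ρ).inter hconv.2).isPreconnected
  have c1 := preconnected_In_or_Out hcl p1 (fun z hz h => hz.2.ne' ((hl z hz.1).1 h))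
  have c2 := preconnected_In_or_Out hcl p2 (fun z hz h => hz.2.ne ((hl z hz.1).1 h))
  have side : ∀ z ∈ Metric.ball z0 ρ, z ∉ range F → z ∈ H1 ∨ z ∈ H2 := by
    intro z hz h
    rcases lt_trichotomy (L z) 0 with h' | h' | h'
    · exact Or.inr ⟨hz, h'⟩
    · exact absurd ((hl z hz).2 h') h
    · exact Or.inl ⟨hz, h'⟩
  have z1 : z0 ∈ closure (In (range F)) := by
    rw [hF.closure_In hne]; exact Or.inr hz0
  have z2 := hF.subset_closure_Out hne hz0
  obtain ⟨w1, hw1, hw1'⟩ := mem_closure_iff_nhds.1 z1 _ (Metric.ball_mem_nhds z0 hρ)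
  obtain ⟨w2, hw2, hw2'⟩ := mem_closure_iff_nhds.1 z2 _ (Metric.ball_mem_nhds z0 hρ)
  have key : (H1 ⊆ Out (range F) ∧ H2 ⊆ In (range F)) ∨
      (H2 ⊆ Out (range F) ∧ H1 ⊆ In (range F)) := by
    have s1 := side w1 hw1 hw1'.1
    have s2 := side w2 hw2 hw2'.1
    rcases c1 with c1 | c1 <;> rcases c2 with c2 | c2
    · exfalso
      rcases s2 with h | h
      · exact disj_In_Out _ (c1 h) hw2'
      · exact disj_In_Out _ (c2 h) hw2'
    · exact Or.inr ⟨c2, c1⟩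
    · exact Or.inl ⟨c1, c2⟩
    · exfalso
      rcases s1 with h | h
      · exact disj_In_Out _ hw1' (c1 h)
      · exact disj_In_Out _ hw1' (c2 h)
  have hdn : 0 < ‖d‖ := norm_pos_iff.2 hd
  have hnn : 0 < Complex.normSq d := Complex.normSq_pos.2 hd
  -- uniform computation
  have comp : ∀ σ : ℝ, |σ| = 1 → ∀ s t : ℝ, |s| < ρ / (2 * ‖d‖) → |t| < ρ / (2 * ‖d‖) →
      z0 + s * (Complex.I * (σ * Complex.I * d)) + t * (σ * Complex.I * d) ∈ Metric.ball z0 ρ ∧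
      L (z0 + s * (Complex.I * (σ * Complex.I * d)) + t * (σ * Complex.I * d)) =
        t * σ * Complex.normSq d := by
    intro σ hσ s t hs ht
    have e : z0 + s * (Complex.I * (σ * Complex.I * d)) + t * (σ * Complex.I * d) - z0 =
        ((-(s * σ) : ℝ) + (t * σ : ℝ) * Complex.I) * d := by
      push_cast; linear_combination (s * σ * d) * Complex.I_mul_I
    constructor
    · rw [Metric.mem_ball, dist_eq_norm, e, norm_mul]
      have : ‖((-(s * σ) : ℝ) + (t * σ : ℝ) * Complex.I : ℂ)‖ ≤ |s| + |t| := by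
        refine (norm_add_le _ _).trans ?_
        rw [norm_mul, Complex.norm_I, mul_one, Complex.norm_real, Complex.norm_real,
          Real.norm_eq_abs, Real.norm_eq_abs, abs_neg, abs_mul, abs_mul, hσ, mul_one, mul_one]
      have h2 : |s| + |t| < ρ / ‖d‖ := by
        have : ρ / (2 * ‖d‖) + ρ / (2 * ‖d‖) = ρ / ‖d‖ := by field_simp; ring
        linarith
      calc _ ≤ (|s| + |t|) * ‖d‖ := by gcongr
        _ < ρ / ‖d‖ * ‖d‖ := by gcongr
        _ = ρ := by field_simp
    · simp only [hL, e]
      rw [mul_assoc, Complex.mul_conj]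
      simp
  have hε : 0 < ρ / (2 * ‖d‖) := by positivity
  have fin : ∀ σ : ℝ, |σ| = 1 → (∀ z ∈ Metric.ball z0 ρ, 0 < L z * σ → z ∈ Out (range F)) →
      (∀ z ∈ Metric.ball z0 ρ, L z * σ < 0 → z ∈ In (range F)) →
      ∃ ν ε, ν ≠ 0 ∧ 0 < ε ∧ Edge F z0 ν ε := by
    intro σ hσ h1 h2
    have hσ2 : σ * σ = 1 := by rw [← abs_mul_abs_self, hσ, one_mul]
    have hσ0 : σ ≠ 0 := by rintro rfl; simp at hσ
    refine ⟨σ * Complex.I * d, ρ / (2 * ‖d‖), ?_, hε, ?_⟩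
    · exact mul_ne_zero (mul_ne_zero (by exact_mod_cast hσ0) Complex.I_ne_zero) hd
    · intro s t hs ht
      obtain ⟨b, hb⟩ := comp σ hσ s t hs ht
      have hb' : L (z0 + s * (Complex.I * (σ * Complex.I * d)) + t * (σ * Complex.I * d)) * σ =
        t * Complex.normSq d := by rw [hb]; linear_combination t * Complex.normSq d * hσ2
      refine ⟨fun h0 => ?_, fun h0 => h1 _ b ?_, fun h0 => h2 _ b ?_⟩
      · rw [hl _ b]; rw [hL] at hb; simp only at hb; rw [hb, h0]; ring
      · rw [hb']; positivity
      · rw [hb']; exact mul_neg_of_neg_of_pos h0 hnn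
  rcases key with ⟨k1, k2⟩ | ⟨k1, k2⟩
  · exact fin 1 (by simp) (fun z hz h => k1 ⟨hz, by simpa using h⟩)
      (fun z hz h => k2 ⟨hz, by simpa using h⟩)
  · exact fin (-1) (by simp) (fun z hz h => k1 ⟨hz, by simpa using h⟩)
      (fun z hz h => k2 ⟨hz, by simpa using h⟩)

lemma first_hit {C : Set ℂ} (hC : IsClosed C) {x y : ℂ} (hx : x ∈ In C) (hy : y ∈ C) :
    ∃ α : ℝ, 0 < α ∧ α ≤ 1 ∧ x + α * (y - x) ∈ C ∧
      ∀ s : ℝ, 0 ≤ s → s < α → x + s * (y - x) ∈ In C := by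
  set φ : ℝ → ℂ := fun s => x + s * (y - x) with hφ
  have hφc : Continuous φ := by fun_prop
  have hcomp : IsCompact (Icc (0:ℝ) 1 ∩ φ ⁻¹' C) :=
    isCompact_Icc.inter_right (hC.preimage hφc)
  obtain ⟨α, ⟨hα, hαC⟩, hmin⟩ := hcomp.exists_isLeast ⟨1, by simp, by simpa [hφ] using hy⟩
  have hα0 : α ≠ 0 := by
    rintro rfl
    apply hx.1; simpa [hφ] using hαC
  refine ⟨α, lt_of_le_of_ne hα.1 hα0.symm, hα.2, hαC, fun s hs hsα => ?_⟩
  have hmiss : φ '' Icc 0 s ⊆ Cᶜ := by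
    rintro _ ⟨t, ht, rfl⟩ h
    have := hmin ⟨⟨ht.1, by linarith [ht.2, hα.2]⟩, h⟩
    linarith [ht.2]
  have h0 : φ 0 = x := by simp [hφ]
  rcases preconnected_In_or_Out hC (isPreconnected_Icc.image φ hφc.continuousOn) hmiss with h | h
  · exact h ⟨s, ⟨hs, le_rfl⟩, rfl⟩
  · have := h ⟨0, ⟨le_rfl, hs⟩, rfl⟩
    rw [h0] at this
    exact (disj_In_Out _ hx this).elim

lemma seg_param (x u : ℂ) {α : ℝ} (hα : 0 < α) {z : ℂ} (hz : z ∈ segment ℝ x (x + α * u)) :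
    ∃ s : ℝ, 0 ≤ s ∧ s ≤ α ∧ z = x + s * u := by
  rw [segment_eq_image'] at hz
  obtain ⟨t, ht, rfl⟩ := hz
  refine ⟨t * α, mul_nonneg ht.1 hα.le, by nlinarith [ht.2], ?_⟩
  simp only [add_sub_cancel_left, Complex.real_smul]; push_cast; ring

lemma param_seg (x u : ℂ) {α s : ℝ} (hα : 0 < α) (h0 : 0 ≤ s) (h1 : s ≤ α) :
    x + s * u ∈ segment ℝ x (x + α * u) := by
  rw [segment_eq_image']
  refine ⟨s / α, ⟨by positivity, by rw [div_le_one hα]; exact h1⟩, ?_⟩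
  simp only [add_sub_cancel_left, Complex.real_smul]; push_cast
  have : (α : ℂ) ≠ 0 := by exact_mod_cast hα.ne'
  field_simp

end TQ


namespace TQ

lemma indep {u v : ℂ} (h : (u * (starRingEnd ℂ) v).im ≠ 0) {s t : ℝ} (e : (s : ℂ) * u = t * v) :
    s = 0 ∧ t = 0 := by
  have hs : s = 0 := by
    have h1 : (s : ℂ) * (u * (starRingEnd ℂ) v) = ((t * Complex.normSq v : ℝ) : ℂ) := by
      push_cast; rw [← Complex.mul_conj]; linear_combination (starRingEnd ℂ) v * e
    have h2 := congrArg Complex.im h1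
    rw [Complex.im_ofReal_mul, Complex.ofReal_im] at h2
    exact (mul_eq_zero.1 h2).resolve_right h
  refine ⟨hs, ?_⟩
  have hv : v ≠ 0 := by rintro rfl; simp at h
  rw [hs] at e
  simp only [Complex.ofReal_zero, zero_mul] at e
  exact_mod_cast (mul_eq_zero.1 e.symm).resolve_right hv

lemma on_line {w u : ℂ} (hu : u ≠ 0) (h : (w * (starRingEnd ℂ) u).im = 0) :
    ∃ c : ℝ, w = c * u := by
  refine ⟨(w * (starRingEnd ℂ) u).re / Complex.normSq u, ?_⟩
  have hn : (Complex.normSq u : ℂ) ≠ 0 := by exact_mod_cast (Complex.normSq_pos.2 hu).ne'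
  have e : (((w * (starRingEnd ℂ) u).re : ℝ) : ℂ) = w * (starRingEnd ℂ) u :=
    Complex.ext (by simp) (by simp [h])
  rw [Complex.ofReal_div, e, div_mul_eq_mul_div, eq_div_iff hn, ← Complex.mul_conj]
  ring

theorem crosscut {f : ℝ → ℂ} (hf : Loop f) {M : Set ℂ} (hM : IsCompact M) (hMne : M.Nonempty)
    (hMD : M ⊆ In (range f)) :
    ∃ F : ℝ → ℂ, Loop F ∧ M ⊆ In (range F) ∧
      In (range F) ∪ range F ⊆ In (range f) ∪ range f ∧
      ∃ z0 ν ε, ν ≠ 0 ∧ 0 < ε ∧ Edge F z0 ν ε := by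
  have hC := hf.isCompact.isClosed
  have hInO := isOpen_In hC
  set y := f 0 with hy
  have hyC : y ∈ range f := ⟨0, rfl⟩
  obtain ⟨r, hr, hrM⟩ := Metric.isOpen_iff.1 hM.isClosed.isOpen_compl y (fun h => (hMD h).1 hyC)
  obtain ⟨δ0, hδ0, hδ0f⟩ := Metric.continuous_iff.1 hf.cont 0 r hr
  set δ := min (δ0 / 2) (1 / 4) with hδ
  have hδp : 0 < δ := by positivity
  have hδ1 : δ < δ0 := (min_le_left _ _).trans_lt (by linarith)
  have hδ2 : δ ≤ 1 / 4 := min_le_right _ _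
  have hδf : ∀ t : ℝ, |t| < δ → f t ∈ Metric.ball y r := fun t ht =>
    hδ0f t (by rw [Real.dist_eq, sub_zero]; linarith)
  have hAc : IsClosed (f '' Icc δ (1 - δ)) := (isCompact_Icc.image hf.cont).isClosed
  have hyA : y ∉ f '' Icc δ (1 - δ) := by
    rintro ⟨t, ht, h⟩
    obtain ⟨n, hn⟩ := hf.inj _ _ h
    have h1 : (0 : ℝ) < n := by linarith [ht.1]
    have h2 : (n : ℝ) < 1 := by linarith [ht.2]
    have h3 : 0 < n := by exact_mod_cast h1
    have h4 : n < 1 := by exact_mod_cast h2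
    omega
  obtain ⟨r', hr', hr'A⟩ := Metric.isOpen_iff.1 hAc.isOpen_compl y hyA
  set r1 := min r r' with hr1
  have hr1p : 0 < r1 := lt_min hr hr'
  have hr1r : Metric.ball y r1 ⊆ Metric.ball y r := Metric.ball_subset_ball (min_le_left _ _)
  have near : ∀ z ∈ range f, z ∈ Metric.ball y r1 → ∃ t, |t| < δ ∧ f t = z := by
    intro z hz hzb
    have hzA : z ∉ f '' Icc δ (1 - δ) := hr'A (Metric.ball_subset_ball (min_le_right _ _) hzb)
    rw [hf.range_eq (-δ)] at hz
    obtain ⟨t, ht, rfl⟩ := hz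
    refine ⟨t, abs_lt.2 ⟨?_, ?_⟩, rfl⟩
    · refine lt_of_le_of_ne ht.1 fun h => hzA ⟨t + 1, ⟨by linarith, by linarith⟩, hf.per t⟩
    · by_contra hcon
      exact hzA ⟨t, ⟨not_lt.1 hcon, by linarith [ht.2]⟩, rfl⟩
  -- second point
  obtain ⟨δ3, hδ3, hδ3f⟩ := Metric.continuous_iff.1 hf.cont 0 r1 hr1p
  obtain ⟨y', hy'C, hy'b, hyy'⟩ : ∃ y' ∈ range f, y' ∈ Metric.ball y r1 ∧ y' ≠ y := by
    set t1 := min (δ3 / 2) (1 / 2) with ht1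
    have h1 : 0 < t1 := by positivity
    have h2 : t1 < δ3 := (min_le_left _ _).trans_lt (by linarith)
    have h3 : t1 ≤ 1 / 2 := min_le_right _ _
    refine ⟨f t1, ⟨t1, rfl⟩, hδ3f t1 (by rw [Real.dist_eq, sub_zero, abs_of_pos h1]; exact h2), ?_⟩
    intro h
    obtain ⟨n, hn⟩ := hf.inj _ _ h
    have h1 : (0 : ℝ) < n := by linarith
    have h2 : (n : ℝ) < 1 := by linarith
    have h3 : 0 < n := by exact_mod_cast h1
    have h4 : n < 1 := by exact_mod_cast h2
    omega
  set d := y' - y with hd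
  have hd0 : d ≠ 0 := sub_ne_zero.2 hyy'
  -- the interior point
  obtain ⟨x, hxIn, hxb, hcr0⟩ : ∃ x ∈ In (range f), x ∈ Metric.ball y r1 ∧
      ((y - x) * (starRingEnd ℂ) d).im ≠ 0 := by
    have hycl : y ∈ closure (In (range f)) := by
      rw [hf.closure_In (hMne.mono hMD)]; exact Or.inr hyC
    obtain ⟨x0, hx0b, hx0⟩ := mem_closure_iff_nhds.1 hycl _ (Metric.ball_mem_nhds y hr1p)
    by_cases hc : ((y - x0) * (starRingEnd ℂ) d).im = 0
    swap
    · exact ⟨x0, hx0, hx0b, hc⟩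
    have hev : ∀ᶠ t : ℝ in 𝓝 0, x0 + t * (Complex.I * d) ∈ In (range f) ∩ Metric.ball y r1 := by
      have hcont : Continuous fun t : ℝ => x0 + t * (Complex.I * d) := by fun_prop
      refine hcont.continuousAt.eventually_mem ((hInO.inter Metric.isOpen_ball).mem_nhds ?_)
      simpa using ⟨hx0, hx0b⟩
    have hev2 : ∀ᶠ t : ℝ in 𝓝[≠] 0, x0 + t * (Complex.I * d) ∈ In (range f) ∩ Metric.ball y r1 :=
      hev.filter_mono nhdsWithin_le_nhds
    obtain ⟨t, ht, ht0⟩ := (hev2.and self_mem_nhdsWithin).exists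
    refine ⟨_, ht.1, ht.2, ?_⟩
    have e : (y - (x0 + t * (Complex.I * d))) * (starRingEnd ℂ) d =
        (y - x0) * (starRingEnd ℂ) d - ((t * Complex.normSq d : ℝ) : ℂ) * Complex.I := by
      push_cast; rw [← Complex.mul_conj]; ring
    rw [e, Complex.sub_im, hc, Complex.im_ofReal_mul, Complex.I_im]
    have := (Complex.normSq_pos.2 hd0).ne'
    simp only [mul_one, zero_sub, neg_ne_zero]
    exact mul_ne_zero ht0 this
  set u := y - x with hu
  set v := y' - x with hv
  have hcr : (u * (starRingEnd ℂ) v).im ≠ 0 := by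
    have e : u * (starRingEnd ℂ) v = u * (starRingEnd ℂ) d + (Complex.normSq u : ℂ) := by
      have : v = d + u := by rw [hv, hd, hu]; ring
      rw [this, map_add, mul_add, Complex.mul_conj]
    rw [e, Complex.add_im, Complex.ofReal_im, add_zero]; exact hcr0
  have hu0 : u ≠ 0 := by intro h; rw [h] at hcr; simp at hcr
  have hv0 : v ≠ 0 := by intro h; rw [h] at hcr; simp at hcr
  obtain ⟨α, hα, hα1, hαC, hαI⟩ := first_hit hC hxIn hyC
  obtain ⟨β, hβ, hβ1, hβC, hβI⟩ := first_hit hC hxIn hy'C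
  rw [← hu] at hαC hαI
  rw [← hv] at hβC hβI
  set a := x + α * u with ha
  set b := x + β * v with hb
  have seg_ball : ∀ w ∈ Metric.ball y r1, ∀ s : ℝ, 0 ≤ s → s ≤ 1 → x + s * (w - x) ∈
      Metric.ball y r1 := by
    intro w hw s h0 h1
    have := (convex_ball y r1).add_smul_sub_mem hxb hw ⟨h0, h1⟩
    simpa using this
  have hyb : y ∈ Metric.ball y r1 := Metric.mem_ball_self hr1p
  set X := segment ℝ x a ∪ segment ℝ x b with hX
  have hXball : X ⊆ Metric.ball y r1 := by
    rintro z (h | h)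
    · obtain ⟨s, h0, h1, rfl⟩ := seg_param x u hα h
      exact seg_ball y hyb s h0 (h1.trans hα1)
    · obtain ⟨s, h0, h1, rfl⟩ := seg_param x v hβ h
      exact seg_ball y' hy'b s h0 (h1.trans hβ1)
  have hXcase : ∀ z ∈ X, z ∈ In (range f) ∨ z = a ∨ z = b := by
    rintro z (h | h)
    · obtain ⟨s, h0, h1, rfl⟩ := seg_param x u hα h
      rcases h1.lt_or_eq with h | h
      · exact Or.inl (hαI s h0 h)
      · rw [h]; exact Or.inr (Or.inl rfl)
    · obtain ⟨s, h0, h1, rfl⟩ := seg_param x v hβ h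
      rcases h1.lt_or_eq with h | h
      · exact Or.inl (hβI s h0 h)
      · rw [h]; exact Or.inr (Or.inr rfl)
  have hxa : x ≠ a := fun h => hxIn.1 (h ▸ hαC)
  have hxb' : x ≠ b := fun h => hxIn.1 (h ▸ hβC)
  have hintr : segment ℝ x a ∩ segment ℝ x b = {x} := by
    apply Subset.antisymm
    · rintro z ⟨h1, h2⟩
      obtain ⟨s, -, -, rfl⟩ := seg_param x u hα h1
      obtain ⟨t, -, -, h⟩ := seg_param x v hβ h2
      have := (indep hcr (add_left_cancel h)).1
      simp [this]
    · rintro z rfl; exact ⟨left_mem_segment ℝ _ _, left_mem_segment ℝ _ _⟩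
  have hXarc : Arc X a b := (arc_segment hxa).symm.trans (arc_segment hxb') hintr
  obtain ⟨ta, hta, hfa⟩ := near a hαC (hXball hXarc.left_mem)
  obtain ⟨tb, htb, hfb⟩ := near b hβC (hXball hXarc.right_mem)
  have hab : ta ≠ tb := fun h => hXarc.ne (by rw [← hfa, ← hfb, h])
  have hXC : X ∩ range f ⊆ {a, b} := by
    rintro z ⟨h1, h2⟩
    rcases hXcase z h1 with h | h | h
    · exact absurd h2 h.1
    · exact Or.inl h
    · exact Or.inr h
  have hXD : X ⊆ In (range f) ∪ range f := by
    intro z hz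
    rcases hXcase z hz with h | rfl | rfl
    · exact Or.inl h
    · exact Or.inr hαC
    · exact Or.inr hβC
  rw [abs_lt] at hta htb
  have small : ∀ s t : ℝ, -δ < s → t < δ → f '' Icc s t ⊆ Metric.ball y r := by
    rintro s t hs ht _ ⟨w, hw, rfl⟩
    exact hδf w (abs_lt.2 ⟨by linarith [hw.1], by linarith [hw.2]⟩)
  obtain ⟨F, A2, hF, hFr, hA2, hFM, hFD⟩ : ∃ (F : ℝ → ℂ) (A2 : Set ℂ), Loop F ∧
      range F = A2 ∪ X ∧ A2 ⊆ range f ∧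
      (∀ m ∈ In (range f), m ∉ Metric.ball y r → m ∈ In (range F)) ∧
      In (range F) ∪ range F ⊆ In (range f) ∪ range f := by
    rcases lt_or_gt_of_ne hab with h | h
    · obtain ⟨F, h1, h2, h3, h4⟩ := crosscut_core hf h (by linarith) (small _ _ hta.1 htb.2)
        (X := X) (by rw [hfa, hfb]; exact hXarc) (hXball.trans hr1r) (by rw [hfa, hfb]; exact hXC) hXD
      exact ⟨F, _, h1, h2, image_subset_range _ _, h3, h4⟩
    · obtain ⟨F, h1, h2, h3, h4⟩ := crosscut_core hf h (by linarith) (small _ _ htb.1 hta.2)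
        (X := X) (by rw [hfa, hfb]; exact hXarc.symm) (hXball.trans hr1r)
        (by rw [hfa, hfb, pair_comm]; exact hXC) hXD
      exact ⟨F, _, h1, h2, image_subset_range _ _, h3, h4⟩
  have hMF : M ⊆ In (range F) := fun m hm => hFM m (hMD hm) fun h => hrM h hm
  refine ⟨F, hF, hMF, hFD, ?_⟩
  -- the edge
  set z0 := x + ((α / 2 : ℝ) : ℂ) * u with hz0
  have hz0In : z0 ∈ In (range f) := hαI _ (by linarith) (by linarith)
  have hz0b : z0 ∉ segment ℝ x b := by
    intro h
    obtain ⟨t, -, -, h⟩ := seg_param x v hβ h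
    have := (indep hcr (add_left_cancel h)).1
    linarith
  obtain ⟨ρ1, hρ1, hρ1'⟩ := Metric.isOpen_iff.1
    (hInO.inter (arc_segment hxb').isClosed.isOpen_compl) z0 ⟨hz0In, hz0b⟩
  have hun : 0 < ‖u‖ := norm_pos_iff.2 hu0
  set ρ := min ρ1 (α / 2 * ‖u‖) with hρ
  have hρp : 0 < ρ := by positivity
  have hz0F : z0 ∈ range F := by
    rw [hFr]; exact Or.inr (Or.inl (param_seg x u hα (by linarith) (by linarith)))
  obtain ⟨ν, ε, h1, h2, h3⟩ := straight_edge hF (hMne.mono hMF) hu0 hρp hz0F (by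
    intro z hz
    obtain ⟨hzI, hzb⟩ := hρ1' (Metric.ball_subset_ball (min_le_left _ _) hz)
    rw [hFr]
    constructor
    · rintro (h | h | h)
      · exact absurd (hA2 h) hzI.1
      · obtain ⟨s, -, -, rfl⟩ := seg_param x u hα h
        have e : (x + s * u - z0) * (starRingEnd ℂ) u = (((s - α / 2) * Complex.normSq u : ℝ) : ℂ) := by
          push_cast; rw [← Complex.mul_conj, hz0]; push_cast; ring
        rw [e, Complex.ofReal_im]
      · exact absurd h hzb
    · intro h
      obtain ⟨c, hc⟩ := on_line hu0 h
      have hzn : ‖z - z0‖ < α / 2 * ‖u‖ := by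
        rw [Metric.mem_ball, dist_eq_norm] at hz
        exact hz.trans_le (min_le_right _ _)
      rw [hc, norm_mul, Complex.norm_real, Real.norm_eq_abs] at hzn
      have hc' := abs_lt.1 (lt_of_mul_lt_mul_right hzn hun.le)
      have e : z = x + ((α / 2 + c : ℝ) : ℂ) * u := by
        have : z = z0 + c * u := by rw [← hc]; ring
        rw [this, hz0]; push_cast; ring
      rw [e]
      exact Or.inr (Or.inl (param_seg x u hα (by linarith) (by linarith))))
  exact ⟨z0, ν, ε, h1, h2, h3⟩

end TQ


namespace TQ

lemma sep_nhds {ι : Type*} [Finite ι] (K : ι → Set RSphere) (hc : ∀ k, IsClosed (K k))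
    (hne : ∀ k, (K k).Nonempty) (hd : ∀ k j x, x ∈ K k → x ∈ K j → k = j) :
    ∃ V : ι → Set RSphere, (∀ k, IsOpen (V k)) ∧ (∀ k, K k ⊆ V k) ∧
      ∀ k j x, x ∈ V k → x ∈ V j → k = j := by
  refine ⟨fun k => ⋂ j : {j // j ≠ k},
    {x | Metric.infDist x (K k) < Metric.infDist x (K j)}, fun k => ?_, fun k x hx => ?_, ?_⟩
  · refine isOpen_iInter_of_finite fun j => ?_
    exact isOpen_lt (Metric.continuous_infDist_pt _) (Metric.continuous_infDist_pt _)
  · refine mem_iInter.2 fun j => ?_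
    show Metric.infDist x (K k) < Metric.infDist x (K j)
    rw [Metric.infDist_zero_of_mem hx]
    refine ((hc j).notMem_iff_infDist_pos (hne j)).1 fun h => ?_
    exact j.2 (hd _ _ _ h hx)
  · intro k j x hk hj
    by_contra h
    have h1 : Metric.infDist x (K k) < Metric.infDist x (K j) := mem_iInter.1 hk ⟨j, Ne.symm h⟩
    have h2 : Metric.infDist x (K j) < Metric.infDist x (K k) := mem_iInter.1 hj ⟨k, h⟩
    exact lt_asymm h1 h2

lemma frontier_ext {f : ℝ → ℂ} (hf : Loop f) (hne : (In (range f)).Nonempty) :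
    frontier (closure (ofC '' In (range f)))ᶜ = frontier (ofC '' In (range f)) := by
  have h1 : IsOpen (closure (ofC '' In (range f)))ᶜ := isClosed_closure.isOpen_compl
  rw [h1.frontier_eq, frontier_ofC_In' hf hne]
  ext x
  constructor
  · rintro ⟨hx, hx'⟩
    rw [notMem_compl_iff, frontier_ofC_In hf hne] at hx'
    obtain ⟨z, hz | hz, rfl⟩ := hx'
    · exfalso
      obtain ⟨y, hy1, hy2⟩ := mem_closure_iff_nhds.1 hx _ ((open_ofC_In hf).mem_nhds ⟨z, hz, rfl⟩)
      exact hy2 (subset_closure hy1)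
    · exact ⟨z, hz, rfl⟩
  · rintro ⟨z, hz, rfl⟩
    refine ⟨?_, ?_⟩
    · rw [ext_ofC_In hf hne]
      refine closure_mono (subset_insert _ _) ?_
      have := image_closure_subset_closure_image cont_ofC (s := Out (range f))
      exact this ⟨z, hf.subset_closure_Out hne hz, rfl⟩
    · rw [notMem_compl_iff, frontier_ofC_In hf hne]
      exact ⟨z, Or.inr hz, rfl⟩

theorem refine_data {g : ℕ} (S : SchottkyData g) (hinf : infty ∈ S.domain) :
    ∃ S' : SchottkyData g, S'.gen = S.gen ∧ infty ∈ S'.domain ∧ ∀ i, ∃ (F : ℝ → ℂ) (z0 ν : ℂ) (ε : ℝ),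
      Loop F ∧ (In (range F)).Nonempty ∧ S'.D (Sum.inl i) = ofC '' In (range F) ∧
      frontier (S'.D (Sum.inl i)) = ofC '' range F ∧ ν ≠ 0 ∧ 0 < ε ∧ Edge F z0 ν ε := by
  let K : Option (Lt g) → Set RSphere := fun o => o.elim {infty} (fun k => closure (S.D k))
  obtain ⟨V, hVo, hKV, hVd⟩ := sep_nhds K
    (by rintro (_ | k); exacts [isClosed_singleton, isClosed_closure])
    (by rintro (_ | k); exacts [⟨infty, rfl⟩, (S.nonempty k).closure])
    (by
      rintro (_ | k) (_ | j) x hx hx'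
      · rfl
      · have : x = infty := hx
        subst this; exact absurd hx' (inf_cl hinf j)
      · have : x = infty := hx'
        subst this; exact absurd hx (inf_cl hinf k)
      · rw [cl_disj hx hx'])
  have main : ∀ i : Fin g, ∃ (F : ℝ → ℂ) (z0 ν : ℂ) (ε : ℝ),
      Loop F ∧ (In (range F)).Nonempty ∧
      closure (ofC '' In (range F)) ⊆ closure (S.D (Sum.inl i)) ∧
      (mobius (S.gen i) '' (ofC '' In (range F)))ᶜ ⊆ V (some (Sum.inr i)) ∧
      ν ≠ 0 ∧ 0 < ε ∧ Edge F z0 ν ε := by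
    intro i
    obtain ⟨f, hf, hne, hD, hfr⟩ := disc hinf (Sum.inl i)
    set W := V (some (Sum.inr i)) with hW
    have hsub : mobius (S.gen i)⁻¹ '' Wᶜ ⊆ S.D (Sum.inl i) := by
      rintro _ ⟨x, hx, rfl⟩
      refine (tm_D hinf (Sum.inl i) x).2 fun h => hx ?_
      exact hKV (some (Sum.inr i)) h
    have hMs : mobius (S.gen i)⁻¹ '' Wᶜ ⊆ ofC '' In (range f) := hD ▸ hsub
    have hM : IsCompact (ofC ⁻¹' (mobius (S.gen i)⁻¹ '' Wᶜ)) := by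
      refine oe_ofC.isInducing.isCompact_preimage' ?_ (hMs.trans (image_subset_range _ _))
      exact ((hVo _).isClosed_compl.isCompact).image (mob_cont _)
    have hMne : (ofC ⁻¹' (mobius (S.gen i)⁻¹ '' Wᶜ)).Nonempty := by
      have hi : infty ∈ Wᶜ := fun h => by
        have := hVd none _ infty (hKV none rfl) h
        simp at this
      obtain ⟨z, hz, hz'⟩ := hMs ⟨_, hi, rfl⟩
      exact ⟨z, ⟨_, hi, hz'.symm⟩⟩
    obtain ⟨F, hF, hMF, hFf, z0, ν, ε, hν, hε, hE⟩ := crosscut hf hM hMne (by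
      intro z hz
      obtain ⟨w, hw, hw'⟩ := hMs hz
      rwa [← ofC_inj hw'])
    have hne' := hMne.mono hMF
    refine ⟨F, z0, ν, ε, hF, hne', ?_, ?_, hν, hε, hE⟩
    · rw [frontier_ofC_In hF hne', hD, frontier_ofC_In hf hne]
      exact image_mono hFf
    · intro x hx
      by_contra hxW
      obtain ⟨z, hz, hz'⟩ := hMs ⟨x, hxW, rfl⟩
      refine hx ⟨ofC z, ⟨z, hMF ⟨x, hxW, hz'.symm⟩, rfl⟩, ?_⟩
      rw [hz', mob_mob_inv]
  choose F z0 ν ε hF hne hcl hV hν hε hE using main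
  let D : Lt g → Set RSphere := fun k => k.elim (fun i => ofC '' In (range (F i)))
    (fun i => mobius (S.gen i) '' (closure (ofC '' In (range (F i))))ᶜ)
  have hclr : ∀ i, closure (D (Sum.inr i)) ⊆ V (some (Sum.inr i)) := by
    intro i
    refine Subset.trans ?_ (hV i)
    refine closure_minimal ?_ ?_
    · rintro _ ⟨x, hx, rfl⟩ ⟨y, hy, h⟩
      rw [mob_inj _ h] at hy
      exact hx (subset_closure hy)
    · exact ((mobH (S.gen i)).isOpenMap _ (open_ofC_In (hF i))).isClosed_compl
  have hfr : ∀ i, frontier (D (Sum.inr i)) = mobius (S.gen i) '' frontier (D (Sum.inl i)) := by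
    intro i
    show frontier (mobius (S.gen i) '' (closure (ofC '' In (range (F i))))ᶜ) = mobius (S.gen i) '' frontier (ofC '' In (range (F i)))
    rw [← frontier_ext (hF i) (hne i), ← mobH_coe, (mobH (S.gen i)).image_frontier]
  have hJ : ∀ i, IsJordanCurve (frontier (D (Sum.inl i))) := by
    intro i
    show IsJordanCurve (frontier (ofC '' In (range (F i))))
    rw [frontier_ofC_In' (hF i) (hne i), ← range_comp]
    exact loop_jordan (loop_ofC (hF i))
  have hVi : ∀ k, closure (D k) ⊆ V (some k) := by
    rintro (i | i)
    · exact (hcl i).trans (hKV (some (Sum.inl i)))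
    · exact hclr i
  refine ⟨{ gen := S.gen, D := D, isOpen := ?_, nonempty := ?_, jordan := ?_,
            disjointClosures := ?_, lox := S.lox, maps_boundary := fun i => (hfr i).symm,
            maps_off := ?_ }, rfl, ?_, ?_⟩
  · rintro (i | i)
    · exact open_ofC_In (hF i)
    · exact (mobH (S.gen i)).isOpenMap _ isClosed_closure.isOpen_compl
  · rintro (i | i)
    · exact (hne i).image _
    · refine ⟨mobius (S.gen i) infty, infty, fun h => ?_, rfl⟩
      exact inf_cl hinf _ (hcl i h)
  · rintro (i | i)
    · exact hJ i
    · rw [hfr]; exact jordan_mob (hJ i) _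
  · intro k j hkj
    rw [eq_empty_iff_forall_notMem]
    rintro x ⟨h1, h2⟩
    exact hkj (Option.some_injective _ (hVd _ _ x (hVi k h1) (hVi j h2)))
  · intro i
    rw [eq_empty_iff_forall_notMem]
    rintro x ⟨⟨y, hy, rfl⟩, ⟨w, hw, h⟩⟩
    rw [mob_inj _ h] at hw
    exact hw (subset_closure hy)
  · intro h
    obtain ⟨k, hk⟩ := mem_iUnion.1 h
    have := hVd none _ infty (hKV none rfl) (hVi k hk)
    simp at this
  · intro i
    exact ⟨F i, z0 i, ν i, ε i, hF i, hne i, rfl, frontier_ofC_In' (hF i) (hne i), hν i, hε i, hE i⟩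

end TQ


namespace TQ

variable {g : ℕ} {S : SchottkyData g}

/-- reduced words -/
def Rd (l : List (Lt g)) : Prop := l.IsChain (fun a b => b ≠ a.swap)

lemma wd_append (l l' : List (Lt g)) : wd S (l ++ l') = wd S l * wd S l' := by
  induction l with
  | nil => simp [wd]
  | cons a l ih => simp [wd, ih, mul_assoc]

lemma wd_single (k : Lt g) : wd S [k] = tm S k := by simp [wd]

lemma exists_R (hinf : infty ∈ S.domain) : ∃ R : ℝ, 0 < R ∧ ∀ k z, ofC z ∈ closure (S.D k) → ‖z‖ ≤ R := by
  have h : ∀ k, ∃ R : ℝ, ∀ z, ofC z ∈ closure (S.D k) → ‖z‖ ≤ R := by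
    intro k
    have := bdd_of_inf (A := closure (S.D k)) (by rw [closure_closure]; exact inf_cl hinf k)
    obtain ⟨R, hR⟩ := this.exists_norm_le
    exact ⟨R, fun z hz => hR z hz⟩
  choose R hR using h
  refine ⟨1 + ∑ k, |R k|, ?_, fun k z hz => ?_⟩
  · have : 0 ≤ ∑ k, |R k| := Finset.sum_nonneg fun _ _ => abs_nonneg _
    linarith
  · have h1 := Finset.single_le_sum (f := fun k => |R k|) (fun _ _ => abs_nonneg _) (Finset.mem_univ k)
    have := hR k z hz
    have := le_abs_self (R k)
    linarith

lemma word_img (hinf : infty ∈ S.domain) (l : List (Lt g)) (k : Lt g) (h : Rd (l ++ [k])) {x : RSphere}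
    (hx : x ∉ S.D k.swap) :
    ∃ j, (l ++ [k]).head? = some j ∧ mobius (wd S (l ++ [k])) x ∈ closure (S.D j) := by
  induction l with
  | nil => exact ⟨k, rfl, by rw [List.nil_append, wd_single]; exact (tm_cl hinf k x).2 hx⟩
  | cons a l ih =>
    have h' : (a :: (l ++ [k])).IsChain (fun a b : Lt g => b ≠ a.swap) := h
    rw [List.isChain_cons] at h'
    obtain ⟨j, hj, hm⟩ := ih h'.2
    refine ⟨a, rfl, ?_⟩
    show mobius (tm S a * wd S (l ++ [k])) x ∈ _
    rw [mob_mul]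
    refine (tm_cl hinf a _).2 fun hc => ?_
    exact h'.1 j hj (cl_disj hm (subset_closure hc))

lemma dom_notMem {x : RSphere} (hx : x ∈ S.domain) (k) : x ∉ closure (S.D k) :=
  fun h => hx (mem_iUnion.2 ⟨k, h⟩)

lemma word_dom (hinf : infty ∈ S.domain) (l : List (Lt g)) (h : Rd l) (hl : l ≠ []) {x : RSphere}
    (hx : x ∈ S.domain) : ∃ j, l.head? = some j ∧ mobius (wd S l) x ∈ closure (S.D j) := by
  obtain ⟨l', k, rfl⟩ : ∃ l' k, l = l' ++ [k] := ⟨l.dropLast, l.getLast hl, (List.dropLast_append_getLast hl).symm⟩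
  exact word_img hinf l' k h fun h => dom_notMem hx _ (subset_closure h)

lemma word_inj (hinf : infty ∈ S.domain) (l l' : List (Lt g)) (h : Rd l) (h' : Rd l') {x x' : RSphere}
    (hx : x ∈ S.domain) (hx' : x' ∈ S.domain) (e : mobius (wd S l) x = mobius (wd S l') x') : l = l' := by
  induction l generalizing l' with
  | nil =>
    by_contra hne
    obtain ⟨j, -, hj⟩ := word_dom hinf l' h' (Ne.symm hne) hx'
    rw [← e] at hj
    simp only [wd, mob_one] at hj
    exact dom_notMem hx _ hj
  | cons a l ih =>
    rcases l' with _ | ⟨b, l'⟩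
    · exfalso
      obtain ⟨j, -, hj⟩ := word_dom hinf _ h (by simp) hx
      rw [e] at hj
      simp only [wd, mob_one] at hj
      exact dom_notMem hx' _ hj
    · obtain ⟨j, e1, hj⟩ := word_dom hinf _ h (by simp) hx
      obtain ⟨j', e2, hj'⟩ := word_dom hinf _ h' (by simp) hx'
      simp only [List.head?_cons, Option.some.injEq] at e1 e2
      subst e1 e2
      rw [e] at hj
      have hab := cl_disj hj hj'
      subst hab
      simp only [wd, mob_mul] at e
      rw [ih l' (List.isChain_cons.1 h).2 (List.isChain_cons.1 h').2 (mob_inj _ e)]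

/-- pole of a reduced word -/
lemma word_pole (hinf : infty ∈ S.domain) (l : List (Lt g)) (k : Lt g) (h : Rd (l ++ [k])) :
    mobius (wd S l)⁻¹ infty ∈ ({infty} ∪ ⋃ j : {j // j ≠ k}, closure (S.D j) : Set RSphere) := by
  induction l using List.reverseRecOn generalizing k with
  | nil => left; simp [wd, mob_one]
  | append_singleton l j ih =>
    have hc : (l ++ ([j] ++ [k])).IsChain (fun a b : Lt g => b ≠ a.swap) := by
      have := h; unfold Rd at this; rwa [List.append_assoc] at this
    have h1 : Rd (l ++ [j]) := by
      have := h; unfold Rd at this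
      exact List.IsChain.left_of_append this
    have hjk : k ≠ j.swap := by
      have := List.IsChain.right_of_append hc
      simpa using this
    have := ih j h1
    right
    refine mem_iUnion.2 ⟨⟨j.swap, Ne.symm hjk⟩, subset_closure ?_⟩
    rw [wd_append, wd_single, mul_inv_rev, mob_mul, ← tm_swap]
    refine (tm_D hinf _ _).2 fun hcl => ?_
    rw [Sum.swap_swap] at hcl
    rcases this with h2 | h2
    · rw [h2] at hcl; exact inf_cl hinf _ hcl
    · obtain ⟨⟨i, hi⟩, h2⟩ := mem_iUnion.1 h2
      exact hi (cl_disj h2 hcl)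

lemma exists_rho (hinf : infty ∈ S.domain) : ∃ ρ : ℝ, 0 < ρ ∧ ∀ l k, Rd (l ++ [k]) → ∀ u z : ℂ,
    mobius (wd S (l ++ [k]))⁻¹ infty = ofC u → ofC z ∉ S.D k.swap → ρ ≤ dist z u := by
  have h : ∀ k : Lt g, ∃ ρ : ℝ, 0 < ρ ∧ ∀ l, Rd (l ++ [k]) → ∀ u z : ℂ,
    mobius (wd S (l ++ [k]))⁻¹ infty = ofC u → ofC z ∉ S.D k.swap → ρ ≤ dist z u := by
    intro k
    set Y : Set RSphere := {infty} ∪ ⋃ j : {j // j ≠ k}, closure (S.D j) with hY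
    have hYc : IsCompact Y := by
      refine IsClosed.isCompact (isClosed_singleton.union ?_)
      exact isClosed_iUnion_of_finite fun j => isClosed_closure
    have hYD : mobius (tm S k.swap) '' Y ⊆ S.D k.swap := by
      rintro _ ⟨x, hx, rfl⟩
      refine (tm_D hinf _ _).2 fun hcl => ?_
      rw [Sum.swap_swap] at hcl
      rcases hx with h2 | h2
      · rw [h2] at hcl; exact inf_cl hinf _ hcl
      · obtain ⟨⟨i, hi⟩, h2⟩ := mem_iUnion.1 h2
        exact hi (cl_disj h2 hcl)
    have hP : IsCompact (ofC ⁻¹' (mobius (tm S k.swap) '' Y)) := by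
      refine oe_ofC.isInducing.isCompact_preimage' (hYc.image (mob_cont _)) ?_
      rw [range_ofC]
      intro x hx hx'
      rw [hx'] at hx
      exact inf_cl hinf _ (subset_closure (hYD hx))
    obtain ⟨ρ, hρ, hth⟩ := hP.exists_thickening_subset_open ((S.isOpen k.swap).preimage cont_ofC)
      (preimage_mono hYD)
    refine ⟨ρ, hρ, fun l hl u z hu hz => ?_⟩
    by_contra hcon
    push Not at hcon
    refine hz (hth (Metric.mem_thickening_iff.2 ⟨u, ?_, hcon⟩))
    refine ⟨_, word_pole hinf l k hl, ?_⟩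
    rw [← hu, wd_append, wd_single, mul_inv_rev, mob_mul, ← tm_swap]
  choose ρ hρ hh using h
  by_cases hg : Nonempty (Lt g)
  · obtain ⟨k0, hk0⟩ := Finite.exists_min ρ
    exact ⟨ρ k0, hρ k0, fun l k hl u z hu hz => (hk0 k).trans (hh k l hl u z hu hz)⟩
  · exact ⟨1, one_pos, fun l k => (hg ⟨k⟩).elim⟩

/-- explicit formula -/
lemma mob_formula (A : SL2C) (hc : A.1 1 0 ≠ 0) {z : ℂ} (hz : z ≠ -(A.1 1 1) / A.1 1 0) :
    mobius A (ofC z) = ofC (A.1 0 0 / A.1 1 0 - 1 / (A.1 1 0 ^ 2 * (z - -(A.1 1 1) / A.1 1 0))) := by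
  have hd := det_eq A
  have h1 : A.1 1 0 * z + A.1 1 1 ≠ 0 := by
    intro h; apply hz; field_simp; linear_combination h
  rw [mob_C A h1]
  congr 1
  have h2 : A.1 1 0 * (A.1 1 0 * z + A.1 1 1) ≠ 0 := mul_ne_zero hc h1
  have e : A.1 1 0 ^ 2 * (z - -(A.1 1 1) / A.1 1 0) = A.1 1 0 * (A.1 1 0 * z + A.1 1 1) := by
    field_simp; ring
  rw [e, div_sub_div _ _ hc h2, div_eq_div_iff h1 (mul_ne_zero hc h2)]
  linear_combination (-(A.1 1 0 * (A.1 1 0 * z + A.1 1 1))) * hd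

lemma mob_inv_inf (A : SL2C) (hc : A.1 1 0 ≠ 0) : mobius A⁻¹ infty = ofC (-(A.1 1 1) / A.1 1 0) := by
  apply mob_inj A
  rw [mob_mob_inv, mob_pole]
  field_simp; ring

lemma word_c (hinf : infty ∈ S.domain) (l : List (Lt g)) (h : Rd l) (hl : l ≠ []) : (wd S l).1 1 0 ≠ 0 := by
  intro h0
  obtain ⟨j, -, hj⟩ := word_dom hinf l h hl hinf
  rw [mob_inf0 _ h0] at hj
  exact inf_cl hinf _ hj

lemma c_large (hinf : infty ∈ S.domain) (C : ℝ) : ∃ N, ∀ l : List (Lt g), Rd l → N < l.length →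
    C < ‖(wd S l).1 1 0‖ := by
  by_contra hcon
  push Not at hcon
  choose L hL hlen hC using hcon
  have hne : ∀ n, L n ≠ [] := fun n h => by have := hlen n; simp [h] at this
  obtain ⟨R, hR, hRb⟩ := exists_R hinf
  have hc := fun n => word_c hinf (L n) (hL n) (hne n)
  set w : ℕ → ℂ := fun n => (wd S (L n)).1 0 0 / (wd S (L n)).1 1 0 with hw
  have hCpos : 0 < C := lt_of_lt_of_le (norm_pos_iff.2 (hc 0)) (hC 0)
  have hwb : ∀ n, w n ∈ Metric.closedBall (0 : ℂ) R := by
    intro n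
    obtain ⟨j, -, hj⟩ := word_dom hinf _ (hL n) (hne n) hinf
    rw [mob_inf _ (hc n)] at hj
    exact mem_closedBall_zero_iff.2 (hRb j _ hj)
  have hsep : ∀ m n, L m ≠ L n → 1 / (2 * R * C ^ 2) ≤ dist (w n) (w m) := by
    intro m n hmn
    by_contra hlt
    push Not at hlt
    apply hmn
    set A := wd S (L m) with hA
    set c := A.1 1 0 with hcdef
    have hcm : c ≠ 0 := hc m
    by_cases he : w n = w m
    · refine word_inj hinf _ _ (hL m) (hL n) hinf hinf ?_
      rw [mob_inf _ (hc m), mob_inf _ (hc n)]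
      exact congrArg ofC he.symm
    · -- preimage of w n under A
      have he' : w m - w n ≠ 0 := sub_ne_zero.2 (Ne.symm he)
      set z : ℂ := -(A.1 1 1) / c + 1 / (c ^ 2 * (w m - w n)) with hz
      have hzu : z - -(A.1 1 1) / c = 1 / (c ^ 2 * (w m - w n)) := by rw [hz]; ring
      have hz0 : z ≠ -(A.1 1 1) / c := by
        rw [← sub_ne_zero, hzu]
        exact one_div_ne_zero (mul_ne_zero (pow_ne_zero _ hcm) he')
      have hform := mob_formula A hcm hz0
      rw [← hcdef, hzu] at hform
      have e2 : A.1 0 0 / c - 1 / (c ^ 2 * (1 / (c ^ 2 * (w m - w n)))) = w n := by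
        have e3 : w m = A.1 0 0 / c := rfl
        rw [← e3]
        field_simp
        ring
      rw [e2] at hform
      have hzd : ofC z ∈ S.domain := by
        intro hcl
        obtain ⟨k, hk⟩ := mem_iUnion.1 hcl
        have hzR := hRb k z hk
        have hd : ‖-(A.1 1 1) / c‖ ≤ R := by
          have hp := mob_inv_inf A hcm
          obtain ⟨l', k', hlk⟩ : ∃ l' k, L m = l' ++ [k] :=
            ⟨(L m).dropLast, (L m).getLast (hne m), (List.dropLast_append_getLast (hne m)).symm⟩
          have hpole := word_pole hinf l' k' (hlk ▸ hL m)
          have : mobius A⁻¹ infty ∈ S.D k'.swap := by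
            rw [hA, hlk, wd_append, wd_single, mul_inv_rev, mob_mul, ← tm_swap]
            refine (tm_D hinf _ _).2 fun hcl => ?_
            rw [Sum.swap_swap] at hcl
            rcases hpole with h2 | h2
            · rw [h2] at hcl; exact inf_cl hinf _ hcl
            · obtain ⟨⟨i, hi⟩, h2⟩ := mem_iUnion.1 h2
              exact hi (cl_disj h2 hcl)
          rw [hp] at this
          exact hRb _ _ (subset_closure this)
        have h1 : ‖z - -(A.1 1 1) / c‖ ≤ 2 * R := (norm_sub_le _ _).trans (by linarith)
        rw [hzu, norm_div, norm_one, norm_mul, norm_pow] at h1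
        have hcC : ‖c‖ ≤ C := hC m
        have hcp : 0 < ‖c‖ := norm_pos_iff.2 hcm
        have hδ : 0 < ‖w m - w n‖ := norm_pos_iff.2 he'
        rw [dist_comm, dist_eq_norm, lt_div_iff₀ (by positivity)] at hlt
        rw [div_le_iff₀ (by positivity)] at h1
        have : ‖c‖ ^ 2 ≤ C ^ 2 := by gcongr
        have : ‖c‖ ^ 2 * (2 * R * ‖w m - w n‖) ≤ C ^ 2 * (2 * R * ‖w m - w n‖) := by gcongr
        nlinarith
      refine word_inj hinf _ _ (hL m) (hL n) hzd hinf ?_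
      rw [← hA, hform, mob_inf _ (hc n)]
  obtain ⟨a, -, φ, hφ, hlim⟩ := (isCompact_closedBall (0 : ℂ) R).tendsto_subseq hwb
  have hcau := Metric.cauchySeq_iff.1 hlim.cauchySeq (1 / (2 * R * C ^ 2)) (by positivity)
  obtain ⟨N, hN⟩ := hcau
  set m := φ N
  set n' := max N (L m).length
  have h1 := hN N le_rfl n' (le_max_left _ _)
  have h2 : (L m).length < (L (φ n')).length := by
    have := hlen (φ n')
    have := hφ.id_le n'
    have := le_max_right N (L m).length
    simp only [id] at *
    omega
  have h3 := hsep (φ n') m (fun h => by rw [h] at h2; exact lt_irrefl _ h2)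
  exact absurd h1 (not_lt.2 h3)

theorem word_shrink (hinf : infty ∈ S.domain) (ε : ℝ) (hε : 0 < ε) : ∃ N, ∀ (l : List (Lt g)) (k : Lt g),
    Rd (l ++ [k]) → N ≤ l.length → ∀ x y, x ∉ S.D k.swap → y ∉ S.D k.swap →
      dist (mobius (wd S (l ++ [k])) x) (mobius (wd S (l ++ [k])) y) ≤ ε := by
  obtain ⟨R, hR, hRb⟩ := exists_R hinf
  obtain ⟨ρ, hρ, hρb⟩ := exists_rho hinf
  have huc := (isCompact_closedBall (0 : ℂ) R).uniformContinuousOn_of_continuous cont_ofC.continuousOn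
  obtain ⟨δ, hδ, hδb⟩ := Metric.uniformContinuousOn_iff.1 huc ε hε
  obtain ⟨N, hN⟩ := c_large hinf (max 1 (4 / (ρ * δ)))
  refine ⟨N, fun l k hl hlen x y hx hy => ?_⟩
  set A := wd S (l ++ [k]) with hA
  have hcl := hN (l ++ [k]) hl (by simp; omega)
  have hc : A.1 1 0 ≠ 0 := word_c hinf _ hl (by simp)
  set c := A.1 1 0 with hcdef
  have hc1 : 1 < ‖c‖ := lt_of_le_of_lt (le_max_left _ _) hcl
  have hc2 : 4 / (ρ * δ) < ‖c‖ := lt_of_le_of_lt (le_max_right _ _) hcl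
  have hp := mob_inv_inf A hc
  have key : ∀ x, x ∉ S.D k.swap → ∃ v : ℂ, mobius A x = ofC v ∧ v ∈ Metric.closedBall (0 : ℂ) R ∧
      ‖v - A.1 0 0 / c‖ < δ / 2 := by
    intro x hx
    have hR' : ∀ v, mobius A x = ofC v → v ∈ Metric.closedBall (0 : ℂ) R := by
      intro v hv
      obtain ⟨j, -, hj⟩ := word_img hinf l k hl hx
      rw [← hA, hv] at hj
      exact mem_closedBall_zero_iff.2 (hRb _ _ hj)
    rcases rs_cases x with rfl | ⟨z, rfl⟩
    · exact ⟨_, mob_inf A hc, hR' _ (mob_inf A hc), by rw [← hcdef, sub_self, norm_zero]; linarith⟩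
    · have h1 := hρb l k hl _ z hp hx
      have hz0 : z ≠ -(A.1 1 1) / c := fun h => by rw [h, dist_self] at h1; linarith
      have hf := mob_formula A hc hz0
      refine ⟨_, hf, hR' _ hf, ?_⟩
      rw [← hcdef, sub_sub_cancel_left, norm_neg, norm_div, norm_one, norm_mul, norm_pow, ← dist_eq_norm]
      have hd0 : 0 < dist z (-(A.1 1 1) / c) := lt_of_lt_of_le hρ h1
      rw [div_lt_iff₀ (by positivity)]
      rw [div_lt_iff₀ (by positivity)] at hc2
      have h2 : ‖c‖ * (ρ * δ) ≤ ‖c‖ ^ 2 * (ρ * δ) := by gcongr; nlinarith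
      have h3 : ‖c‖ ^ 2 * (ρ * δ) ≤ ‖c‖ ^ 2 * (dist z (-(A.1 1 1) / c) * δ) := by gcongr
      nlinarith
  obtain ⟨v, hv, hvR, hvd⟩ := key x hx
  obtain ⟨v', hv', hvR', hvd'⟩ := key y hy
  rw [hv, hv']
  refine (hδb v hvR v' hvR' ?_).le
  rw [dist_eq_norm]
  calc ‖v - v'‖ = ‖(v - A.1 0 0 / c) - (v' - A.1 0 0 / c)‖ := by congr 1; ring
    _ ≤ _ := norm_sub_le _ _
    _ < δ := by linarith

end TQ


namespace TQ

variable {g : ℕ} {S : SchottkyData g}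

structure Pts (S : SchottkyData g) (x1 : RSphere) where
  P : Lt g → Bool → ℂ
  P' : Lt g → Bool → ℂ
  C : Lt g → Bool → Set ℂ
  h : Lt g → ℝ → RSphere
  ν : Fin g → ℂ
  fr : ∀ k b, ofC (P k b) ∈ frontier (S.D k)
  ne : ∀ k, P k false ≠ P k true
  T : ∀ k b, mobius (tm S k) (ofC (P k.swap b)) = ofC (P k (!b))
  arc : ∀ k b, Arc (C k b) (P k b) (P' k b)
  off : ∀ k b j z, z ∈ C k b → ofC z ∈ closure (S.D j) → z = P k b
  hc : ∀ k, ContinuousOn (h k) (Icc 0 1)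
  hK : ∀ k, ∀ s ∈ Icc (0 : ℝ) 1, h k s ∈ closure (S.D k)
  h0 : ∀ k, h k 0 = ofC (P k false)
  h1 : ∀ k, h k 1 = ofC (P k true)
  νne : ∀ i, ν i ≠ 0
  orb : ∀ k b (γ : SL2C), (γ : PSL2C) ∈ S.group → mobius γ (ofC (P k b)) ≠ x1
  orth1 : ∀ i b, ∀ᶠ t : ℝ in 𝓝 0, ofC (P (Sum.inl i) b + t * ν i) ∈ ofC '' C (Sum.inl i) b ∨
    mobius (tm S (Sum.inr i)) (ofC (P (Sum.inl i) b + t * ν i)) ∈ ofC '' C (Sum.inr i) (!b)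
  orth2 : ∀ i b, ∀ᶠ t : ℝ in 𝓝 0, ofC (P (Sum.inl i) b + t * (Complex.I * ν i)) ∈ frontier (S.D (Sum.inl i))

lemma collar (hinf : infty ∈ S.domain) (k : Lt g) (c : ℝ → RSphere) (ε : ℝ) (hε : 0 < ε)
    (hc : ContinuousOn c (Icc 0 ε)) (hi : InjOn c (Icc 0 ε)) (h0 : c 0 ∈ closure (S.D k))
    (ho : ∀ t ∈ Ioc 0 ε, c t ∉ closure (S.D k)) (y : ℂ) (hy : c 0 = ofC y) :
    ∃ δ, 0 < δ ∧ δ ≤ ε ∧ ∃ (y' : ℂ) (C : Set ℂ), Arc C y y' ∧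
      (∀ j z, z ∈ C → ofC z ∈ closure (S.D j) → z = y) ∧
      ∀ t ∈ Icc 0 δ, c t ∈ ofC '' C := by
  set O : Set RSphere := ({infty} ∪ ⋃ j : {j // j ≠ k}, closure (S.D j))ᶜ with hO
  have hOo : IsOpen O := by
    refine IsClosed.isOpen_compl (self := isClosed_singleton.union ?_)
    exact isClosed_iUnion_of_finite fun j => isClosed_closure
  have h0O : c 0 ∈ O := by
    rintro (h | h)
    · rw [mem_singleton_iff, hy] at h; exact ofC_ne_inf _ h
    · obtain ⟨⟨j, hj⟩, h⟩ := mem_iUnion.1 h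
      exact hj (cl_disj h h0)
  have hev : ∀ᶠ t in 𝓝[Icc 0 ε] (0 : ℝ), c t ∈ O :=
    hc 0 ⟨le_rfl, hε.le⟩ (hOo.mem_nhds h0O)
  obtain ⟨δ0, hδ0, hδ⟩ := Metric.mem_nhdsWithin_iff.1 hev
  refine ⟨min ε (δ0 / 2), lt_min hε (by linarith), min_le_left _ _, ?_⟩
  set δ := min ε (δ0 / 2) with hδd
  have hδp : 0 < δ := lt_min hε (by linarith)
  have hsub : Icc 0 δ ⊆ Icc 0 ε := Icc_subset_Icc_right (min_le_left _ _)
  have hin : ∀ t ∈ Icc 0 δ, c t ∈ O := by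
    intro t ht
    refine hδ ⟨?_, hsub ht⟩
    rw [Metric.mem_ball, Real.dist_eq, sub_zero, abs_of_nonneg ht.1]
    have := min_le_right ε (δ0 / 2)
    linarith [ht.2]
  have hf : ∀ t ∈ Icc 0 δ, ∃ z, ofC z = c t := by
    intro t ht
    rcases rs_cases (c t) with h | ⟨z, hz⟩
    · exact absurd (Or.inl h) (hin t ht)
    · exact ⟨z, hz.symm⟩
  choose! f hf using hf
  have hfc : ContinuousOn f (Icc 0 δ) := by
    rw [oe_ofC.isInducing.continuousOn_iff]
    exact (hc.mono hsub).congr fun t ht => hf t ht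
  have hfi : InjOn f (Icc 0 δ) := by
    intro s hs t ht e
    refine hi (hsub hs) (hsub ht) ?_
    rw [← hf s hs, ← hf t ht, e]
  have hf0 : f 0 = y := ofC_inj ((hf 0 ⟨le_rfl, hδp.le⟩).trans hy)
  refine ⟨f δ, f '' Icc 0 δ, ?_, ?_, ?_⟩
  · have := arc_of_Icc hδp hfc hfi
    rwa [hf0] at this
  · rintro j _ ⟨t, ht, rfl⟩ hcl
    rw [hf t ht] at hcl
    rcases ht.1.eq_or_lt with h | h
    · rw [← h, hf0]
    · exfalso
      by_cases hjk : j = k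
      · subst hjk
        exact ho t ⟨h, (hsub ht).2⟩ hcl
      · exact hin t ht (Or.inr (mem_iUnion.2 ⟨⟨j, hjk⟩, hcl⟩))
  · intro t ht
    exact ⟨f t, ⟨t, ht, rfl⟩, hf t ht⟩

lemma pick {B : Set ℝ} (hB : B.Countable) {a b : ℝ} (hab : a < b) : ∃ s ∈ Ioo a b, s ∉ B := by
  obtain ⟨s, hs⟩ := (hB.dense_compl ℝ).inter_open_nonempty _ isOpen_Ioo (nonempty_Ioo.2 hab)
  exact ⟨s, hs.1, hs.2⟩

theorem exists_pts (hinf : infty ∈ S.domain) (x1 : RSphere)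
    (hS : ∀ i, ∃ (F : ℝ → ℂ) (z0 ν : ℂ) (ε : ℝ),
      Loop F ∧ (In (range F)).Nonempty ∧ S.D (Sum.inl i) = ofC '' In (range F) ∧
      frontier (S.D (Sum.inl i)) = ofC '' range F ∧ ν ≠ 0 ∧ 0 < ε ∧ Edge F z0 ν ε) :
    Nonempty (Pts S x1) := by
  choose F z0 ν ε hF hne hD hfr hν hε hE using hS
  have hinj : ∀ i, Function.Injective fun s : ℝ => ofC (z0 i + s * (Complex.I * ν i)) := by
    intro i s t e
    have e1 := ofC_inj e
    have e2 : (s : ℂ) * (Complex.I * ν i) = t * (Complex.I * ν i) := by linear_combination e1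
    have := mul_right_cancel₀ (mul_ne_zero Complex.I_ne_zero (hν i)) e2
    exact_mod_cast this
  have hbad : ∀ i, {s : ℝ | ofC (z0 i + s * (Complex.I * ν i)) ∈ mobiusOrbit S.group x1}.Countable := fun i =>
    (orbit_countable S x1).preimage (hinj i)
  choose s0 hs0 hs0' using fun i => pick (hbad i) (a := -(ε i / 2)) (b := 0) (by linarith [hε i])
  choose s1 hs1 hs1' using fun i => pick (hbad i) (a := 0) (b := ε i / 2) (by linarith [hε i])
  let s : Fin g → Bool → ℝ := fun i b => bif b then s1 i else s0 i
  have hs : ∀ i b, |s i b| < ε i / 2 := by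
    rintro i (_ | _)
    · exact abs_lt.2 ⟨(hs0 i).1, (hs0 i).2.trans (by linarith [hε i])⟩
    · exact abs_lt.2 ⟨lt_trans (by linarith [hε i]) (hs1 i).1, (hs1 i).2⟩
  let y : Fin g → Bool → ℂ := fun i b => z0 i + s i b * (Complex.I * ν i)
  have hyorb : ∀ i b, ofC (y i b) ∉ mobiusOrbit S.group x1 := by
    rintro i (_ | _)
    · exact hs0' i
    · exact hs1' i
  have hedge : ∀ i b (u t : ℝ), |u| < ε i / 2 → |t| < ε i →
      (t = 0 → y i b + u * (Complex.I * ν i) + t * ν i ∈ range (F i)) ∧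
      (0 < t → y i b + u * (Complex.I * ν i) + t * ν i ∈ Out (range (F i))) ∧
      (t < 0 → y i b + u * (Complex.I * ν i) + t * ν i ∈ In (range (F i))) := by
    intro i b u t hu ht
    have := hE i (s i b + u) t ((abs_add_le _ _).trans_lt (by linarith [hs i b])) ht
    have e : y i b + u * (Complex.I * ν i) + t * ν i =
        z0 i + ((s i b + u : ℝ) : ℂ) * (Complex.I * ν i) + t * ν i := by
      simp only [y]; push_cast; ring
    rw [e]; exact this
  have hedge0 : ∀ i b (t : ℝ), |t| < ε i →
      (t = 0 → y i b + t * ν i ∈ range (F i)) ∧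
      (0 < t → y i b + t * ν i ∈ Out (range (F i))) ∧
      (t < 0 → y i b + t * ν i ∈ In (range (F i))) := by
    intro i b t ht
    have := hedge i b 0 t (by simpa using hε i) ht
    simpa using this
  have hyF : ∀ i b, y i b ∈ range (F i) := by
    intro i b
    simpa using (hedge0 i b 0 (by simpa using hε i)).1 rfl
  have hclF : ∀ i, closure (S.D (Sum.inl i)) = ofC '' (In (range (F i)) ∪ range (F i)) := by
    intro i; rw [hD, frontier_ofC_In (hF i) (hne i)]
  have hyfr : ∀ i b, ofC (y i b) ∈ frontier (S.D (Sum.inl i)) := by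
    intro i b; rw [hfr]; exact ⟨_, hyF i b, rfl⟩
  have hTfr : ∀ i b, mobius (tm S (Sum.inr i)) (ofC (y i b)) ∈ frontier (S.D (Sum.inr i)) := by
    intro i b
    rw [← tm_fr (S := S) (Sum.inr i)]
    exact ⟨_, hyfr i b, rfl⟩
  have hw : ∀ i b, ∃ w, mobius (tm S (Sum.inr i)) (ofC (y i (!b))) = ofC w := by
    intro i b
    rcases rs_cases (mobius (tm S (Sum.inr i)) (ofC (y i (!b)))) with h | h
    · have := hTfr i (!b)
      rw [h] at this
      exact absurd (frontier_subset_closure this) (inf_cl hinf _)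
    · exact h
  choose w hw using hw
  let P : Lt g → Bool → ℂ := fun k b => k.elim (fun i => y i b) (fun i => w i b)
  have hyne : ∀ i, y i false ≠ y i true := by
    intro i h
    have := hinj i (a₁ := s0 i) (a₂ := s1 i) (congrArg ofC h)
    have h1 := (hs0 i).2
    have h2 := (hs1 i).1
    linarith
  -- collars
  have linj : ∀ i b (σ : ℝ), σ ≠ 0 → Function.Injective fun t : ℝ => ofC (y i b + (σ * t : ℝ) * ν i) := by
    intro i b σ hσ t t' e
    have e1 := ofC_inj e
    have e2 : ((σ * t : ℝ) : ℂ) * ν i = ((σ * t' : ℝ) : ℂ) * ν i := by linear_combination e1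
    have := mul_right_cancel₀ (hν i) e2
    have h3 : σ * t = σ * t' := by exact_mod_cast this
    exact mul_left_cancel₀ hσ h3
  have lcont : ∀ i b (σ : ℝ), Continuous fun t : ℝ => ofC (y i b + (σ * t : ℝ) * ν i) := by
    intro i b σ
    exact cont_ofC.comp (by fun_prop)
  have col : ∀ (k : Lt g) (b : Bool), ∃ δ, 0 < δ ∧ ∃ (y' : ℂ) (C : Set ℂ), Arc C (P k b) y' ∧
      (∀ j z, z ∈ C → ofC z ∈ closure (S.D j) → z = P k b) ∧
      ∀ t ∈ Icc 0 δ, k.elim (fun i => ofC (y i b + (1 * t : ℝ) * ν i))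
        (fun i => mobius (tm S (Sum.inr i)) (ofC (y i (!b) + (-1 * t : ℝ) * ν i))) ∈ ofC '' C := by
    rintro (i | i) b
    · have := collar hinf (Sum.inl i) (fun t : ℝ => ofC (y i b + (1 * t : ℝ) * ν i)) (ε i / 2)
        (by linarith [hε i]) (lcont i b 1).continuousOn (linj i b 1 one_ne_zero).injOn
        (by simpa using frontier_subset_closure (hyfr i b))
        (by
          intro t ht hcl
          rw [hclF, ofC_inj.mem_set_image] at hcl
          have h2 := (hedge0 i b (1 * t) (by rw [one_mul, abs_of_pos ht.1]; linarith [ht.2, hε i])).2.1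
            (by linarith [ht.1])
          rcases hcl with h | h
          · exact disj_In_Out _ h h2
          · exact h2.1 h)
        (y i b) (by simp)
      obtain ⟨δ, h1, -, y', C, h2⟩ := this
      exact ⟨δ, h1, y', C, h2⟩
    · have := collar hinf (Sum.inr i)
        (fun t : ℝ => mobius (tm S (Sum.inr i)) (ofC (y i (!b) + (-1 * t : ℝ) * ν i))) (ε i / 2)
        (by linarith [hε i]) ((mob_cont _).comp (lcont i (!b) (-1))).continuousOn
        ((mob_inj _).comp (linj i (!b) (-1) (by norm_num))).injOn
        (by simpa using frontier_subset_closure (hTfr i (!b)))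
        (by
          intro t ht hcl
          rw [tm_cl hinf] at hcl
          apply hcl
          show _ ∈ S.D (Sum.inl i)
          rw [hD]
          exact ⟨_, (hedge0 i (!b) (-1 * t) (by
            rw [abs_mul, abs_neg, abs_one, one_mul, abs_of_pos ht.1]; linarith [ht.2, hε i])).2.2
            (by linarith [ht.1]), rfl⟩)
        (w i b) (by simpa using hw i b)
      obtain ⟨δ, h1, -, y', C, h2⟩ := this
      exact ⟨δ, h1, y', C, h2⟩
  choose δ hδ P' C harc hoff hcol using col
  let hl : Fin g → ℝ → RSphere := fun i t => ofC (AffineMap.lineMap (y i false) (y i true) t)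
  have hlc : ∀ i, Continuous (hl i) := fun i => cont_ofC.comp AffineMap.lineMap_continuous
  have hlF : ∀ i, ∀ t ∈ Icc (0 : ℝ) 1, hl i t ∈ frontier (S.D (Sum.inl i)) := by
    intro i t ht
    rw [hfr]
    refine ⟨_, ?_, rfl⟩
    have e : AffineMap.lineMap (y i false) (y i true) t =
        z0 i + ((s0 i + t * (s1 i - s0 i) : ℝ) : ℂ) * (Complex.I * ν i) + (0 : ℝ) * ν i := by
      rw [AffineMap.lineMap_apply]
      simp only [y, s, cond_false, cond_true, vsub_eq_sub, vadd_eq_add, Complex.real_smul]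
      push_cast; ring
    rw [e]
    have a1 := (hs0 i).1
    have a2 := (hs0 i).2
    have a3 := (hs1 i).1
    have a4 := (hs1 i).2
    refine (hE i _ 0 ?_ (by simpa using hε i)).1 rfl
    rw [abs_lt]
    constructor
    · nlinarith [ht.1, ht.2, hε i]
    · nlinarith [ht.1, ht.2, hε i]
  refine ⟨{
    P := P, P' := P', C := C, ν := ν
    h := fun k t => k.elim (fun i => hl i t) (fun i => mobius (tm S (Sum.inr i)) (hl i (1 - t)))
    fr := ?_, ne := ?_, T := ?_, arc := harc, off := hoff, hc := ?_, hK := ?_, h0 := ?_, h1 := ?_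
    νne := hν, orb := ?_, orth1 := ?_, orth2 := ?_ }⟩
  · rintro (i | i) b
    · exact hyfr i b
    · show ofC (w i b) ∈ _
      rw [← hw]; exact hTfr i _
  · rintro (i | i)
    · exact hyne i
    · intro h
      have h' : w i false = w i true := h
      have := congrArg ofC h'
      rw [← hw, ← hw] at this
      exact hyne i (ofC_inj (mob_inj _ this)).symm
  · rintro (i | i) b
    · show mobius (tm S (Sum.inl i)) (ofC (w i b)) = ofC (y i (!b))
      rw [← hw]
      exact tm_tm S (Sum.inr i) _
    · show mobius (tm S (Sum.inr i)) (ofC (y i b)) = ofC (w i (!b))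
      rw [← hw, Bool.not_not]
  · rintro (i | i)
    · exact (hlc i).continuousOn
    · exact ((mob_cont _).comp ((hlc i).comp (by fun_prop))).continuousOn
  · rintro (i | i) t ht
    · exact frontier_subset_closure (hlF i t ht)
    · refine frontier_subset_closure ?_
      rw [← tm_fr (S := S) (Sum.inr i)]
      exact ⟨_, hlF i (1 - t) ⟨by linarith [ht.2], by linarith [ht.1]⟩, rfl⟩
  · rintro (i | i)
    · simp [hl, P]
    · have := hw i false
      simpa [hl, P] using this
  · rintro (i | i)
    · simp [hl, P]
    · have := hw i true
      simpa [hl, P] using this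
  · have key : ∀ i b (γ : SL2C), (γ : PSL2C) ∈ S.group → mobius γ (ofC (y i b)) ≠ x1 := by
      intro i b γ hγ h
      refine hyorb i b ⟨γ⁻¹, ?_, ?_⟩
      · have := S.group.inv_mem hγ
        simpa using this
      · rw [← h, mob_inv_mob]
    rintro (i | i) b γ hγ
    · exact key i b γ hγ
    · show mobius γ (ofC (w i b)) ≠ x1
      rw [← hw, ← mob_mul]
      refine key i _ _ ?_
      have := S.group.mul_mem hγ (tm_mem S (Sum.inr i))
      simpa using this
  · intro i b
    have h1 : ∀ᶠ t : ℝ in 𝓝 0, |t| < min (δ (Sum.inl i) b) (δ (Sum.inr i) (!b)) := by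
      have := Metric.ball_mem_nhds (0 : ℝ) (lt_min (hδ (Sum.inl i) b) (hδ (Sum.inr i) (!b)))
      filter_upwards [this] with t ht
      simpa [Real.dist_eq] using ht
    filter_upwards [h1] with t ht
    have ht1 := ht.trans_le (min_le_left _ _)
    have ht2 := ht.trans_le (min_le_right _ _)
    rcases le_or_gt 0 t with h | h
    · left
      rw [abs_of_nonneg h] at ht1
      have := hcol (Sum.inl i) b t ⟨h, ht1.le⟩
      simpa [P] using this
    · right
      rw [abs_of_neg h] at ht2
      have := hcol (Sum.inr i) (!b) (-t) ⟨by linarith, ht2.le⟩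
      simpa [P] using this
  · intro i b
    have h1 := Metric.ball_mem_nhds (0 : ℝ) (show 0 < ε i / 2 by linarith [hε i])
    filter_upwards [h1] with t ht
    rw [hfr]
    refine ⟨_, ?_, rfl⟩
    have := (hedge i b t 0 (by simpa [Real.dist_eq] using ht) (by simpa using hε i)).1 rfl
    simpa [P] using this

end TQ


namespace TQ

variable {g : ℕ} {S : SchottkyData g}

lemma In_filled {f : ℝ → ℂ} (hf : Loop f) (hne : (In (range f)).Nonempty) :
    In (In (range f) ∪ range f) = ∅ := by
  set K := In (range f) ∪ range f with hK
  have hKc : IsCompact K := by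
    rw [hK, ← hf.closure_In hne]
    exact (In_bounded hf.isCompact).isCompact_closure
  have hcomp : Kᶜ ⊆ Out (range f) := by
    intro z hz
    rcases mem_trichotomy (range f) z with h | h | h
    · exact absurd (Or.inr h) hz
    · exact absurd (Or.inl h) hz
    · exact h
  have hOut : Out (range f) ⊆ Kᶜ := by
    rintro z hz (h | h)
    · exact disj_In_Out _ h hz
    · exact hz.1 h
  rcases preconnected_In_or_Out hKc.isClosed (isPreconnected_Out hf.isCompact) hOut with h | h
  · exfalso
    have h1 : Bornology.IsBounded (Out (range f)) := (In_bounded hKc).subset h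
    have h2 := h1.union (Out_cobounded hf.isCompact)
    rw [union_compl_self] at h2
    exact NormedSpace.unbounded_univ ℝ ℂ h2
  · rw [eq_empty_iff_forall_notMem]
    intro z hz
    exact disj_In_Out _ hz (h (hcomp hz.1))

theorem exists_cyc (hinf : infty ∈ S.domain) {x1 : RSphere} (Q : Pts S x1) (hg : 1 ≤ g) :
    ∃ (n : ℕ) (E : ZMod n ≃ Lt g) (Y : Cyc n RSphere), (∀ k, Y.b k = E.symm (E k).swap) ∧
      (∀ k, Y.T k = mobius (tm S (E k))) ∧ (∀ k, Y.K k = closure (S.D (E k))) ∧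
      (∀ k, Y.p k = ofC (Q.P (E k) false)) ∧ (∀ k, Y.q k = ofC (Q.P (E k) true)) ∧
      ∀ k b, ∀ᶠ X in 𝓝 (ofC (Q.P (E k) b)), X ∈ ofC '' Q.C (E k) b → ∃ j, X ∈ Y.e j '' Icc 0 1 := by
  obtain ⟨n, hn⟩ : ∃ n, n = 2 * g := ⟨_, rfl⟩
  have hn2 : 2 ≤ n := by omega
  haveI : NeZero n := ⟨by omega⟩
  have hcard : Fintype.card (ZMod n) = Fintype.card (Lt g) := by
    rw [ZMod.card, hn]; simp [Lt]; ring
  let E : ZMod n ≃ Lt g := Fintype.equivOfCardEq hcard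
  let K : ℕ → Set ℂ := fun i => ofC ⁻¹' closure (S.D (E (i : ZMod n)))
  have castinj : ∀ i < n, ∀ j < n, ((i : ℕ) : ZMod n) = (j : ZMod n) → i = j := by
    intro i hi j hj h
    have := congrArg ZMod.val h
    rwa [ZMod.val_natCast_of_lt hi, ZMod.val_natCast_of_lt hj] at this
  have hfill : ∀ k, ∃ f : ℝ → ℂ, Loop f ∧ (In (range f)).Nonempty ∧
      ofC ⁻¹' closure (S.D k) = In (range f) ∪ range f := by
    intro k
    obtain ⟨f, hf, hne, hD, -⟩ := disc hinf k
    refine ⟨f, hf, hne, ?_⟩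
    rw [hD, frontier_ofC_In hf hne, ofC_inj.preimage_image]
  have hoff : ∀ i b, Q.C (E (i : ZMod n)) b ∩ (⋃ j ∈ Iio n, K j) ⊆ {Q.P (E (i : ZMod n)) b} := by
    rintro i b z ⟨hz, hz'⟩
    simp only [mem_iUnion] at hz'
    obtain ⟨j, -, hj⟩ := hz'
    exact Q.off _ _ _ z hz hj
  obtain ⟨e, he⟩ := connecting_arcs n hn2 K (fun i => Q.P (E (i : ZMod n)) true)
    (fun i => Q.P (E (i : ZMod n)) false) (fun i => Q.P' (E (i : ZMod n)) true)
    (fun i => Q.P' (E (i : ZMod n)) false) (fun i => Q.C (E (i : ZMod n)) true)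
    (fun i => Q.C (E (i : ZMod n)) false)
    (by
      intro i hi
      obtain ⟨f, hf, hne, h⟩ := hfill (E (i : ZMod n))
      show IsCompact (ofC ⁻¹' closure (S.D (E (i : ZMod n))))
      rw [h, ← hf.closure_In hne]
      exact (In_bounded hf.isCompact).isCompact_closure)
    (by
      intro i hi j hj hij
      refine Set.disjoint_left.2 fun z h1 h2 => hij ?_
      exact castinj i hi j hj (E.injective (cl_disj h1 h2)))
    (by
      intro i hi
      obtain ⟨f, hf, hne, h⟩ := hfill (E (i : ZMod n))
      show In (ofC ⁻¹' closure (S.D (E (i : ZMod n)))) = ∅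
      rw [h]; exact In_filled hf hne)
    (fun i _ => frontier_subset_closure (Q.fr _ _)) (fun i _ => frontier_subset_closure (Q.fr _ _))
    (fun i _ => (Q.ne _).symm) (fun i _ => Q.arc _ _) (fun i _ => Q.arc _ _)
    (fun i _ => hoff i _) (fun i _ => hoff i _)
  have hsucc : ∀ k : ZMod n, (((k.val + 1) % n : ℕ) : ZMod n) = k + 1 := by
    intro k; rw [ZMod.natCast_mod]; push_cast; rw [ZMod.natCast_zmod_val]
  have hval : ∀ k : ZMod n, ((k.val : ℕ) : ZMod n) = k := fun k => ZMod.natCast_zmod_val k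
  have hA := fun k : ZMod n => (he k.val (ZMod.val_lt k)).1
  simp only [hsucc, hval] at hA
  choose f fc fi f0 f1 fA using hA
  have hmem : ∀ k : ZMod n, ∀ s ∈ Icc (0 : ℝ) 1, f k s ∈ e k.val := by
    intro k s hs; rw [fA k]; exact ⟨s, hs, rfl⟩
  let Y : Cyc n RSphere :=
    { b := fun k => E.symm (E k).swap
      T := fun k => mobius (tm S (E k))
      e := fun k s => ofC (f k s)
      h := fun k => Q.h (E k)
      p := fun k => ofC (Q.P (E k) false)
      q := fun k => ofC (Q.P (E k) true)
      K := fun k => closure (S.D (E k))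
      hn := hn2
      bb := fun k => by simp
      TT := fun k x => by simp [tm_tm]
      Tc := fun k => mob_cont _
      ec := fun k => cont_ofC.comp_continuousOn (fc k)
      einj := fun k => ofC_inj.comp_injOn (fi k)
      e0 := fun k => by rw [f0]
      e1 := fun k => by rw [f1]
      eK := by
        intro k j s hs hsK
        have h1 := (he k.val (ZMod.val_lt k)).2.1
        have h2 : f k s ∈ e k.val ∩ ⋃ j ∈ Iio n, K j := by
          refine ⟨hmem k s hs, ?_⟩
          simp only [mem_iUnion]
          refine ⟨j.val, ZMod.val_lt j, ?_⟩
          show ofC (f k s) ∈ closure (S.D (E ((j.val : ℕ) : ZMod n)))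
          rw [hval]; exact hsK
        rw [h1] at h2
        simp only [hsucc, hval] at h2
        rcases h2 with h2 | h2
        · left
          have h3 : s = 0 := fi k hs ⟨le_rfl, zero_le_one⟩ (h2.trans (f0 k).symm)
          refine ⟨h3, ?_⟩
          rw [h2] at hsK
          exact E.injective (cl_disj hsK (frontier_subset_closure (Q.fr (E k) true)))
        · right
          have h2' : f k s = Q.P (E (k + 1)) false := h2
          have h3 : s = 1 := fi k hs ⟨zero_le_one, le_rfl⟩ (h2'.trans (f1 k).symm)
          refine ⟨h3, ?_⟩
          rw [h2'] at hsK
          exact E.injective (cl_disj hsK (frontier_subset_closure (Q.fr (E (k + 1)) false)))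
      ee := by
        intro k j s hs t ht h
        by_contra hkj
        have h1 := (he k.val (ZMod.val_lt k)).2.2.2.2 j.val (ZMod.val_lt j)
          (fun h => hkj (ZMod.val_injective n h).symm)
        refine Set.disjoint_left.1 h1 (hmem k s hs) ?_
        rw [ofC_inj h]; exact hmem j t ht
      pK := fun k => frontier_subset_closure (Q.fr _ _)
      qK := fun k => frontier_subset_closure (Q.fr _ _)
      pq := fun k h => Q.ne _ (ofC_inj h)
      KK := fun k j x h1 h2 => E.injective (cl_disj h1 h2)
      Kc := fun k => isClosed_closure
      TK := fun k x hx => by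
        rw [Equiv.apply_symm_apply] at hx
        exact subset_closure ((tm_D hinf _ _).2 hx)
      Tq := fun k => by
        rw [Equiv.apply_symm_apply, Q.T]; rfl
      Tp := fun k => by
        rw [Equiv.apply_symm_apply, Q.T]; rfl
      hc := fun k => Q.hc _
      hK := fun k => Q.hK _
      h0 := fun k => Q.h0 _
      h1 := fun k => Q.h1 _ }
  refine ⟨n, E, Y, fun _ => rfl, fun _ => rfl, fun _ => rfl, fun _ => rfl, fun _ => rfl, ?_⟩
  have push : ∀ (z : ℂ) (C : Set ℂ) (j : ZMod n), (∀ᶠ x in 𝓝 z, x ∈ C → x ∈ e j.val) →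
      ∀ᶠ X in 𝓝 (ofC z), X ∈ ofC '' C → ∃ j, X ∈ Y.e j '' Icc 0 1 := by
    intro z C j h
    rw [← oe_ofC.map_nhds_eq, eventually_map]
    filter_upwards [h] with x hx hxC
    rw [ofC_inj.mem_set_image] at hxC
    have := hx hxC
    rw [fA j] at this
    obtain ⟨s, hs, hs'⟩ := this
    exact ⟨j, s, hs, congrArg ofC hs'⟩
  rintro k (_ | _)
  · refine push _ _ (k - 1) ?_
    have := (he (k - 1).val (ZMod.val_lt _)).2.2.2.1
    simp only [hsucc, sub_add_cancel] at this
    exact this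
  · refine push _ _ k ?_
    have := (he k.val (ZMod.val_lt _)).2.2.1
    simp only [hval] at this
    exact this

end TQ


namespace TQ

variable {g : ℕ} {S : SchottkyData g}

lemma exists_reduced (l : List (Lt g)) : ∃ l', Rd l' ∧ wd S l' = wd S l := by
  induction l with
  | nil => exact ⟨[], List.IsChain.nil, rfl⟩
  | cons a l ih =>
    obtain ⟨m, hm, e⟩ := ih
    by_cases h : ∀ b ∈ m.head?, b ≠ a.swap
    · exact ⟨a :: m, List.isChain_cons.2 ⟨h, hm⟩, by show tm S a * wd S m = tm S a * wd S l; rw [e]⟩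
    · push Not at h
      obtain ⟨b, hb, rfl⟩ := h
      rcases m with _ | ⟨c, m⟩
      · simp at hb
      · simp at hb
        subst hb
        refine ⟨m, (List.isChain_cons.1 hm).2, ?_⟩
        show wd S m = tm S a * wd S l
        rw [← e]
        show wd S m = tm S a * (tm S a.swap * wd S m)
        rw [tm_swap]; group

lemma exists_rwd {γ : SL2C} (h : (γ : PSL2C) ∈ S.group) :
    ∃ l, Rd l ∧ ∀ x, mobius γ x = mobius (wd S l) x := by
  obtain ⟨l, hl⟩ := exists_wd S h
  obtain ⟨l', h', e⟩ := exists_reduced (S := S) l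
  exact ⟨l', h', fun x => by rw [hl, e]⟩

lemma last_cases (l : List (Lt g)) : l = [] ∨ ∃ m k, l = m ++ [k] := by
  by_cases hl : l = []
  · exact Or.inl hl
  · exact Or.inr ⟨l.dropLast, l.getLast hl, (List.dropLast_append_getLast hl).symm⟩

lemma fr_notMem {k : Lt g} {y : RSphere} (hy : y ∈ frontier (S.D k)) (j : Lt g) : y ∉ S.D j := by
  intro h
  have hk : y ∈ closure (S.D k) := frontier_subset_closure hy
  obtain rfl := cl_disj hk (subset_closure h)
  rw [(S.isOpen k).frontier_eq] at hy
  exact hy.2 h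

lemma inf_OB (hinf : infty ∈ S.domain) : infty ∉ S.orbitBoundary := by
  intro h
  rw [SchottkyData.orbitBoundary, mem_iUnion] at h
  obtain ⟨⟨γ, hγ⟩, y, hy, e⟩ := h
  obtain ⟨k, hy⟩ := mem_iUnion.1 hy
  obtain ⟨l, hl, el⟩ := exists_rwd hγ
  simp only [el] at e
  rcases last_cases l with rfl | ⟨m, j, rfl⟩
  · have : y = infty := by rw [← e]; exact (mob_one y).symm
    exact inf_cl hinf k (this ▸ frontier_subset_closure hy)
  · obtain ⟨i, -, hi⟩ := word_img hinf m j hl (fr_notMem hy _)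
    rw [e] at hi
    exact inf_cl hinf i hi

/-- descent -/
lemma descent (hinf : infty ∈ S.domain) (z : RSphere) (N : ℕ) :
    (∃ γ : SL2C, (γ : PSL2C) ∈ S.group ∧ ∀ k, mobius γ z ∉ S.D k) ∨
    ∃ l k x, Rd (l ++ [k]) ∧ l.length = N ∧ x ∉ S.D k.swap ∧ z = mobius (wd S (l ++ [k])) x := by
  have step : ∀ j x, x ∈ S.D j → ∃ y, y ∉ S.D j.swap ∧ x = mobius (tm S j) y := by
    intro j x hx
    have e : mobius (tm S j) (mobius (tm S j.swap) x) = x := by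
      have := tm_tm S j.swap x
      rwa [Sum.swap_swap] at this
    refine ⟨mobius (tm S j.swap) x, fun h => ?_, e.symm⟩
    have := (tm_D hinf j (mobius (tm S j.swap) x)).1 (by rw [e]; exact hx)
    exact this (subset_closure h)
  induction N with
  | zero =>
    by_cases h : ∃ k, z ∈ S.D k
    · obtain ⟨k, hk⟩ := h
      obtain ⟨y, hy, e⟩ := step k z hk
      exact Or.inr ⟨[], k, y, List.IsChain.singleton _, rfl, hy, by
        rw [List.nil_append, wd_single]; exact e⟩
    · push Not at h
      exact Or.inl ⟨1, by simpa using S.group.one_mem, by simpa [mob_one] using h⟩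
  | succ N ih =>
    rcases ih with ih | ⟨l, k, x, hl, hN, hx, e⟩
    · exact Or.inl ih
    by_cases h : ∃ j, x ∈ S.D j
    · obtain ⟨j, hj⟩ := h
      obtain ⟨y, hy, e'⟩ := step j x hj
      refine Or.inr ⟨l ++ [k], j, y, ?_, by simp [hN], hy, ?_⟩
      · refine List.isChain_append.2 ⟨hl, List.IsChain.singleton _, ?_⟩
        intro a ha b hb
        simp at ha hb
        subst ha; subst hb
        rintro rfl
        exact hx hj
      · rw [wd_append _ [j], mob_mul, wd_single, ← e', e]
    · push Not at h
      refine Or.inl ⟨(wd S (l ++ [k]))⁻¹, ?_, ?_⟩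
      · have := S.group.inv_mem (wd_mem S (l ++ [k]))
        simpa using this
      · rw [e, mob_inv_mob]; exact h

lemma limit_sub (hinf : infty ∈ S.domain) {η : Set RSphere} (hc : IsClosed η)
    (hinv : ∀ γ : SL2C, (γ : PSL2C) ∈ S.group → mobius γ '' η = η)
    (hne : ∀ k, ∃ y ∈ η, y ∉ S.D k) : limitSet S.group ⊆ η := by
  have near : ∀ ε > 0, ∃ N, ∀ (l : List (Lt g)) k, Rd (l ++ [k]) → N ≤ l.length → ∀ x, x ∉ S.D k.swap →
      ∃ y ∈ η, dist (mobius (wd S (l ++ [k])) x) y ≤ ε := by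
    intro ε hε
    obtain ⟨N, hN⟩ := word_shrink hinf ε hε
    refine ⟨N, fun l k hl hn x hx => ?_⟩
    obtain ⟨y, hy, hy'⟩ := hne k.swap
    refine ⟨mobius (wd S (l ++ [k])) y, ?_, hN l k hl hn x y hx hy'⟩
    rw [← hinv _ (wd_mem S (l ++ [k]))]
    exact mem_image_of_mem _ hy
  rintro w ⟨z, hz⟩
  by_contra hw
  by_cases hd : ∃ γ : SL2C, (γ : PSL2C) ∈ S.group ∧ ∀ k, mobius γ z ∉ S.D k
  · obtain ⟨δ, hδ, hx⟩ := hd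
    set x := mobius δ z with hxd
    obtain ⟨ε, hε, hball⟩ := Metric.isOpen_iff.1 hc.isOpen_compl w hw
    obtain ⟨N, hN⟩ := near (ε/2) (by linarith)
    have hfin : (mobiusOrbit S.group z ∩ Metric.ball w (ε/2)).Finite := by
      have hf : ({l : List (Lt g) | l.length ≤ N}).Finite := List.finite_length_le _ _
      refine (hf.image fun l => mobius (wd S l) x).subset ?_
      rintro _ ⟨⟨γ, hγ, rfl⟩, hb⟩
      have hm : ((γ * δ⁻¹ : SL2C) : PSL2C) ∈ S.group := by
        have := S.group.mul_mem hγ (S.group.inv_mem hδ)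
        simpa using this
      obtain ⟨l, hl, el⟩ := exists_rwd hm
      have e : mobius (wd S l) x = mobius γ z := by
        rw [← el, mob_mul, hxd, mob_inv_mob]
      refine ⟨l, ?_, e⟩
      rcases last_cases l with rfl | ⟨m, k, rfl⟩
      · simp
      · by_contra hlen
        simp at hlen
        obtain ⟨y, hy, hd⟩ := hN m k hl (by omega) x (hx _)
        rw [e] at hd
        refine hball (Metric.mem_ball.2 ?_) hy
        have h1 := Metric.mem_ball.1 hb
        have := dist_triangle y (mobius γ z) w
        rw [dist_comm] at hd
        linarith
    have hacc : AccPt w (𝓟 (mobiusOrbit S.group z ∩ Metric.ball w (ε/2))) := by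
      have := hz.nhds_inter (Metric.ball_mem_nhds w (by linarith : 0 < ε/2))
      rwa [inter_comm] at this
    rw [accPt_iff_frequently] at hacc
    have hcl := (hfin.subset sdiff_subset : (_ \ {w} : Set RSphere).Finite).isClosed
    obtain ⟨y, ⟨hy1, hy2⟩, hy3⟩ := (hacc.and_eventually (hcl.isOpen_compl.mem_nhds (show w ∈ _ from fun h => h.2 rfl))).exists
    exact hy3 ⟨hy2, hy1⟩
  · have hzη : z ∈ η := by
      rw [← hc.closure_eq, Metric.mem_closure_iff]
      intro ε hε
      obtain ⟨N, hN⟩ := near (ε/2) (by linarith)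
      rcases descent hinf z N with h | ⟨l, k, x, hl, hn, hx, e⟩
      · exact absurd h hd
      · obtain ⟨y, hy, h⟩ := hN l k hl hn.ge x hx
        exact ⟨y, hy, by rw [e]; linarith⟩
    have hsub : mobiusOrbit S.group z ⊆ η := by
      rintro _ ⟨γ, hγ, rfl⟩
      rw [← hinv γ hγ]; exact mem_image_of_mem _ hzη
    exact hw (hc.closure_subset_iff.2 hsub (mem_closure_iff_clusterPt.2 hz.clusterPt))

end TQ


namespace TQ

variable {g : ℕ} {S : SchottkyData g}

lemma OB_inv {γ : SL2C} (hγ : (γ : PSL2C) ∈ S.group) {x : RSphere} (hx : x ∈ S.orbitBoundary) :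
    mobius γ x ∈ S.orbitBoundary := by
  rw [SchottkyData.orbitBoundary, mem_iUnion] at hx ⊢
  obtain ⟨⟨δ, hδ⟩, y, hy, rfl⟩ := hx
  exact ⟨⟨γ * δ, by simpa using S.group.mul_mem hγ hδ⟩, y, hy, mob_mul _ _ _⟩

lemma fr_OB {k : Lt g} {x : RSphere} (hx : x ∈ frontier (S.D k)) : x ∈ S.orbitBoundary := by
  rw [SchottkyData.orbitBoundary, mem_iUnion]
  exact ⟨⟨1, by simpa using S.group.one_mem⟩, x, mem_iUnion.2 ⟨k, hx⟩, mob_one _⟩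

lemma cyl_word (hinf : infty ∈ S.domain) {n : ℕ} (E : ZMod n ≃ Lt g) (Y : Cyc n RSphere)
    (hb : ∀ k, Y.b k = E.symm (E k).swap) (hT : ∀ k, Y.T k = mobius (tm S (E k)))
    (hK : ∀ k, Y.K k = closure (S.D (E k))) {M : ℕ} {k : ZMod n} {A : Set RSphere} (h : Y.Cyl M k A) :
    ∃ l j, Rd (l ++ [j]) ∧ l.length + 1 = M ∧ (l ++ [j]).head? = some (E k) ∧
      ∀ x ∈ A, ∃ y, y ∉ S.D j.swap ∧ mobius (wd S (l ++ [j])) y = x := by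
  induction h with
  | one k =>
    refine ⟨[], E k, List.IsChain.singleton _, rfl, rfl, fun x hx => ?_⟩
    rw [hK] at hx
    have e : mobius (tm S (E k)) (mobius (tm S (E k).swap) x) = x := by
      have := tm_tm S (E k).swap x
      rwa [Sum.swap_swap] at this
    refine ⟨mobius (tm S (E k).swap) x, ?_, by rw [List.nil_append, wd_single, e]⟩
    exact (tm_cl hinf (E k) _).1 (by rw [e]; exact hx)
  | succ N j k A h hj ih =>
    obtain ⟨l, i, hl, hN, hh, hA⟩ := ih
    refine ⟨E k :: l, i, ?_, by simp [hN], rfl, ?_⟩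
    · refine List.isChain_cons.2 ⟨?_, hl⟩
      intro b hb'
      replace hb' : b ∈ (l ++ [i]).head? := hb'
      rw [hh] at hb'
      simp at hb'
      subst hb'
      intro h'
      apply hj
      rw [hb, ← h', E.symm_apply_apply]
    · rintro _ ⟨x, hx, rfl⟩
      obtain ⟨y, hy, rfl⟩ := hA x hx
      refine ⟨y, hy, ?_⟩
      rw [hT]
      exact mob_mul _ _ _

lemma cyc_shrink (hinf : infty ∈ S.domain) {n : ℕ} (E : ZMod n ≃ Lt g) (Y : Cyc n RSphere)
    (hb : ∀ k, Y.b k = E.symm (E k).swap) (hT : ∀ k, Y.T k = mobius (tm S (E k)))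
    (hK : ∀ k, Y.K k = closure (S.D (E k))) : Y.Shrink := by
  intro ε hε
  obtain ⟨N, hN⟩ := word_shrink hinf ε hε
  refine ⟨N + 1, fun M hM k A hA x hx y hy => ?_⟩
  obtain ⟨l, j, hl, hlen, -, h⟩ := cyl_word hinf E Y hb hT hK hA
  obtain ⟨x', hx', rfl⟩ := h x hx
  obtain ⟨y', hy', rfl⟩ := h y hy
  exact hN l j hl (by omega) x' y' hx' hy'

theorem exists_curve (hinf : infty ∈ S.domain) {x1 : RSphere} (Q : Pts S x1) (hg : 1 ≤ g) :
    ∃ η, IsQuasiCircle S.group η ∧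
      (∀ x ∈ η ∩ S.orbitBoundary, MeetsOrthogonallyAt η S.orbitBoundary x) ∧
      x1 ∉ η ∩ S.orbitBoundary ∧ (η ∩ S.orbitBoundary).Countable := by
  obtain ⟨n, E, Y, hb, hT, hK, hp, hq, hev⟩ := exists_cyc hinf Q hg
  have hS := cyc_shrink hinf E Y hb hT hK
  obtain ⟨G, hG, hGT⟩ := Y.exists_fixed hS
  have hn0 : (n : ℝ) ≠ 0 := by
    have := Y.hn
    exact_mod_cast (by omega : n ≠ 0)
  have hloop : Loop (fun t => G (n * t)) := by
    refine ⟨hG.cont.comp (continuous_const.mul continuous_id), fun t => ?_, fun s t h => ?_⟩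
    · show G (n * (t + 1)) = _
      rw [mul_add, mul_one, hG.per]
    · obtain ⟨a, ha⟩ := Cyc.G_inj hG hGT h
      exact ⟨a, mul_left_cancel₀ hn0 (by rw [ha]; ring)⟩
  have hrange : range (fun t => G (n * t)) = range G := by
    ext x; constructor
    · rintro ⟨t, rfl⟩; exact ⟨_, rfl⟩
    · rintro ⟨t, rfl⟩; exact ⟨t / n, by show G (n * (t / n)) = _; rw [mul_div_cancel₀ _ hn0]⟩
  set η := range G with hη
  have hinv : ∀ γ : SL2C, (γ : PSL2C) ∈ S.group → mobius γ '' η = η := by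
    intro γ hγ
    refine inv_of_tm S (fun k => ?_) hγ
    have := Cyc.T_range hG hGT (E.symm k)
    rwa [hT, E.apply_symm_apply] at this
  have hmem : ∀ (γ : SL2C), (γ : PSL2C) ∈ S.group → ∀ x ∈ η, mobius γ x ∈ η := by
    intro γ hγ x hx
    rw [← hinv γ hγ]; exact mem_image_of_mem _ hx
  have hginv : ∀ {γ : SL2C}, (γ : PSL2C) ∈ S.group → ((γ⁻¹ : SL2C) : PSL2C) ∈ S.group := by
    intro γ h
    have := S.group.inv_mem h
    simpa using this
  have hcl : IsClosed η := (Cyc.isCompact_range hG).isClosed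
  have heη : ∀ j, Y.e j '' Icc 0 1 ⊆ η := by
    rintro j _ ⟨s, hs, rfl⟩
    refine ⟨(Cyc.lft j : ℤ) + s / 2, ?_⟩
    rw [hG.E _ (s/2) ⟨by linarith [hs.1], by linarith [hs.2]⟩, Cyc.cast_lft _ Y.hn]
    congr 1; ring
  have hPη : ∀ k b, ofC (Q.P k b) ∈ η := by
    intro k b
    cases b
    · have h := hG.p (Cyc.lft (E.symm k) - 1)
      have e : ((Cyc.lft (E.symm k) - 1 + 1 : ℤ) : ZMod n) = E.symm k := by
        rw [sub_add_cancel, Cyc.cast_lft _ Y.hn]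
      rw [e, hp, E.apply_symm_apply] at h
      exact ⟨_, h⟩
    · have h := hG.q (Cyc.lft (E.symm k))
      rw [Cyc.cast_lft _ Y.hn, hq, E.apply_symm_apply] at h
      exact ⟨_, h⟩
  have hlim : limitSet S.group ⊆ η := by
    refine limit_sub hinf hcl hinv fun k => ⟨_, hPη k false, fr_notMem (Q.fr k false) k⟩
  have hform : ∀ x ∈ η ∩ S.orbitBoundary, ∃ γ : SL2C, (γ : PSL2C) ∈ S.group ∧ ∃ k b,
      x = mobius γ (ofC (Q.P k b)) := by
    rintro x ⟨hx, hx'⟩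
    rw [SchottkyData.orbitBoundary, mem_iUnion] at hx'
    obtain ⟨⟨γ, hγ⟩, y, hy, rfl⟩ := hx'
    obtain ⟨k, hy⟩ := mem_iUnion.1 hy
    have hyη : y ∈ η := by
      have := hmem _ (hginv hγ) _ hx
      rwa [mob_inv_mob] at this
    refine ⟨γ, hγ, k, ?_⟩
    have h := Cyc.disc_mem hG hGT (k := E.symm k) hyη
      (by rw [hK, E.apply_symm_apply]; exact frontier_subset_closure hy)
      (by
        rw [hb, hK, hT, E.apply_symm_apply, E.apply_symm_apply]
        refine frontier_subset_closure ?_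
        rw [← tm_fr (S := S) k.swap, Sum.swap_swap]
        exact mem_image_of_mem _ hy)
    rw [hp, hq, E.apply_symm_apply] at h
    rcases h with h | h
    · exact ⟨false, by rw [h]⟩
    · exact ⟨true, by rw [h]⟩
  -- orthogonality
  have hnear : ∀ k b, ∀ᶠ X in 𝓝 (ofC (Q.P k b)), X ∈ ofC '' Q.C k b → X ∈ η := by
    intro k b
    have h := hev (E.symm k) b
    rw [E.apply_symm_apply] at h
    filter_upwards [h] with X hX hC
    obtain ⟨j, hj⟩ := hX hC
    exact heη j hj
  have ho1 : ∀ i b, MeetsOrthogonallyAt η S.orbitBoundary (ofC (Q.P (Sum.inl i) b)) := by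
    intro i b
    have hd : ∀ v : ℂ, HasDerivAt (fun t : ℝ => Q.P (Sum.inl i) b + t * v) v 0 := by
      intro v
      have := ((Complex.ofRealCLM.hasDerivAt (x := (0:ℝ))).mul_const v).const_add (Q.P (Sum.inl i) b)
      simpa using this
    refine ⟨_, Q.ν i, Complex.I * Q.ν i, _, _, rfl, Q.νne i, mul_ne_zero Complex.I_ne_zero (Q.νne i),
      hd _, hd _, by simp, by simp, ?_, ?_, ?_⟩
    · have hc : Tendsto (fun t : ℝ => ofC (Q.P (Sum.inl i) b + t * Q.ν i)) (𝓝 0)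
          (𝓝 (ofC (Q.P (Sum.inl i) b))) := by
        have := (cont_ofC.continuousAt.comp (hd (Q.ν i)).continuousAt).tendsto
        simpa [Function.comp_def] using this
      have hc2 : Tendsto (fun t : ℝ => mobius (tm S (Sum.inr i)) (ofC (Q.P (Sum.inl i) b + t * Q.ν i))) (𝓝 0)
          (𝓝 (ofC (Q.P (Sum.inr i) (!b)))) := by
        have := ((mob_cont (tm S (Sum.inr i))).tendsto _).comp hc
        have e := Q.T (Sum.inr i) b
        rw [Sum.swap_inr] at e
        rw [e] at this
        exact this
      filter_upwards [Q.orth1 i b, hc.eventually (hnear _ _), hc2.eventually (hnear _ _)] with t h1 h2 h3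
      rcases h1 with h1 | h1
      · exact h2 h1
      · have := hmem _ (hginv (tm_mem S (Sum.inr i))) _ (h3 h1)
        rwa [mob_inv_mob] at this
    · exact (Q.orth2 i b).mono fun t ht => fr_OB ht
    · have : Q.ν i * (starRingEnd ℂ) (Complex.I * Q.ν i) = -Complex.I * (Complex.normSq (Q.ν i) : ℂ) := by
        rw [map_mul, Complex.conj_I, ← Complex.mul_conj]; ring
      rw [this]; simp
  have htr : ∀ (γ : SL2C), (γ : PSL2C) ∈ S.group → ∀ x, x ∈ S.orbitBoundary →
      MeetsOrthogonallyAt η S.orbitBoundary x → MeetsOrthogonallyAt η S.orbitBoundary (mobius γ x) := by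
    intro γ hγ x hx h
    refine orth_mono (orth_mob γ h fun e => ?_) (hinv γ hγ).subset ?_
    · exact inf_OB hinf (e ▸ OB_inv hγ hx)
    · rintro _ ⟨y, hy, rfl⟩; exact OB_inv hγ hy
  have ho : ∀ k b, MeetsOrthogonallyAt η S.orbitBoundary (ofC (Q.P k b)) := by
    rintro (i | i) b
    · exact ho1 i b
    · have e := Q.T (Sum.inr i) (!b)
      rw [Sum.swap_inr, Bool.not_not] at e
      rw [← e]
      exact htr _ (tm_mem S _) _ (fr_OB (Q.fr _ _)) (ho1 i _)
  refine ⟨η, ⟨hrange ▸ loop_jordan hloop, hlim, hinv⟩, ?_, ?_, ?_⟩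
  · intro x hx
    obtain ⟨γ, hγ, k, b, rfl⟩ := hform x hx
    exact htr γ hγ _ (fr_OB (Q.fr k b)) (ho k b)
  · intro hx
    obtain ⟨γ, hγ, k, b, e⟩ := hform _ hx
    exact Q.orb k b γ hγ e.symm
  · have hc : (⋃ k, ⋃ b, mobiusOrbit S.group (ofC (Q.P k b))).Countable :=
      countable_iUnion fun k => countable_iUnion fun b => orbit_countable S _
    refine hc.mono fun x hx => ?_
    obtain ⟨γ, hγ, k, b, rfl⟩ := hform x hx
    exact mem_iUnion.2 ⟨k, mem_iUnion.2 ⟨b, γ, hγ, rfl⟩⟩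

theorem main_inf (S : SchottkyData g) (hinf : infty ∈ S.domain) (hg : 1 ≤ g) (x1 : RSphere) :
    ∃ (S' : SchottkyData g) (η : Set RSphere), S'.group = S.group ∧ IsQuasiCircle S.group η ∧
      (∀ x ∈ η ∩ S'.orbitBoundary, MeetsOrthogonallyAt η S'.orbitBoundary x) ∧
      x1 ∉ η ∩ S'.orbitBoundary ∧ (η ∩ S'.orbitBoundary).Countable := by
  obtain ⟨S', hgen, hinf', hS'⟩ := refine_data S hinf
  obtain ⟨Q⟩ := exists_pts hinf' x1 hS'
  have hgr : S'.group = S.group := by simp only [SchottkyData.group, hgen]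
  obtain ⟨η, h1, h2⟩ := exists_curve hinf' Q hg
  exact ⟨S', η, hgr, hgr ▸ h1, h2⟩

end TQ


namespace TQ

variable {g : ℕ}

lemma img_cl (φ : SL2C) (A : Set RSphere) : closure (mobius φ '' A) = mobius φ '' closure A :=
  ((mobH φ).image_closure A).symm

lemma img_fr (φ : SL2C) (A : Set RSphere) : frontier (mobius φ '' A) = mobius φ '' frontier A :=
  ((mobH φ).image_frontier A).symm

def cj (S : SchottkyData g) (φ : SL2C) : SchottkyData g where
  gen i := φ * S.gen i * φ⁻¹
  D k := mobius φ '' S.D k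
  isOpen k := (mobH φ).isOpenMap _ (S.isOpen k)
  nonempty k := (S.nonempty k).image _
  jordan k := by
    rw [img_fr]; exact jordan_mob (S.jordan k) φ
  disjointClosures i j h := by
    rw [img_cl, img_cl, ← image_inter (mob_inj φ), S.disjointClosures i j h, image_empty]
  lox i := by
    intro t ht
    apply S.lox i t
    rw [← ht]
    have : (φ * S.gen i * φ⁻¹).1 = φ.1 * ((S.gen i).1 * (φ⁻¹).1) := by
      rw [mul_assoc]; rfl
    rw [this, Matrix.trace_mul_comm, mul_assoc]
    have h2 : (φ⁻¹).1 * φ.1 = 1 := by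
      have := congrArg Subtype.val (inv_mul_cancel φ)
      exact this
    rw [h2, mul_one]
  maps_boundary i := by
    rw [img_fr, img_fr, ← S.maps_boundary i, image_image, image_image]
    refine image_congr fun x _ => ?_
    rw [mob_mul, mob_mul, mob_inv_mob]
  maps_off i := by
    have e : mobius (φ * S.gen i * φ⁻¹) '' (mobius φ '' S.D (Sum.inl i)) =
        mobius φ '' (mobius (S.gen i) '' S.D (Sum.inl i)) := by
      rw [image_image, image_image]
      refine image_congr fun x _ => ?_
      rw [mob_mul, mob_mul, mob_inv_mob]
    rw [e, ← image_inter (mob_inj φ), S.maps_off i, image_empty]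

lemma cj_group (S : SchottkyData g) (φ : SL2C) :
    (cj S φ).group = S.group.map (MulAut.conj (φ : PSL2C)).toMonoidHom := by
  rw [SchottkyData.group, SchottkyData.group, MonoidHom.map_closure, ← range_comp]
  rfl

lemma cj_mem (S : SchottkyData g) (φ γ : SL2C) (h : (γ : PSL2C) ∈ S.group) :
    ((φ * γ * φ⁻¹ : SL2C) : PSL2C) ∈ (cj S φ).group := by
  rw [cj_group]
  exact ⟨γ, h, rfl⟩

lemma cj_mem' (S : SchottkyData g) (φ γ : SL2C) (h : (γ : PSL2C) ∈ (cj S φ).group) :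
    ((φ⁻¹ * γ * φ : SL2C) : PSL2C) ∈ S.group := by
  rw [cj_group] at h
  obtain ⟨δ, hδ, e⟩ := h
  have e' : (φ : PSL2C) * δ * (φ : PSL2C)⁻¹ = γ := e
  have : ((φ⁻¹ * γ * φ : SL2C) : PSL2C) = (φ : PSL2C)⁻¹ * γ * φ := rfl
  rw [this, ← e']
  have : (φ : PSL2C)⁻¹ * ((φ : PSL2C) * δ * (φ : PSL2C)⁻¹) * φ = δ := by group
  rw [this]; exact hδ

lemma cj_OB (S : SchottkyData g) (φ : SL2C) : (cj S φ).orbitBoundary = mobius φ '' S.orbitBoundary := by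
  ext x
  simp only [SchottkyData.orbitBoundary]
  constructor
  · intro h
    obtain ⟨⟨γ, hγ⟩, y, hy, rfl⟩ := mem_iUnion.1 h
    obtain ⟨k, hy⟩ := mem_iUnion.1 hy
    obtain ⟨z, hz, rfl⟩ : y ∈ mobius φ '' frontier (S.D k) := by rw [← img_fr]; exact hy
    refine ⟨mobius (φ⁻¹ * γ * φ) z, mem_iUnion.2 ⟨⟨_, cj_mem' S φ γ hγ⟩, z, mem_iUnion.2 ⟨k, hz⟩, rfl⟩, ?_⟩
    rw [mob_mul, mob_mul, mob_mob_inv]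
  · rintro ⟨y, h, rfl⟩
    obtain ⟨⟨γ, hγ⟩, z, hz, rfl⟩ := mem_iUnion.1 h
    obtain ⟨k, hz⟩ := mem_iUnion.1 hz
    refine mem_iUnion.2 ⟨⟨_, cj_mem S φ γ hγ⟩, mobius φ z, mem_iUnion.2 ⟨k, ?_⟩, ?_⟩
    · show _ ∈ frontier (mobius φ '' S.D k)
      rw [img_fr]; exact mem_image_of_mem _ hz
    · show mobius (φ * γ * φ⁻¹) (mobius φ z) = _
      rw [mob_mul, mob_mul, mob_inv_mob]

lemma cj_dom (S : SchottkyData g) (φ : SL2C) {x : RSphere} (hx : x ∈ S.domain) :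
    mobius φ x ∈ (cj S φ).domain := by
  intro h
  obtain ⟨k, hk⟩ := mem_iUnion.1 h
  have hk' : mobius φ x ∈ closure (mobius φ '' S.D k) := hk
  rw [img_cl] at hk'
  obtain ⟨y, hy, e⟩ := hk'
  exact hx (mem_iUnion.2 ⟨k, mob_inj φ e ▸ hy⟩)

lemma to_inf (x : RSphere) : ∃ φ : SL2C, mobius φ x = infty := by
  rcases rs_cases x with rfl | ⟨z, rfl⟩
  · exact ⟨1, mob_one _⟩
  · refine ⟨⟨!![0, -1; 1, -z], by simp [Matrix.det_fin_two]⟩, mob_pole _ ?_⟩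
    simp

lemma dom_nonempty (S : SchottkyData g) (hg : 1 ≤ g) : S.domain.Nonempty := by
  rw [nonempty_iff_ne_empty]
  intro h
  have hu : (⋃ k, closure (S.D k)) = univ := by
    rw [SchottkyData.domain, compl_empty_iff] at h; exact h
  let i : Fin g := ⟨0, hg⟩
  have hco : (closure (S.D (Sum.inl i)))ᶜ = ⋃ k : {k : Lt g // k ≠ Sum.inl i}, closure (S.D k.1) := by
    ext x
    constructor
    · intro hx
      obtain ⟨k, hk⟩ := mem_iUnion.1 (hu ▸ mem_univ x : x ∈ ⋃ k, closure (S.D k))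
      exact mem_iUnion.2 ⟨⟨k, fun e => hx (e ▸ hk)⟩, hk⟩
    · intro hx hx'
      obtain ⟨⟨k, hk⟩, hxk⟩ := mem_iUnion.1 hx
      exact hk (cl_disj hxk hx')
  have hclopen : IsClopen (closure (S.D (Sum.inl i))) := by
    refine ⟨isClosed_closure, ?_⟩
    rw [← isClosed_compl_iff, hco]
    exact isClosed_iUnion_of_finite fun _ => isClosed_closure
  have huniv := hclopen.eq_univ (S.nonempty _).closure
  obtain ⟨x, hx⟩ := S.nonempty (Sum.inr i)
  have := cl_disj (S := S) (k := Sum.inr i) (j := Sum.inl i) (subset_closure hx) (huniv ▸ mem_univ x)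
  simp at this

lemma no_arc {B : Set RSphere} (hB : B.Countable) :
    ¬∃ (A : Set RSphere) (p q : RSphere), p ≠ q ∧ IsArc A p q ∧ A ⊆ B := by
  rintro ⟨A, p, q, -, ⟨f, hf, hinj, -, -, rfl⟩, hA⟩
  have hc : (Icc (0:ℝ) 1).Countable := countable_of_injective_of_countable_image hinj (hB.mono hA)
  obtain ⟨s, hs, hs'⟩ := pick hc (zero_lt_one (α := ℝ))
  exact hs' ⟨hs.1.le, hs.2.le⟩

lemma case_zero (S : SchottkyData 0) : ∃ η, IsTransverseQC S.group η := by
  have hid : ∀ γ : SL2C, (γ : PSL2C) ∈ S.group → ∀ x, mobius γ x = x := by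
    intro γ hγ x
    obtain ⟨l, hl⟩ := exists_wd S hγ
    rw [hl]
    rcases l with _ | ⟨k, l⟩
    · exact mob_one x
    · rcases k with k | k <;> exact k.elim0
  have hOB : S.orbitBoundary = ∅ := by
    rw [eq_empty_iff_forall_notMem]
    intro x h
    obtain ⟨_, y, hy, -⟩ := mem_iUnion.1 h
    obtain ⟨k, -⟩ := mem_iUnion.1 hy
    rcases k with k | k <;> exact k.elim0
  refine ⟨ofC '' unitCircle, ⟨⟨ofC, cont_ofC.continuousOn, ofC_inj.injOn, rfl⟩, ?_, ?_⟩, 0, S, rfl, ?_, ?_⟩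
  · rintro w ⟨z, hz⟩
    refine absurd ((finite_singleton z).subset ?_) (Set.Infinite.of_accPt hz)
    rintro _ ⟨γ, hγ, rfl⟩
    exact hid γ hγ z
  · intro γ hγ
    have : mobius γ = id := funext (hid γ hγ)
    rw [this, image_id]
  · intro x hx
    rw [hOB] at hx; exact hx.2.elim
  · rw [hOB]; exact no_arc (by simp)

theorem main_pos (S : SchottkyData g) (hg : 1 ≤ g) : ∃ η, IsTransverseQC S.group η := by
  obtain ⟨x0, hx0⟩ := dom_nonempty S hg
  obtain ⟨φ, hφ⟩ := to_inf x0
  obtain ⟨S', η, hgr, ⟨hJ, hL, hI⟩, ho, hx1, hc⟩ :=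
    main_inf (cj S φ) (hφ ▸ cj_dom S φ hx0) hg (mobius φ infty)
  have hOB : (cj S' φ⁻¹).orbitBoundary = mobius φ⁻¹ '' S'.orbitBoundary := cj_OB _ _
  have hintr : (mobius φ⁻¹ '' η) ∩ (cj S' φ⁻¹).orbitBoundary = mobius φ⁻¹ '' (η ∩ S'.orbitBoundary) := by
    rw [hOB, image_inter (mob_inj _)]
  refine ⟨mobius φ⁻¹ '' η, ⟨jordan_mob hJ _, ?_, ?_⟩, g, cj S' φ⁻¹, ?_, ?_, ?_⟩
  · rintro w ⟨z, hz⟩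
    refine ⟨mobius φ w, hL ⟨mobius φ z, ?_⟩, mob_inv_mob _ _⟩
    have := hz.map (mob_cont φ).continuousAt (mob_inj φ)
    rw [map_principal] at this
    refine this.mono (principal_mono.2 ?_)
    rintro _ ⟨_, ⟨γ, hγ, rfl⟩, rfl⟩
    refine ⟨φ * γ * φ⁻¹, cj_mem S φ γ hγ, ?_⟩
    rw [mob_mul, mob_mul, mob_inv_mob]
  · intro γ hγ
    have h := hI _ (cj_mem S φ γ hγ)
    have e : mobius γ '' (mobius φ⁻¹ '' η) = mobius φ⁻¹ '' (mobius (φ * γ * φ⁻¹) '' η) := by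
      rw [image_image, image_image]
      refine image_congr fun x _ => ?_
      rw [mob_mul, mob_mul, mob_inv_mob]
    rw [e, h]
  · rw [cj_group, hgr, cj_group, Subgroup.map_map]
    have : ((MulAut.conj ((φ⁻¹ : SL2C) : PSL2C)).toMonoidHom.comp (MulAut.conj (φ : PSL2C)).toMonoidHom) =
        MonoidHom.id _ := by
      ext x
      show (φ : PSL2C)⁻¹ * ((φ : PSL2C) * x * (φ : PSL2C)⁻¹) * ((φ : PSL2C)⁻¹)⁻¹ = x
      group
    rw [this, Subgroup.map_id]
  · intro x hx
    rw [hintr] at hx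
    obtain ⟨y, hy, rfl⟩ := hx
    rw [hOB]
    refine orth_mob _ (ho y hy) fun e => hx1 ?_
    rw [← e, mob_mob_inv]; exact hy
  · rw [hintr]; exact no_arc (hc.image _)

theorem main_all (Γ : Subgroup PSL2C) (hS : IsSchottky Γ) :
    ∃ η : Set RSphere, IsTransverseQC Γ η := by
  obtain ⟨g, S, rfl, -⟩ := hS
  rcases Nat.eq_zero_or_pos g with rfl | hg
  · exact case_zero S
  · exact main_pos S hg

end TQ


/-- Every Schottky group admits a transverse quasi-circle. -/
theorem exists_transverse_quasicircle
    (Γ : Subgroup PSL2C) (hS : IsSchottky Γ) :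
    ∃ η : Set RSphere, IsTransverseQC Γ η := by
  exact TQ.main_all Γ hS
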